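/- Assume the standing assumptions in dimension n = 3, with u_k → u in L¹(Ω) where u takes only the values ±1 on Ω \ spt(μ) and is locally constant there, and let I be a nonempty compact subset of the open interval (−1,1). Assume additionally that α({x}) = 0 for every x ∈ Ω \ spt(μ) (α has no atoms outside spt(μ)). Then there exist a subsequence (k_j) and a compact set K ⊆ closure(Ω) such that the closures of the level sets u_{k_j}^{-1}(I) converge to K in Hausdorff distance as j → ∞ and K ∩ Ω = spt(μ) ∩ Ω. -/

import Mathlib

open MeasureTheory Filter Metric Set

noncomputable section

abbrev E (n : ℕ) : Type := EuclideanSpace ℝ (Fin n)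

def W (t : ℝ) : ℝ := (t ^ 2 - 1) ^ 2 / 4

def W' (t : ℝ) : ℝ := t ^ 3 - t

def c0 : ℝ := 2 * Real.sqrt 2 / 3

def lap {n : ℕ} (u : E n → ℝ) (x : E n) : ℝ :=
  ∑ i, (fderiv ℝ (fderiv ℝ u) x) (EuclideanSpace.single i 1) (EuclideanSpace.single i 1)

def areaDensity {n : ℕ} (ev : ℝ) (u : E n → ℝ) (x : E n) : ℝ :=
  ev / 2 * ‖fderiv ℝ u x‖ ^ 2 + (1 / ev) * W (u x)

def willDensity {n : ℕ} (ev : ℝ) (u : E n → ℝ) (x : E n) : ℝ :=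
  (ev * lap u x - (1 / ev) * W' (u x)) ^ 2

def Se {n : ℕ} (ev : ℝ) (Ω : Set (E n)) (u : E n → ℝ) : ℝ :=
  (1 / c0) * ∫ x in Ω, areaDensity ev u x

def We {n : ℕ} (ev : ℝ) (Ω : Set (E n)) (u : E n → ℝ) : ℝ :=
  (1 / (c0 * ev)) * ∫ x in Ω, willDensity ev u x

def mue {n : ℕ} (ev : ℝ) (Ω : Set (E n)) (u : E n → ℝ) (U : Set (E n)) : ℝ :=
  (1 / c0) * ∫ x in U ∩ Ω, areaDensity ev u x

def ale {n : ℕ} (ev : ℝ) (Ω : Set (E n)) (u : E n → ℝ) (U : Set (E n)) : ℝ :=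
  (1 / (c0 * ev)) * ∫ x in U ∩ Ω, willDensity ev u x

def xiPlus {n : ℕ} (ev : ℝ) (Ω : Set (E n)) (u : E n → ℝ) (U : Set (E n)) : ℝ :=
  ∫ x in U ∩ Ω, max (ev / 2 * ‖fderiv ℝ u x‖ ^ 2 - (1 / ev) * W (u x)) 0

def sptM {n : ℕ} (μ : Measure (E n)) : Set (E n) :=
  {x | ∀ r > 0, 0 < μ (ball x r)}

def weakConvA {n : ℕ} (Ω : Set (E n)) (ε : ℕ → ℝ) (u : ℕ → E n → ℝ)
    (μ : Measure (E n)) : Prop :=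
  ∀ φ : BoundedContinuousFunction (E n) ℝ,
    Tendsto (fun k => (1 / c0) * ∫ x in Ω, φ x * areaDensity (ε k) (u k) x) atTop
      (nhds (∫ x, φ x ∂μ))

def weakConvW {n : ℕ} (Ω : Set (E n)) (ε : ℕ → ℝ) (u : ℕ → E n → ℝ)
    (α : Measure (E n)) : Prop :=
  ∀ φ : BoundedContinuousFunction (E n) ℝ,
    Tendsto (fun k => (1 / (c0 * ε k)) * ∫ x in Ω, φ x * willDensity (ε k) (u k) x) atTop
      (nhds (∫ x, φ x ∂α))

/-- The `i`-th partial derivative. -/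
def pd (i : Fin 3) (g : E 3 → ℝ) (x : E 3) : ℝ :=
  fderiv ℝ g x (EuclideanSpace.single i 1)

section PartialDerivatives

variable {f g : E 3 → ℝ} {x : E 3} {i : Fin 3}

lemma pd_add (hf : DifferentiableAt ℝ f x) (hg : DifferentiableAt ℝ g x) :
    pd i (fun y => f y + g y) x = pd i f x + pd i g x := by
  simp [pd, fderiv_fun_add hf hg]

lemma pd_sub (hf : DifferentiableAt ℝ f x) (hg : DifferentiableAt ℝ g x) :
    pd i (fun y => f y - g y) x = pd i f x - pd i g x := by
  simp [pd, fderiv_fun_sub hf hg]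

lemma pd_mul (hf : DifferentiableAt ℝ f x) (hg : DifferentiableAt ℝ g x) :
    pd i (fun y => f y * g y) x = pd i f x * g x + f x * pd i g x := by
  simp [pd, fderiv_fun_mul hf hg]; ring

lemma pd_const (c : ℝ) : pd i (fun _ => c) x = 0 := by
  simp [pd]

lemma pd_const_mul (c : ℝ) (hf : DifferentiableAt ℝ f x) :
    pd i (fun y => c * f y) x = c * pd i f x := by
  rw [pd_mul (differentiableAt_const c) hf, pd_const]; ring

lemma pd_sum {ι : Type*} (s : Finset ι) {F : ι → E 3 → ℝ}
    (hF : ∀ j ∈ s, DifferentiableAt ℝ (F j) x) :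
    pd i (fun y => ∑ j ∈ s, F j y) x = ∑ j ∈ s, pd i (F j) x := by
  simp [pd, fderiv_fun_sum hF]

lemma pd_comp {G : ℝ → ℝ} {G' : ℝ} (hG : HasDerivAt G G' (f x))
    (hf : DifferentiableAt ℝ f x) :
    pd i (fun y => G (f y)) x = G' * pd i f x := by
  have := (hG.comp_hasFDerivAt x hf.hasFDerivAt).fderiv
  simp only [pd]
  rw [show (fun y => G (f y)) = G ∘ f from rfl, this]
  simp

lemma pd_pow (n : ℕ) (hf : DifferentiableAt ℝ f x) :
    pd i (fun y => f y ^ n) x = n * f x ^ (n - 1) * pd i f x :=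
  pd_comp (hasDerivAt_pow n (f x)) hf

lemma pd_coord_sub (z : E 3) (j : Fin 3) :
    pd i (fun y : E 3 => y j - z j) x = if i = j then 1 else 0 := by
  have h : HasFDerivAt (fun y : E 3 => y j - z j)
      (EuclideanSpace.proj j : E 3 →L[ℝ] ℝ) x :=
    ((EuclideanSpace.proj j : E 3 →L[ℝ] ℝ).hasFDerivAt).sub_const (z j)
  simp [pd, h.fderiv, eq_comm]

lemma pd_congr (h : f =ᶠ[nhds x] g) : pd i f x = pd i g x := by
  simp [pd, h.fderiv_eq]

lemma contDiff_pd {n : ℕ∞} (hf : ContDiff ℝ (n + 1) f) : ContDiff ℝ n (pd i f) :=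
  (hf.fderiv_right le_rfl).clm_apply contDiff_const

lemma contDiff_pd_one (hf : ContDiff ℝ 2 f) : ContDiff ℝ 1 (pd i f) :=
  contDiff_pd (n := 1) (by norm_num; exact hf)

lemma continuous_pd (hf : ContDiff ℝ 1 f) : Continuous (pd i f) :=
  (contDiff_pd (n := 0) (by norm_num; exact hf)).continuous

lemma pd_comm (hf : ContDiff ℝ 2 f) (i j : Fin 3) :
    pd i (pd j f) x = pd j (pd i f) x := by
  have hd : DifferentiableAt ℝ (fderiv ℝ f) x :=
    ((hf.fderiv_right (m := 1) (by norm_num)).differentiable (by norm_num)) x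
  have hs : IsSymmSndFDerivAt ℝ f x :=
    hf.contDiffAt.isSymmSndFDerivAt (by simp)
  have key : ∀ a b : Fin 3, pd a (pd b f) x =
      fderiv ℝ (fderiv ℝ f) x (EuclideanSpace.single a 1) (EuclideanSpace.single b 1) := by
    intro a b
    simp only [pd]
    have : HasFDerivAt (fun y => fderiv ℝ f y (EuclideanSpace.single b 1))
      ((fderiv ℝ (fderiv ℝ f) x).flip (EuclideanSpace.single b 1)) x := by
        simpa using hd.hasFDerivAt.clm_apply
          (hasFDerivAt_const (EuclideanSpace.single b (1 : ℝ)) x)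
    change fderiv ℝ (fun y => fderiv ℝ f y (EuclideanSpace.single b 1)) x _ = _
    rw [this.fderiv]; rfl
  rw [key, key]; exact hs _ _

lemma lap_eq_sum_pd (hf : ContDiff ℝ 2 f) : lap f x = ∑ i, pd i (pd i f) x := by
  have hd : DifferentiableAt ℝ (fderiv ℝ f) x :=
    ((hf.fderiv_right (m := 1) (by norm_num)).differentiable (by norm_num)) x
  unfold lap
  refine Finset.sum_congr rfl fun a _ => ?_
  have : HasFDerivAt (fun y => fderiv ℝ f y (EuclideanSpace.single a 1))
      ((fderiv ℝ (fderiv ℝ f) x).flip (EuclideanSpace.single a 1)) x := by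
    simpa using hd.hasFDerivAt.clm_apply
      (hasFDerivAt_const (EuclideanSpace.single a (1 : ℝ)) x)
  change _ = fderiv ℝ (fun y => fderiv ℝ f y (EuclideanSpace.single a 1)) x _
  rw [this.fderiv]; rfl

lemma norm_fderiv_sq : ‖fderiv ℝ f x‖ ^ 2 = ∑ i, pd i f x ^ 2 := by
  set v := (InnerProductSpace.toDual ℝ (E 3)).symm (fderiv ℝ f x)
  have h1 : ‖v‖ = ‖fderiv ℝ f x‖ := LinearIsometryEquiv.norm_map _ _
  rw [← h1, EuclideanSpace.real_norm_sq_eq]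
  refine Finset.sum_congr rfl fun a _ => ?_
  have : pd a f x = inner ℝ v (EuclideanSpace.single a (1 : ℝ)) := by
    simp [v, pd]
  rw [this, EuclideanSpace.inner_single_right]; simp

lemma pd_eq_zero_of_notMem_tsupport (hx : x ∉ tsupport f) : pd i f x = 0 := by
  have : f =ᶠ[nhds x] fun _ => (0 : ℝ) := by
    rw [notMem_tsupport_iff_eventuallyEq] at hx; exact hx
  rw [pd_congr this, pd_const]

lemma hasCompactSupport_pd (hf : HasCompactSupport f) : HasCompactSupport (pd i f) :=
  hf.fderiv_apply ℝ _

lemma integral_pd_eq_zero (hf : ContDiff ℝ 1 f) (hc : HasCompactSupport f) :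
    ∫ x, pd i f x = 0 := by
  have h := integral_mul_fderiv_eq_neg_fderiv_mul_of_integrable (μ := volume) (𝕜 := ℝ)
    (f := fun _ : E 3 => (1 : ℝ)) (g := f) (v := EuclideanSpace.single i 1)
    (by simp) ?_ ?_ (fun _ _ => differentiableAt_const _)
    (fun y _ => hf.differentiable (by norm_num) y)
  · simpa [pd] using h
  · simp only [one_mul]
    exact (continuous_pd (i := i) hf).integrable_of_hasCompactSupport
      (hasCompactSupport_pd hc)
  · simpa using hf.continuous.integrable_of_hasCompactSupport hc

end PartialDerivatives

lemma integrable_of_tsupport {η g : E 3 → ℝ} (hη : HasCompactSupport η) (hg : Continuous g)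
    (h0 : ∀ x ∉ tsupport η, g x = 0) : Integrable g :=
  hg.integrable_of_hasCompactSupport (HasCompactSupport.intro hη h0)

/-- If the divergence of a compactly supported field dominates `a - b`, then `∫ a ≤ ∫ b`. -/
lemma integral_le_of_div {a b : E 3 → ℝ} (F : Fin 3 → E 3 → ℝ)
    (hF : ∀ i, ContDiff ℝ 1 (F i)) (hc : ∀ i, HasCompactSupport (F i))
    (ha : Integrable a) (hb : Integrable b) (h : ∀ x, a x - b x ≤ ∑ i, pd i (F i) x) :
    ∫ x, a x ≤ ∫ x, b x := by
  have hi : ∀ i, Integrable (pd i (F i)) := fun i =>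
    (continuous_pd (hF i)).integrable_of_hasCompactSupport (hasCompactSupport_pd (hc i))
  have h1 : ∫ x, (a x - b x) ≤ ∫ x, ∑ i, pd i (F i) x :=
    integral_mono (ha.sub hb) (integrable_finsetSum _ fun i _ => hi i) h
  rw [integral_sub ha hb, integral_finsetSum _ fun i _ => hi i] at h1
  simp only [fun i => integral_pd_eq_zero (i := i) (hF i) (hc i), Finset.sum_const_zero] at h1
  linarith

/-- A convex `C¹` regularisation of the positive part. -/
def smoothPos (τ t : ℝ) : ℝ := (max t 0) ^ 2 / (max t 0 + τ)

/-- The derivative of `smoothPos`. -/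
def smoothPos' (τ t : ℝ) : ℝ := max t 0 * (max t 0 + 2 * τ) / (max t 0 + τ) ^ 2

section SmoothPos

variable {τ : ℝ}

lemma hasDerivAt_smoothPos (hτ : 0 < τ) (t : ℝ) :
    HasDerivAt (smoothPos τ) (smoothPos' τ t) t := by
  rcases lt_trichotomy t 0 with h | h | h
  · have : smoothPos τ =ᶠ[nhds t] fun _ => 0 := by
      filter_upwards [gt_mem_nhds h] with s hs
      simp [smoothPos, max_eq_right hs.le]
    simpa [smoothPos', max_eq_right h.le] using
      (hasDerivAt_const t (0 : ℝ)).congr_of_eventuallyEq this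
  · subst h
    rw [hasDerivAt_iff_tendsto_slope]
    have hc : Continuous fun s : ℝ => max s 0 / (max s 0 + τ) := by
      refine Continuous.div (by fun_prop) (by fun_prop) fun s => ?_
      have := le_max_right s 0
      positivity
    have h0 := (hc.tendsto 0).mono_left (nhdsWithin_le_nhds (s := {0}ᶜ))
    simp only [max_self, zero_div] at h0
    simp only [smoothPos', max_self, zero_mul, zero_div]
    refine h0.congr' ?_
    filter_upwards [self_mem_nhdsWithin] with s hs
    have hs' : s ≠ 0 := hs
    rcases le_total s 0 with h | h
    · simp [slope_def_field, smoothPos, h]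
    · have : s + τ ≠ 0 := by positivity
      simp [slope_def_field, smoothPos, h]
      field_simp
  · have : smoothPos τ =ᶠ[nhds t] fun s => s ^ 2 / (s + τ) := by
      filter_upwards [lt_mem_nhds h] with s hs
      simp [smoothPos, max_eq_left hs.le]
    have hne : t + τ ≠ 0 := by positivity
    have h1 : HasDerivAt (fun s : ℝ => s ^ 2 / (s + τ))
        (((2 : ℕ) * t ^ (2 - 1) * (t + τ) - t ^ 2 * 1) / (t + τ) ^ 2) t :=
      (hasDerivAt_pow 2 t).div ((hasDerivAt_id t).add_const τ) hne
    have h2 : smoothPos' τ t = ((2 : ℕ) * t ^ (2 - 1) * (t + τ) - t ^ 2 * 1) / (t + τ) ^ 2 := by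
      rw [smoothPos', max_eq_left h.le]
      congr 1
      push_cast; ring
    rw [h2]
    exact h1.congr_of_eventuallyEq this

lemma continuous_smoothPos' (hτ : 0 < τ) : Continuous (smoothPos' τ) := by
  refine Continuous.div (by fun_prop) (by fun_prop) fun s => ?_
  have := le_max_right s 0
  positivity

lemma contDiff_smoothPos (hτ : 0 < τ) : ContDiff ℝ 1 (smoothPos τ) := by
  rw [contDiff_one_iff_deriv]
  refine ⟨fun t => (hasDerivAt_smoothPos hτ t).differentiableAt, ?_⟩
  rw [show deriv (smoothPos τ) = smoothPos' τ from
    funext fun t => (hasDerivAt_smoothPos hτ t).deriv]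
  exact continuous_smoothPos' hτ

lemma smoothPos_nonneg (hτ : 0 < τ) (t : ℝ) : 0 ≤ smoothPos τ t := by
  have := le_max_right t 0
  unfold smoothPos; positivity

lemma smoothPos'_nonneg (hτ : 0 < τ) (t : ℝ) : 0 ≤ smoothPos' τ t := by
  have := le_max_right t 0
  unfold smoothPos'; positivity

lemma smoothPos'_le_one (hτ : 0 < τ) (t : ℝ) : smoothPos' τ t ≤ 1 := by
  have := le_max_right t 0
  unfold smoothPos'
  rw [div_le_one (by positivity)]
  nlinarith [sq_nonneg τ]

lemma smoothPos_le_max (hτ : 0 < τ) (t : ℝ) : smoothPos τ t ≤ max t 0 := by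
  have := le_max_right t 0
  unfold smoothPos
  rw [div_le_iff₀ (by positivity)]
  nlinarith

lemma smoothPos_of_nonpos {t : ℝ} (ht : t ≤ 0) : smoothPos τ t = 0 := by
  simp [smoothPos, ht]

lemma smoothPos_le_deriv_mul (hτ : 0 < τ) (t : ℝ) :
    smoothPos τ t ≤ smoothPos' τ t * max t 0 := by
  have := le_max_right t 0
  unfold smoothPos smoothPos'
  rw [div_mul_eq_mul_div, div_le_div_iff₀ (by positivity) (by positivity)]
  have h : 0 ≤ max t 0 ^ 2 * (max t 0 + τ) * τ := by positivity
  nlinarith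

lemma sub_le_smoothPos (hτ : 0 < τ) (t : ℝ) : max t 0 - τ ≤ smoothPos τ t := by
  have := le_max_right t 0
  unfold smoothPos
  rw [le_div_iff₀ (by positivity)]
  nlinarith

lemma half_le_smoothPos (hτ : 0 < τ) {t : ℝ} (ht : τ ≤ t) : t / 2 ≤ smoothPos τ t := by
  have h0 : 0 ≤ t := hτ.le.trans ht
  unfold smoothPos
  rw [max_eq_left h0, le_div_iff₀ (by positivity)]
  nlinarith

lemma smoothPos_sq_le (hτ : 0 < τ) (t : ℝ) : smoothPos τ t ^ 2 ≤ t * smoothPos τ t := by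
  rcases le_total t 0 with h | h
  · simp [smoothPos_of_nonpos h]
  · have h1 := smoothPos_le_max hτ t
    rw [max_eq_left h] at h1
    nlinarith [smoothPos_nonneg hτ t]

end SmoothPos

/-- Squared length of the gradient. -/
def gsq (g : E 3 → ℝ) (x : E 3) : ℝ := ∑ i, pd i g x ^ 2

/-- Scalar product of two gradients. -/
def gdot (f g : E 3 → ℝ) (x : E 3) : ℝ := ∑ i, pd i f x * pd i g x

/-- The diffuse area density at scale one. -/
def edens (u : E 3 → ℝ) (x : E 3) : ℝ := gsq u x / 2 + W (u x)

/-- The discrepancy density at scale one. -/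
def disc (u : E 3 → ℝ) (x : E 3) : ℝ := gsq u x / 2 - W (u x)

/-- The residual of the Allen–Cahn equation at scale one. -/
def resid (u : E 3 → ℝ) (x : E 3) : ℝ := lap u x - W' (u x)

lemma gsq_nonneg (g : E 3 → ℝ) (x : E 3) : 0 ≤ gsq g x :=
  Finset.sum_nonneg fun _ _ => sq_nonneg _

lemma W_nonneg (t : ℝ) : 0 ≤ W t := by unfold W; positivity

lemma edens_nonneg (u : E 3 → ℝ) (x : E 3) : 0 ≤ edens u x := by
  have := gsq_nonneg u x
  have := W_nonneg (u x)
  unfold edens; positivity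

lemma gdot_sq_le (f g : E 3 → ℝ) (x : E 3) : gdot f g x ^ 2 ≤ gsq f x * gsq g x :=
  Finset.sum_mul_sq_le_sq_mul_sq _ _ _

lemma continuous_gsq {g : E 3 → ℝ} (hg : ContDiff ℝ 1 g) : Continuous (gsq g) :=
  continuous_finsetSum _ fun _ _ => (continuous_pd hg).pow 2

lemma contDiff_gsq {g : E 3 → ℝ} (hg : ContDiff ℝ 2 g) : ContDiff ℝ 1 (gsq g) :=
  ContDiff.sum fun _ _ => (contDiff_pd_one hg).pow 2

lemma continuous_W : Continuous W := by unfold W; fun_prop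

lemma continuous_W' : Continuous W' := by unfold W'; fun_prop

lemma continuous_lap {u : E 3 → ℝ} (hu : ContDiff ℝ 2 u) : Continuous (lap u) := by
  rw [show lap u = fun x => ∑ i, pd i (pd i u) x from funext fun x => lap_eq_sum_pd hu]
  exact continuous_finsetSum _ fun _ _ => continuous_pd (contDiff_pd_one hu)

lemma continuous_resid {u : E 3 → ℝ} (hu : ContDiff ℝ 2 u) : Continuous (resid u) :=
  (continuous_lap hu).sub (continuous_W'.comp hu.continuous)

lemma continuous_edens {u : E 3 → ℝ} (hu : ContDiff ℝ 1 u) : Continuous (edens u) :=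
  ((continuous_gsq hu).div_const 2).add (continuous_W.comp hu.continuous)

lemma continuous_disc {u : E 3 → ℝ} (hu : ContDiff ℝ 1 u) : Continuous (disc u) :=
  ((continuous_gsq hu).div_const 2).sub (continuous_W.comp hu.continuous)

lemma gsq_eq_zero_of_notMem_tsupport {η : E 3 → ℝ} {x : E 3} (hx : x ∉ tsupport η) :
    gsq η x = 0 := by
  simp [gsq, pd_eq_zero_of_notMem_tsupport hx]

lemma integrable_mul_sq {η : E 3 → ℝ} (hη : ContDiff ℝ 1 η) (hc : HasCompactSupport η)
    {g : E 3 → ℝ} (hg : Continuous g) :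
    Integrable fun x => g x * η x ^ 2 :=
  integrable_of_tsupport hc (hg.mul (hη.continuous.pow 2)) fun x hx => by
    simp [image_eq_zero_of_notMem_tsupport hx]

lemma integrable_mul_gsq {η : E 3 → ℝ} (hη : ContDiff ℝ 1 η) (hc : HasCompactSupport η)
    {g : E 3 → ℝ} (hg : Continuous g) :
    Integrable fun x => g x * gsq η x :=
  integrable_of_tsupport hc (hg.mul (continuous_gsq hη)) fun x hx => by
    simp [gsq_eq_zero_of_notMem_tsupport hx]

/-- Testing `Δu = W'(u) + f` with `G(u) ζ`. -/
lemma integral_le_of_test {u ζ : E 3 → ℝ} (hu : ContDiff ℝ 2 u) (hζ : ContDiff ℝ 1 ζ)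
    (hc : HasCompactSupport ζ) {G G' : ℝ → ℝ} (hG : ∀ t, HasDerivAt G (G' t) t)
    (hG' : Continuous G') {a b : E 3 → ℝ}
    (ha : Integrable a) (hb : Integrable b)
    (h : ∀ x, a x - b x ≤ G' (u x) * gsq u x * ζ x +
      G (u x) * (W' (u x) + resid u x) * ζ x + G (u x) * gdot u ζ x) :
    ∫ x, a x ≤ ∫ x, b x := by
  have hu1 : ContDiff ℝ 1 u := hu.of_le (by norm_num)
  have hG1 : ContDiff ℝ 1 G := contDiff_one_iff_deriv.2
    ⟨fun t => (hG t).differentiableAt, by rwa [show deriv G = G' from funext fun t => (hG t).deriv]⟩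
  have hGu : ContDiff ℝ 1 fun x => G (u x) := hG1.comp hu1
  refine integral_le_of_div (fun i x => G (u x) * ζ x * pd i u x)
    (fun i => (hGu.mul hζ).mul (contDiff_pd_one hu))
    (fun i => (hc.mul_left (f := fun x => G (u x))).mul_right) ha hb fun x => (h x).trans_eq ?_
  have hd : ∀ i, pd i (fun x => G (u x) * ζ x * pd i u x) x =
      G' (u x) * ζ x * pd i u x ^ 2 + G (u x) * ζ x * pd i (pd i u) x
        + G (u x) * (pd i u x * pd i ζ x) := by
    intro i
    have d1 : DifferentiableAt ℝ (fun x => G (u x)) x := hGu.differentiable (by norm_num) x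
    have d2 : DifferentiableAt ℝ ζ x := hζ.differentiable (by norm_num) x
    rw [pd_mul (d1.fun_mul d2) ((contDiff_pd_one hu).differentiable (by norm_num) x), pd_mul d1 d2,
      pd_comp (hG _)
        (hu1.differentiable (by norm_num) x)]
    ring
  simp only [hd, resid, lap_eq_sum_pd hu, gsq, gdot, Fin.sum_univ_three]
  ring

lemma continuous_smoothPos {τ : ℝ} (hτ : 0 < τ) : Continuous (smoothPos τ) :=
  (contDiff_smoothPos hτ).continuous

lemma pd_sq {η : E 3 → ℝ} (hη : ContDiff ℝ 1 η) (i : Fin 3) (x : E 3) :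
    pd i (fun y => η y ^ 2) x = 2 * η x * pd i η x := by
  rw [pd_pow 2 (hη.differentiable (by norm_num) x)]; norm_num

lemma gdot_sq_right {u η : E 3 → ℝ} (hη : ContDiff ℝ 1 η) (x : E 3) :
    gdot u (fun y => η y ^ 2) x = 2 * η x * gdot u η x := by
  simp only [gdot, pd_sq hη, Finset.mul_sum]
  exact Finset.sum_congr rfl fun _ _ => by ring

lemma hasCompactSupport_sq {η : E 3 → ℝ} (hc : HasCompactSupport η) :
    HasCompactSupport fun x => η x ^ 2 :=
  hc.comp_left (g := fun t : ℝ => t ^ 2) (by norm_num)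

/-- Control of the values of `u` outside the wells. -/
lemma integral_outside_le {u η : E 3 → ℝ} (hu : ContDiff ℝ 2 u) (hη : ContDiff ℝ 1 η)
    (hc : HasCompactSupport η) {τ : ℝ} (hτ : 0 < τ) :
    ∫ x, u x ^ 2 * smoothPos τ (u x ^ 2 - 1) ^ 2 * η x ^ 2 ≤
      2 * ∫ x, resid u x ^ 2 * η x ^ 2 + 4 * (gsq u x * gsq η x) := by
  have hu1 : ContDiff ℝ 1 u := hu.of_le (by norm_num)
  have cu := hu.continuous
  have i1 : Integrable fun x => resid u x ^ 2 * η x ^ 2 :=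
    integrable_mul_sq hη hc ((continuous_resid hu).pow 2)
  have i2 : Integrable fun x => gsq u x * gsq η x := integrable_mul_gsq hη hc (continuous_gsq hu1)
  have i3 : Integrable fun x => u x ^ 2 * smoothPos τ (u x ^ 2 - 1) ^ 2 * η x ^ 2 :=
    integrable_mul_sq hη hc (g := fun x => u x ^ 2 * smoothPos τ (u x ^ 2 - 1) ^ 2)
      ((cu.pow 2).mul (((continuous_smoothPos hτ).comp ((cu.pow 2).sub continuous_const)).pow 2))
  have hGd : ∀ t : ℝ, HasDerivAt (fun t : ℝ => t * smoothPos τ (t ^ 2 - 1))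
      (smoothPos τ (t ^ 2 - 1) + t * (smoothPos' τ (t ^ 2 - 1) * (2 * t))) t := by
    intro t
    have h1 : HasDerivAt (fun t : ℝ => t ^ 2 - 1) (2 * t) t := by
      simpa using (hasDerivAt_pow 2 t).sub_const 1
    simpa using (hasDerivAt_id t).fun_mul ((hasDerivAt_smoothPos hτ (t ^ 2 - 1)).comp t h1)
  have hG : Continuous fun t : ℝ =>
      smoothPos τ (t ^ 2 - 1) + t * (smoothPos' τ (t ^ 2 - 1) * (2 * t)) := by
    have := continuous_smoothPos hτ
    have := continuous_smoothPos' hτ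
    fun_prop
  rw [← integral_const_mul]
  refine integral_le_of_test hu (hη.pow 2) (hasCompactSupport_sq hc)
    (fun t => (hGd t).const_mul 2) (continuous_const.mul hG) i3
    ((i1.add (i2.const_mul 4)).const_mul 2) fun x => ?_
  have hcs := gdot_sq_le u η x
  have h0 := smoothPos_nonneg hτ (u x ^ 2 - 1)
  have h1 := smoothPos'_nonneg hτ (u x ^ 2 - 1)
  have h2 := smoothPos_sq_le hτ (u x ^ 2 - 1)
  have h3 := gsq_nonneg u x
  rw [gdot_sq_right hη]
  simp only [W']
  generalize smoothPos τ (u x ^ 2 - 1) = h at *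
  generalize smoothPos' τ (u x ^ 2 - 1) = h' at *
  generalize gsq u x = q at *
  generalize gdot u η x = d at *
  generalize gsq η x = g at *
  generalize η x = e at *
  generalize resid u x = f at *
  generalize u x = v at *
  have k1 : 0 ≤ (h + v * (h' * (2 * v))) * q * e ^ 2 := by
    have : v * (h' * (2 * v)) = 2 * h' * v ^ 2 := by ring
    rw [this]; positivity
  have k2 : 0 ≤ (v ^ 2 * e ^ 2) * ((v ^ 2 - 1) * h - h ^ 2) :=
    mul_nonneg (by positivity) (by linarith)
  nlinarith [sq_nonneg (v * h * e + 2 * f * e), sq_nonneg (v * h * e + 4 * d)]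

lemma sqrt_sq_add_pos {σ : ℝ} (hσ : 0 < σ) (t : ℝ) : 0 < √(t ^ 2 + σ ^ 2) :=
  Real.sqrt_pos.2 (by positivity)

lemma hasDerivAt_div_sqrt {σ : ℝ} (hσ : 0 < σ) (t : ℝ) :
    HasDerivAt (fun t : ℝ => t / √(t ^ 2 + σ ^ 2)) (σ ^ 2 / √(t ^ 2 + σ ^ 2) ^ 3) t := by
  have hp := sqrt_sq_add_pos hσ t
  have h1 : HasDerivAt (fun t : ℝ => t ^ 2 + σ ^ 2) (2 * t) t := by
    simpa using (hasDerivAt_pow 2 t).add_const (σ ^ 2)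
  have h2 := (hasDerivAt_id t).fun_div (h1.sqrt (by positivity)) hp.ne'
  have hs : √(t ^ 2 + σ ^ 2) ^ 2 = t ^ 2 + σ ^ 2 := Real.sq_sqrt (by positivity)
  have h3 : σ ^ 2 / √(t ^ 2 + σ ^ 2) ^ 3 = (1 * √(t ^ 2 + σ ^ 2) -
      id t * (2 * t / (2 * √(t ^ 2 + σ ^ 2)))) / √(t ^ 2 + σ ^ 2) ^ 2 := by
    simp only [id]
    field_simp
    rw [hs]; ring
  rw [h3]
  exact h2

/-- The gradient energy is not concentrated where `u² - 1` is small compared to `σ`. -/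
lemma integral_transition_le {u η : E 3 → ℝ} (hu : ContDiff ℝ 2 u) (hη : ContDiff ℝ 1 η)
    (hc : HasCompactSupport η) {σ : ℝ} (hσ : 0 < σ) :
    ∫ x, gsq u x * (σ / √((u x ^ 2 - 1) ^ 2 + σ ^ 2)) ^ 3 * η x ^ 2 ≤
      ∫ x, (3 / 2 * (σ * (gsq u x * η x ^ 2)) + 1 / 4 * (resid u x ^ 2 * η x ^ 2)
        + gsq u x * gsq η x) := by
  have hu1 : ContDiff ℝ 1 u := hu.of_le (by norm_num)
  have cu := hu.continuous
  have i1 : Integrable fun x => resid u x ^ 2 * η x ^ 2 :=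
    integrable_mul_sq hη hc ((continuous_resid hu).pow 2)
  have i2 : Integrable fun x => gsq u x * gsq η x := integrable_mul_gsq hη hc (continuous_gsq hu1)
  have i0 : Integrable fun x => gsq u x * η x ^ 2 := integrable_mul_sq hη hc (continuous_gsq hu1)
  have i3 : Integrable fun x => gsq u x * (σ / √((u x ^ 2 - 1) ^ 2 + σ ^ 2)) ^ 3 * η x ^ 2 := by
    refine integrable_mul_sq hη hc
      (g := fun x => gsq u x * (σ / √((u x ^ 2 - 1) ^ 2 + σ ^ 2)) ^ 3) ?_
    refine (continuous_gsq hu1).mul (Continuous.pow (Continuous.div (by fun_prop) (by fun_prop)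
      fun x => (sqrt_sq_add_pos hσ _).ne') 3)
  have hGd : ∀ t : ℝ, HasDerivAt (fun t : ℝ => t * ((t ^ 2 - 1) / √((t ^ 2 - 1) ^ 2 + σ ^ 2)))
      ((t ^ 2 - 1) / √((t ^ 2 - 1) ^ 2 + σ ^ 2) +
        t * (σ ^ 2 / √((t ^ 2 - 1) ^ 2 + σ ^ 2) ^ 3 * (2 * t))) t := by
    intro t
    have h1 : HasDerivAt (fun t : ℝ => t ^ 2 - 1) (2 * t) t := by
      simpa using (hasDerivAt_pow 2 t).sub_const 1
    simpa using (hasDerivAt_id t).fun_mul ((hasDerivAt_div_sqrt hσ (t ^ 2 - 1)).comp t h1)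
  have hG : Continuous fun t : ℝ => (t ^ 2 - 1) / √((t ^ 2 - 1) ^ 2 + σ ^ 2) +
      t * (σ ^ 2 / √((t ^ 2 - 1) ^ 2 + σ ^ 2) ^ 3 * (2 * t)) := by
    have h0 : ∀ t : ℝ, √((t ^ 2 - 1) ^ 2 + σ ^ 2) ≠ 0 := fun t => (sqrt_sq_add_pos hσ _).ne'
    exact (Continuous.div (by fun_prop) (by fun_prop) h0).add (continuous_id.mul
      ((Continuous.div (by fun_prop) (by fun_prop) fun t => pow_ne_zero 3 (h0 t)).mul
        (by fun_prop)))
  refine integral_le_of_test hu (hη.pow 2) (hasCompactSupport_sq hc)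
    (fun t => (hGd t).const_mul (σ / 2)) (continuous_const.mul hG) i3
    ((((i0.const_mul σ).const_mul (3 / 2)).add (i1.const_mul (1 / 4))).add i2) fun x => ?_
  have hcs := gdot_sq_le u η x
  have h3 := gsq_nonneg u x
  rw [gdot_sq_right hη]
  simp only [W']
  have hS := sqrt_sq_add_pos hσ (u x ^ 2 - 1)
  have hS2 : √((u x ^ 2 - 1) ^ 2 + σ ^ 2) ^ 2 = (u x ^ 2 - 1) ^ 2 + σ ^ 2 :=
    Real.sq_sqrt (by positivity)
  generalize √((u x ^ 2 - 1) ^ 2 + σ ^ 2) = S at *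
  generalize gsq u x = q at *
  generalize gdot u η x = d at *
  generalize gsq η x = g at *
  generalize η x = e at *
  generalize resid u x = f at *
  generalize u x = v at *
  obtain ⟨a, ha⟩ : ∃ a, a = σ / S := ⟨_, rfl⟩
  obtain ⟨b, hb⟩ : ∃ b, b = (v ^ 2 - 1) / S := ⟨_, rfl⟩
  have ha0 : 0 < a := ha ▸ div_pos hσ hS
  have hab : a ^ 2 + b ^ 2 = 1 := by
    rw [ha, hb]; field_simp; rw [hS2]; ring
  have ha1 : a ≤ 1 := by nlinarith [sq_nonneg b]
  have hb1 : -1 ≤ b := by nlinarith [sq_nonneg a]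
  have e1 : σ ^ 2 / S ^ 3 * (v * (2 * v)) * σ = 2 * a ^ 3 + 2 * a ^ 2 * b * σ := by
    rw [ha, hb]; field_simp; ring
  have e2 : v ^ 3 - v = v * b * S := by rw [hb]; field_simp
  have e3 : σ = a * S := by rw [ha]; field_simp
  rw [← ha, ← hb]
  have t1 : q * a ^ 3 * e ^ 2 - 3 / 2 * (σ * (q * e ^ 2)) ≤
      σ / 2 * (b + v * (σ ^ 2 / S ^ 3 * (2 * v))) * q * e ^ 2 := by
    have : σ / 2 * (b + v * (σ ^ 2 / S ^ 3 * (2 * v))) =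
        σ * b / 2 + (a ^ 3 + a ^ 2 * b * σ) := by linarith [e1]
    rw [this]
    have h4 : -(3 / 2) * σ ≤ σ * b / 2 + a ^ 2 * b * σ := by
      have : 0 ≤ σ * ((1 + b) / 2 + (1 - a ^ 2) + a ^ 2 * (1 + b)) := by
        have : a ^ 2 ≤ 1 := by nlinarith
        have : 0 ≤ a ^ 2 * (1 + b) := mul_nonneg (by positivity) (by linarith)
        apply mul_nonneg hσ.le; linarith
      linarith
    have h5 : 0 ≤ q * e ^ 2 := by positivity
    nlinarith
  have t2 : -(1 / 4 * (f ^ 2 * e ^ 2)) - q * g ≤ σ / 2 * (v * b) * (v ^ 3 - v + f) * e ^ 2 +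
      σ / 2 * (v * b) * (2 * e * d) := by
    have hqg : 0 ≤ q * g := (sq_nonneg d).trans hcs
    have hσS : σ ≤ S := by rw [e3]; nlinarith
    rw [e2]
    have k1 : σ / 2 * (v * b) * (v * b * S + f) * e ^ 2 + σ / 2 * (v * b) * (2 * e * d)
        = σ / 2 * S * (v * b * e) ^ 2 + σ / 2 * (v * b * e) * (f * e) + σ * (v * b * e) * d := by
      ring
    rw [k1]
    generalize v * b * e = w
    have k2 : 0 ≤ σ * (S - σ) * w ^ 2 :=
      mul_nonneg (mul_nonneg hσ.le (by linarith)) (sq_nonneg _)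
    nlinarith [sq_nonneg (σ * w / 2 + f * e / 2), sq_nonneg (σ * w / 2 + d)]
  linarith

/-- Mollification by a normalised bump function. -/
def mollify (φ : ContDiffBump (0 : E 3)) (g : E 3 → ℝ) : E 3 → ℝ :=
  convolution (φ.normed volume) g (ContinuousLinearMap.lsmul ℝ ℝ) volume

lemma locallyIntegrable_normed (φ : ContDiffBump (0 : E 3)) :
    LocallyIntegrable (φ.normed volume) volume :=
  (φ.continuous_normed).locallyIntegrable

lemma contDiff_mollify (φ : ContDiffBump (0 : E 3)) {g : E 3 → ℝ} (hg : Continuous g) {n : ℕ∞} :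
    ContDiff ℝ n (mollify φ g) :=
  φ.hasCompactSupport_normed.contDiff_convolution_left _ φ.contDiff_normed hg.locallyIntegrable

lemma pd_mollify (φ : ContDiffBump (0 : E 3)) {g : E 3 → ℝ} (hg : ContDiff ℝ 1 g)
    (hc : HasCompactSupport g) (i : Fin 3) : pd i (mollify φ g) = mollify φ (pd i g) := by
  funext x
  have h := hc.hasFDerivAt_convolution_right (ContinuousLinearMap.lsmul ℝ ℝ)
    (locallyIntegrable_normed φ) hg x
  rw [pd, mollify, h.fderiv, convolution_precompR_apply _ (locallyIntegrable_normed φ)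
    (hc.fderiv ℝ) (hg.continuous_fderiv (by norm_num))]
  rfl

lemma abs_mollify_le (φ : ContDiffBump (0 : E 3)) {g : E 3 → ℝ} (hg : Continuous g) {M : ℝ}
    (hM : ∀ x, |g x| ≤ M) (x : E 3) : |mollify φ g x| ≤ 3 * M := by
  have h := φ.dist_normed_convolution_le (μ := volume) (x₀ := x) (ε := 2 * M)
    hg.aestronglyMeasurable fun y _ => by
      rw [Real.dist_eq]
      exact (abs_sub _ _).trans (by linarith [hM x, hM y])
  rw [Real.dist_eq] at h
  have h2 := abs_sub_abs_le_abs_sub (mollify φ g x) (g x)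
  have h3 : |mollify φ g x - g x| ≤ 2 * M := h
  linarith [hM x]

/-- A divergence identity for the second derivatives of a thrice differentiable function. -/
lemma integral_hessian_of_contDiff_three {w ζ : E 3 → ℝ} (hw : ContDiff ℝ 3 w)
    (hζ : ContDiff ℝ 1 ζ) (hc : HasCompactSupport ζ) :
    ∫ x, (∑ i, ((∑ j, pd i (pd j w) x * pd j w x) - (∑ j, pd j (pd j w) x) * pd i w x) * pd i ζ x +
      ζ x * ((∑ i, ∑ j, pd i (pd j w) x ^ 2) - (∑ j, pd j (pd j w) x) ^ 2)) = 0 := by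
  have hw2 : ContDiff ℝ 2 w := hw.of_le (by norm_num)
  have h1 : ∀ i, ContDiff ℝ 2 (pd i w) := fun i => contDiff_pd (n := 2) (by norm_num; exact hw)
  have h2 : ∀ i j, ContDiff ℝ 1 (pd i (pd j w)) := fun i j => contDiff_pd_one (h1 j)
  set B : Fin 3 → E 3 → ℝ := fun i x =>
    (∑ j, pd i (pd j w) x * pd j w x) - (∑ j, pd j (pd j w) x) * pd i w x with hB
  have hBc : ∀ i, ContDiff ℝ 1 (B i) := fun i =>
    (ContDiff.sum fun j _ => (h2 i j).mul ((h1 j).of_le (by norm_num))).sub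
      ((ContDiff.sum fun j _ => h2 j j).mul ((h1 i).of_le (by norm_num)))
  have hF : ∀ i, ContDiff ℝ 1 fun x => ζ x * B i x := fun i => hζ.mul (hBc i)
  have hFc : ∀ i, HasCompactSupport fun x => ζ x * B i x := fun i => hc.mul_right
  have hI : ∫ x, ∑ i, pd i (fun x => ζ x * B i x) x = 0 := by
    rw [integral_finsetSum _ fun i _ => (continuous_pd (hF i)).integrable_of_hasCompactSupport
      (hasCompactSupport_pd (hFc i))]
    exact Finset.sum_eq_zero fun i _ => integral_pd_eq_zero (hF i) (hFc i)
  rw [← hI]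
  refine integral_congr_ae (Eventually.of_forall fun x => ?_)
  have dd : ∀ {g : E 3 → ℝ}, ContDiff ℝ 1 g → DifferentiableAt ℝ g x :=
    fun hg => hg.differentiable (by norm_num) x
  have d1 : ∀ i, DifferentiableAt ℝ (pd i w) x := fun i => dd ((h1 i).of_le (by norm_num))
  have d2 : ∀ i j, DifferentiableAt ℝ (pd i (pd j w)) x := fun i j => dd (h2 i j)
  have hpB : ∀ i, pd i (B i) x = (∑ j, (pd i (pd i (pd j w)) x * pd j w x +
      pd i (pd j w) x * pd i (pd j w) x)) - ((∑ j, pd i (pd j (pd j w)) x) * pd i w x +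
        (∑ j, pd j (pd j w) x) * pd i (pd i w) x) := by
    intro i
    rw [hB, pd_sub (DifferentiableAt.fun_sum fun j _ => (d2 i j).fun_mul (d1 j))
      ((DifferentiableAt.fun_sum fun j _ => d2 j j).fun_mul (d1 i)),
      pd_sum _ fun j _ => (d2 i j).fun_mul (d1 j),
      pd_mul (DifferentiableAt.fun_sum fun j _ => d2 j j) (d1 i), pd_sum _ fun j _ => d2 j j]
    simp only [pd_mul (d2 i _) (d1 _)]
  have hs : ∀ i j, pd i (pd i (pd j w)) x = pd j (pd i (pd i w)) x := by
    intro i j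
    rw [show pd i (pd j w) = pd j (pd i w) from funext fun y => pd_comm hw2 i j,
      pd_comm (h1 i) i j]
  simp only [pd_mul (dd hζ) (dd (hBc _)), hpB]
  simp only [hB, Fin.sum_univ_three]
  rw [hs 0 1, hs 0 2, hs 1 0, hs 1 2, hs 2 0, hs 2 1, pd_comm hw2 1 0, pd_comm hw2 2 0,
    pd_comm hw2 2 1]
  ring

lemma exists_bound_of_hasCompactSupport {g : E 3 → ℝ} (hg : Continuous g)
    (hc : HasCompactSupport g) : ∃ M, ∀ x, |g x| ≤ M := by
  obtain ⟨C, hC⟩ := hc.exists_bound_of_continuous hg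
  exact ⟨C, fun x => by simpa using hC x⟩

/-- The divergence identity for the second derivatives of a compactly supported `C²` function. -/
lemma integral_hessian {u ζ : E 3 → ℝ} (hu : ContDiff ℝ 2 u) (huc : HasCompactSupport u)
    (hζ : ContDiff ℝ 1 ζ) (hc : HasCompactSupport ζ) :
    ∫ x, (∑ i, ((∑ j, pd i (pd j u) x * pd j u x) - (∑ j, pd j (pd j u) x) * pd i u x) * pd i ζ x +
      ζ x * ((∑ i, ∑ j, pd i (pd j u) x ^ 2) - (∑ j, pd j (pd j u) x) ^ 2)) = 0 := by
  have hu1 : ContDiff ℝ 1 u := hu.of_le (by norm_num)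
  have c1 : ∀ i, Continuous (pd i u) := fun i => continuous_pd hu1
  have c2 : ∀ i j, Continuous (pd i (pd j u)) := fun i j => continuous_pd (contDiff_pd_one hu)
  have s1 : ∀ i, HasCompactSupport (pd i u) := fun i => hasCompactSupport_pd huc
  let φ : ℕ → ContDiffBump (0 : E 3) := fun n =>
    ⟨1 / (n + 1) / 2, 1 / (n + 1), by positivity, by
      have : (0 : ℝ) < 1 / (n + 1) := by positivity
      linarith⟩
  have hφ : Tendsto (fun n => (φ n).rOut) atTop (nhds 0) := tendsto_one_div_add_atTop_nhds_zero_nat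
  have p1 : ∀ n i, pd i (mollify (φ n) u) = mollify (φ n) (pd i u) := fun n i =>
    pd_mollify _ hu1 huc i
  have p2 : ∀ n i j, pd i (pd j (mollify (φ n) u)) = mollify (φ n) (pd i (pd j u)) :=
      fun n i j => by
    rw [p1, pd_mollify _ (contDiff_pd_one hu) (s1 j)]
  have t1 : ∀ i x, Tendsto (fun n => mollify (φ n) (pd i u) x) atTop (nhds (pd i u x)) :=
    fun i x => ContDiffBump.convolution_tendsto_right_of_continuous hφ (c1 i) x
  have t2 : ∀ i j x, Tendsto (fun n => mollify (φ n) (pd i (pd j u)) x) atTop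
      (nhds (pd i (pd j u) x)) :=
    fun i j x => ContDiffBump.convolution_tendsto_right_of_continuous hφ (c2 i j) x
  choose M1 hM1 using fun i => exists_bound_of_hasCompactSupport (c1 i) (s1 i)
  choose M2 hM2 using fun i j =>
    exists_bound_of_hasCompactSupport (c2 i j) (hasCompactSupport_pd (i := i) (s1 j))
  obtain ⟨M, hM1', hM2'⟩ : ∃ M, (∀ i, M1 i ≤ M) ∧ ∀ i j, M2 i j ≤ M := by
    obtain ⟨A, hA⟩ := Finite.bddAbove_range M1
    obtain ⟨B, hB⟩ := Finite.bddAbove_range fun p : Fin 3 × Fin 3 => M2 p.1 p.2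
    exact ⟨max A B, fun i => (hA ⟨i, rfl⟩).trans (le_max_left _ _),
      fun i j => (hB ⟨(i, j), rfl⟩).trans (le_max_right _ _)⟩
  have b1 : ∀ n i x, |mollify (φ n) (pd i u) x| ≤ 3 * M := fun n i x =>
    abs_mollify_le _ (c1 i) (fun y => (hM1 i y).trans (hM1' i)) x
  have b2 : ∀ n i j x, |mollify (φ n) (pd i (pd j u)) x| ≤ 3 * M := fun n i j x =>
    abs_mollify_le _ (c2 i j) (fun y => (hM2 i j y).trans (hM2' i j)) x
  have hlim := tendsto_integral_of_dominated_convergence (μ := (volume : Measure (E 3)))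
    (F := fun n x => ∑ i, ((∑ j, mollify (φ n) (pd i (pd j u)) x * mollify (φ n) (pd j u) x) -
      (∑ j, mollify (φ n) (pd j (pd j u)) x) * mollify (φ n) (pd i u) x) * pd i ζ x +
      ζ x * ((∑ i, ∑ j, mollify (φ n) (pd i (pd j u)) x ^ 2) -
        (∑ j, mollify (φ n) (pd j (pd j u)) x) ^ 2))
    (f := fun x => ∑ i, ((∑ j, pd i (pd j u) x * pd j u x) -
      (∑ j, pd j (pd j u) x) * pd i u x) * pd i ζ x +
      ζ x * ((∑ i, ∑ j, pd i (pd j u) x ^ 2) - (∑ j, pd j (pd j u) x) ^ 2))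
    (fun x => 18 * (3 * M) ^ 2 * ((∑ i, |pd i ζ x|) + |ζ x|)) ?_ ?_ ?_ ?_
  · refine tendsto_nhds_unique hlim (tendsto_const_nhds.congr fun n => ?_)
    have := integral_hessian_of_contDiff_three
      (contDiff_mollify (φ n) hu.continuous (n := 3)) hζ hc
    simp only [p2] at this
    simp only [p1] at this
    exact this.symm
  · intro n
    refine Continuous.aestronglyMeasurable ?_
    have k1 : ∀ i, Continuous (mollify (φ n) (pd i u)) := fun i =>
      (contDiff_mollify (φ n) (c1 i) (n := 0)).continuous
    have k2 : ∀ i j, Continuous (mollify (φ n) (pd i (pd j u))) := fun i j =>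
      (contDiff_mollify (φ n) (c2 i j) (n := 0)).continuous
    have k3 : ∀ i, Continuous (pd i ζ) := fun i => continuous_pd hζ
    have k4 := hζ.continuous
    fun_prop
  · refine Integrable.const_mul (Integrable.add (integrable_finsetSum _ fun i _ => ?_) ?_) _
    · exact ((continuous_pd hζ).integrable_of_hasCompactSupport (hasCompactSupport_pd hc)).abs
    · exact (hζ.continuous.integrable_of_hasCompactSupport hc).abs
  · intro n
    refine Eventually.of_forall fun x => ?_
    have hM0 : 0 ≤ 3 * M := (abs_nonneg _).trans (b1 n 0 x)
    have pr : ∀ {a b : ℝ}, |a| ≤ 3 * M → |b| ≤ 3 * M → |a * b| ≤ (3 * M) ^ 2 := by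
      intro a b ha hb
      rw [abs_mul, sq]; exact mul_le_mul ha hb (abs_nonneg _) hM0
    have q1 : ∀ i j k, |mollify (φ n) (pd i (pd j u)) x * mollify (φ n) (pd k u) x| ≤ (3 * M) ^ 2 :=
      fun i j k => pr (b2 n i j x) (b1 n k x)
    have l1 : ∀ i, |(∑ j, mollify (φ n) (pd i (pd j u)) x * mollify (φ n) (pd j u) x) -
        (∑ j, mollify (φ n) (pd j (pd j u)) x) * mollify (φ n) (pd i u) x| ≤
          18 * (3 * M) ^ 2 := by
      intro i
      simp only [Fin.sum_univ_three, add_mul]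
      have := abs_le.1 (q1 i 0 0); have := abs_le.1 (q1 i 1 1); have := abs_le.1 (q1 i 2 2)
      have := abs_le.1 (q1 0 0 i); have := abs_le.1 (q1 1 1 i); have := abs_le.1 (q1 2 2 i)
      rw [abs_le]; constructor <;> nlinarith
    have l2 : |(∑ i, ∑ j, mollify (φ n) (pd i (pd j u)) x ^ 2) -
        (∑ j, mollify (φ n) (pd j (pd j u)) x) ^ 2| ≤ 18 * (3 * M) ^ 2 := by
      have hsq : ∀ i j, mollify (φ n) (pd i (pd j u)) x ^ 2 ≤ (3 * M) ^ 2 := fun i j =>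
        sq_le_sq' (by linarith [(abs_le.1 (b2 n i j x)).1]) (abs_le.1 (b2 n i j x)).2
      have hA : (∑ i, ∑ j, mollify (φ n) (pd i (pd j u)) x ^ 2) ≤ ∑ i : Fin 3, ∑ j : Fin 3,
          (3 * M) ^ 2 := Finset.sum_le_sum fun i _ => Finset.sum_le_sum fun j _ => hsq i j
      have hA0 : 0 ≤ ∑ i, ∑ j, mollify (φ n) (pd i (pd j u)) x ^ 2 :=
        Finset.sum_nonneg fun i _ => Finset.sum_nonneg fun j _ => sq_nonneg _
      have hB : |∑ j, mollify (φ n) (pd j (pd j u)) x| ≤ 3 * (3 * M) := by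
        refine (Finset.abs_sum_le_sum_abs _ _).trans
          ((Finset.sum_le_sum fun j _ => b2 n j j x).trans_eq ?_)
        simp
      have hB2 := sq_le_sq' (by linarith [(abs_le.1 hB).1]) (abs_le.1 hB).2
      have hB0 := sq_nonneg (∑ j, mollify (φ n) (pd j (pd j u)) x)
      simp only [Finset.sum_const, Finset.card_univ, Fintype.card_fin, nsmul_eq_mul] at hA
      push_cast at hA
      rw [abs_le]; constructor <;> nlinarith [sq_nonneg (3 * M)]
    rw [Real.norm_eq_abs]
    refine (abs_add_le _ _).trans ?_
    rw [mul_add, Finset.mul_sum]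
    refine add_le_add ((Finset.abs_sum_le_sum_abs _ _).trans
      (Finset.sum_le_sum fun i _ => ?_)) ?_
    · rw [abs_mul]; exact mul_le_mul_of_nonneg_right (l1 i) (abs_nonneg _)
    · rw [abs_mul, mul_comm]; exact mul_le_mul_of_nonneg_right l2 (abs_nonneg _)
  · refine Eventually.of_forall fun x => ?_
    refine Tendsto.add (tendsto_finsetSum _ fun i _ => Tendsto.mul_const _ (Tendsto.sub
      (tendsto_finsetSum _ fun j _ => (t2 i j x).mul (t1 j x))
      ((tendsto_finsetSum _ fun j _ => t2 j j x).mul (t1 i x)))) (Tendsto.const_mul _ (Tendsto.sub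
      (tendsto_finsetSum _ fun i _ => tendsto_finsetSum _ fun j _ => (t2 i j x).pow 2)
      ((tendsto_finsetSum _ fun j _ => t2 j j x).pow 2)))

lemma pd_gsq {u : E 3 → ℝ} (hu : ContDiff ℝ 2 u) (i : Fin 3) (x : E 3) :
    pd i (fun y => gsq u y / 2) x = ∑ j, pd i (pd j u) x * pd j u x := by
  have d : ∀ j, DifferentiableAt ℝ (pd j u) x := fun j =>
    (contDiff_pd_one hu).differentiable (by norm_num) x
  have h : (fun y => gsq u y / 2) = fun y => ∑ j, (1 / 2 : ℝ) * pd j u y ^ 2 := by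
    funext y; simp only [gsq, Fin.sum_univ_three]; ring
  rw [h, pd_sum _ fun j _ => ((d j).fun_pow 2).const_mul _]
  refine Finset.sum_congr rfl fun j _ => ?_
  rw [pd_const_mul _ ((d j).fun_pow 2), pd_pow 2 (d j)]
  norm_num; ring

set_option maxHeartbeats 1000000 in
/-- The pointwise inequality behind the discrepancy estimate.  Here `a = |∇Q|²`, `b = ∇u·∇Q`,
`c = ∇Q·∇η`, `d = ∇u·∇η`, `g = |∇η|²`, `e = η`, `D = |D²u|²`, `q = |∇u|²/2`, `v = u`. -/
lemma discrepancy_pointwise {a b c d g e D q v f h h' k κ : ℝ} (hq : 0 < q) (hκ : 0 < κ)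
    (hh : 0 ≤ h) (hh' : 0 ≤ h') (hh1 : h' ≤ 1) (hhq : h ≤ h' * q) (ha : 0 ≤ a) (hg : 0 ≤ g)
    (hb : b ^ 2 ≤ 2 * q * a) (hc : c ^ 2 ≤ a * g) (hd : d ^ 2 ≤ 2 * q * g)
    (hk : κ ≤ v ^ 2 - 1 → (v ^ 2 - 1) / 2 ≤ k)
    (hD : a + 2 * (v * (v ^ 2 - 1 - 2 * κ)) * b + 2 * q * (v * (v ^ 2 - 1 - 2 * κ)) ^ 2 ≤
      2 * q * D) :
    4 * κ * h * e ^ 2 - 7 * f ^ 2 * e ^ 2 - 8 * (v ^ 2 * k ^ 2 * e ^ 2) - 10 * h * g ≤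
      (2 * e * h / q * c + e ^ 2 * h' / q * a - e ^ 2 * h / q ^ 2 *
        (a + v * (v ^ 2 - 1 - 2 * κ) * b)) - f * (2 * e * h / q * d + e ^ 2 * h' / q * b -
          e ^ 2 * h / q ^ 2 * (b + v * (v ^ 2 - 1 - 2 * κ) * (2 * q))) +
      e ^ 2 * h / q * (D - (v ^ 3 - v + f) ^ 2 + 2 * κ * (2 * q + v * (v ^ 3 - v + f))) := by
  obtain ⟨r, hr⟩ : ∃ r, r = h / q := ⟨_, rfl⟩
  obtain ⟨s, hs⟩ : ∃ s, s = h' / q := ⟨_, rfl⟩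
  have hhr : h = r * q := by rw [hr]; field_simp
  have hhs : h' = s * q := by rw [hs]; field_simp
  have hr0 : 0 ≤ r := hr ▸ div_nonneg hh hq.le
  have hs0 : 0 ≤ s := hs ▸ div_nonneg hh' hq.le
  have hrs : r ≤ s * q := by rw [hr, div_le_iff₀ hq, ← hhs]; exact hhq
  have hr1 : r ≤ 1 := hrs.trans (hhs ▸ hh1)
  set F := v * (v ^ 2 - 1 - 2 * κ) with hF
  -- Hessian term
  have k1 : e ^ 2 * r / (2 * q) * (a + 2 * F * b + 2 * q * F ^ 2) ≤ e ^ 2 * r * D := by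
    have : e ^ 2 * r * D = e ^ 2 * r / (2 * q) * (2 * q * D) := by field_simp
    rw [this]; exact mul_le_mul_of_nonneg_left hD (by positivity)
  -- gradient coefficient
  have k2 : e ^ 2 * s * a / 2 ≤ e ^ 2 * (s - r / (2 * q)) * a := by
    have : r / (2 * q) ≤ s / 2 := by
      rw [div_le_iff₀ (by positivity)]; linarith
    have h0 : 0 ≤ e ^ 2 * a * (s / 2 - r / (2 * q)) :=
      mul_nonneg (by positivity) (by linarith)
    linarith
  -- cross terms
  have k3 : -(e ^ 2 * s * a / 8) - 8 * h * g ≤ 2 * e * r * c := by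
    rcases hs0.eq_or_lt with h0 | h0
    · have : r = 0 := le_antisymm (by rw [← h0] at hrs; linarith) hr0
      rw [hhr, this, ← h0]; simp
    · have : r ^ 2 ≤ s * h := by
        rw [hhr]; linarith [mul_le_mul_of_nonneg_left hrs hr0]
      have m1 : (2 * e * r * c) ^ 2 ≤ 4 * (e ^ 2 * s * a / 8) * (8 * h * g) := by
        have : (2 * e * r * c) ^ 2 = 4 * e ^ 2 * (r ^ 2 * c ^ 2) := by ring
        rw [this]
        have : r ^ 2 * c ^ 2 ≤ (s * h) * (a * g) :=
          mul_le_mul ‹_› hc (sq_nonneg _) (by positivity)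
        exact (mul_le_mul_of_nonneg_left this (by positivity)).trans_eq (by ring)
      have m2 : 0 ≤ e ^ 2 * s * a / 8 := by positivity
      have m3 : 0 ≤ 8 * h * g := by positivity
      have := abs_le_of_sq_le_sq' (a := 2 * e * r * c) (b := e ^ 2 * s * a / 8 + 8 * h * g)
        (by linarith [sq_nonneg (e ^ 2 * s * a / 8 - 8 * h * g)]) (by linarith)
      linarith [this.1]
  have k4 : -(f ^ 2 * e ^ 2) - 2 * h * g ≤ -(2 * f * e * r * d) := by
    have m0 : r ^ 2 * d ^ 2 ≤ 2 * h * g := by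
      have : r ^ 2 * d ^ 2 ≤ r * (2 * q * g) := mul_le_mul
        (by linarith [mul_le_mul_of_nonneg_left hr1 hr0]) hd (sq_nonneg _) hr0
      rw [hhr]; linarith
    linarith [sq_nonneg (f * e - r * d)]
  have k5 : -(e ^ 2 * s * a / 8) - 4 * f ^ 2 * e ^ 2 ≤ -(f * e ^ 2 * (s - r / q) * b) := by
    have n0 : 0 ≤ s - r / q := by
      rw [sub_nonneg, div_le_iff₀ hq]; exact hrs
    have n1 : s - r / q ≤ s := by
      have : 0 ≤ r / q := by positivity
      linarith
    generalize s - r / q = p at *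
    have n2 : p * q ≤ 1 := (mul_le_mul_of_nonneg_right n1 hq.le).trans (hhs ▸ hh1)
    have : -(e ^ 2 * p * a / 8) - 4 * f ^ 2 * e ^ 2 ≤ -(f * e ^ 2 * p * b) := by
      have m1 : (f * b) ^ 2 ≤ (a / 8 + 4 * q * f ^ 2) ^ 2 := by
        have : (f * b) ^ 2 ≤ f ^ 2 * (2 * q * a) := by
          rw [mul_pow]; exact mul_le_mul_of_nonneg_left hb (sq_nonneg _)
        linarith [sq_nonneg (a / 8 - 4 * q * f ^ 2)]
      have m2 := abs_le_of_sq_le_sq' m1 (by positivity)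
      have m3 : 0 ≤ e ^ 2 * p * (a / 8 + 4 * q * f ^ 2 - f * b) :=
        mul_nonneg (by positivity) (by linarith [m2.2])
      have m4 : 0 ≤ 4 * f ^ 2 * e ^ 2 * (1 - p * q) :=
        mul_nonneg (by positivity) (by linarith)
      linarith
    have : e ^ 2 * p * a ≤ e ^ 2 * s * a := by gcongr
    linarith
  -- zero order terms
  have k6 : -(2 * f ^ 2 * e ^ 2) - 8 * (v ^ 2 * k ^ 2 * e ^ 2) ≤
      e ^ 2 * r * (2 * κ * v ^ 2 * (2 * κ - (v ^ 2 - 1)) - 2 * κ * v * f - f ^ 2) := by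
    have m0 : -(2 * f ^ 2) - 8 * (v ^ 2 * k ^ 2) ≤
        2 * κ * v ^ 2 * (2 * κ - (v ^ 2 - 1)) - 2 * κ * v * f - f ^ 2 := by
      have hv := sq_nonneg v
      rcases le_total (v ^ 2 - 1) (3 / 2 * κ) with ht | ht
      · have : 0 ≤ κ * v ^ 2 * (3 / 2 * κ - (v ^ 2 - 1)) :=
          mul_nonneg (by positivity) (by linarith)
        linarith [sq_nonneg (κ * v - f), mul_nonneg hv (sq_nonneg k)]
      · have hkk := hk (by linarith)
        generalize v ^ 2 - 1 = t at *
        have ht0 : 0 ≤ t := by linarith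
        have n1 : t ^ 2 / 4 ≤ k ^ 2 := by
          linarith [pow_le_pow_left₀ (by linarith : 0 ≤ t / 2) hkk 2]
        have n2 : v ^ 2 * (2 * κ * t) ≤ v ^ 2 * (2 * t ^ 2) :=
          mul_le_mul_of_nonneg_left
            (by linarith [mul_le_mul_of_nonneg_right (show κ ≤ t by linarith) ht0]) hv
        have n3 : v ^ 2 * (2 * t ^ 2) ≤ v ^ 2 * (8 * k ^ 2) :=
          mul_le_mul_of_nonneg_left (by linarith) hv
        linarith [sq_nonneg (κ * v - f), mul_nonneg hv (sq_nonneg κ)]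
    have m1 : 0 ≤ 2 * f ^ 2 + 8 * (v ^ 2 * k ^ 2) := by positivity
    have m2 : 0 ≤ e ^ 2 * r := by positivity
    have m3 : e ^ 2 * r ≤ e ^ 2 := mul_le_of_le_one_right (sq_nonneg e) hr1
    have m4 := mul_le_mul_of_nonneg_left m0 m2
    have m5 := mul_le_mul_of_nonneg_right m3 m1
    linarith
  have key : (2 * e * h / q * c + e ^ 2 * h' / q * a - e ^ 2 * h / q ^ 2 * (a + F * b))
      - f * (2 * e * h / q * d + e ^ 2 * h' / q * b - e ^ 2 * h / q ^ 2 * (b + F * (2 * q))) +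
      e ^ 2 * h / q * (D - (v ^ 3 - v + f) ^ 2 + 2 * κ * (2 * q + v * (v ^ 3 - v + f))) =
      2 * e * r * c + e ^ 2 * (s - r / (2 * q)) * a - 2 * f * e * r * d
      - f * e ^ 2 * (s - r / q) * b
      + (e ^ 2 * r * D - e ^ 2 * r / (2 * q) * (a + 2 * F * b + 2 * q * F ^ 2))
      + e ^ 2 * r * (2 * κ * v ^ 2 * (2 * κ - (v ^ 2 - 1)) - 2 * κ * v * f - f ^ 2)
      + 4 * κ * h * e ^ 2 := by
    obtain ⟨p, hp⟩ : ∃ p, p = r / q := ⟨_, rfl⟩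
    have hrp : r = p * q := by rw [hp]; field_simp
    have e1 : 2 * e * h / q = 2 * e * r := by rw [hr]; ring
    have e2 : e ^ 2 * h' / q = e ^ 2 * s := by rw [hs]; ring
    have e3 : e ^ 2 * h / q ^ 2 = e ^ 2 * p := by rw [hp, hr]; ring
    have e4 : r / (2 * q) = p / 2 := by rw [hp]; ring
    have e5 : e ^ 2 * r / (2 * q) = e ^ 2 * p / 2 := by rw [hp]; ring
    have e6 : e ^ 2 * h / q = e ^ 2 * r := by rw [hr]; ring
    rw [e1, e2, e3, e4, e5, e6, ← hp, hhr, hrp, hF]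
    ring
  rw [key]
  have k7 : 0 ≤ e ^ 2 * s * a := by positivity
  linarith

lemma discrepancy_vector {U N : Fin 3 → ℝ} {H : Fin 3 → Fin 3 → ℝ} {e q v h h' k κ : ℝ}
    (hU : ∑ i, U i ^ 2 = 2 * q) (hq : 0 < q) (hκ : 0 < κ)
    (hh : 0 ≤ h) (hh' : 0 ≤ h') (hh1 : h' ≤ 1) (hhq : h ≤ h' * q)
    (hk : κ ≤ v ^ 2 - 1 → (v ^ 2 - 1) / 2 ≤ k) :
    4 * κ * h * e ^ 2 - 7 * ((∑ i, H i i) - (v ^ 3 - v)) ^ 2 * e ^ 2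
        - 8 * (v ^ 2 * k ^ 2 * e ^ 2) - 10 * h * ∑ i, N i ^ 2 ≤
      (∑ i, ((∑ j, H i j * U j) - (∑ j, H j j) * U i) * (2 * e * h / q * N i +
        e ^ 2 * h' / q * ((∑ j, H i j * U j) - v * (v ^ 2 - 1 - 2 * κ) * U i) -
        e ^ 2 * h / q ^ 2 * ∑ j, H i j * U j) +
        e ^ 2 * h / q * ((∑ i, ∑ j, H i j ^ 2) - (∑ j, H j j) ^ 2)) +
      ∑ i, 2 * κ * (U i * (e ^ 2 * h / q) * U i + v * (2 * e * h / q * N i +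
        e ^ 2 * h' / q * ((∑ j, H i j * U j) - v * (v ^ 2 - 1 - 2 * κ) * U i) -
        e ^ 2 * h / q ^ 2 * ∑ j, H i j * U j) * U i + v * (e ^ 2 * h / q) * H i i) := by
  obtain ⟨Y, hY⟩ : ∃ Y : Fin 3 → ℝ, ∀ i, Y i = ∑ j, H i j * U j := ⟨_, fun _ => rfl⟩
  have hYD : ∑ i, Y i ^ 2 ≤ 2 * q * ∑ i, ∑ j, H i j ^ 2 := by
    rw [← hU, Finset.mul_sum]
    refine Finset.sum_le_sum fun i _ => ?_
    rw [hY, mul_comm]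
    exact Finset.sum_mul_sq_le_sq_mul_sq _ _ _
  simp only [← hY]
  generalize (∑ i, ∑ j, H i j ^ 2) = D at *
  obtain ⟨F, hF⟩ : ∃ F, F = v * (v ^ 2 - 1 - 2 * κ) := ⟨_, rfl⟩
  have key := discrepancy_pointwise (a := ∑ i, (Y i - F * U i) ^ 2)
    (b := ∑ i, U i * (Y i - F * U i)) (c := ∑ i, (Y i - F * U i) * N i) (d := ∑ i, U i * N i)
    (g := ∑ i, N i ^ 2) (e := e) (D := D) (v := v) (f := (∑ i, H i i) - (v ^ 3 - v)) (k := k)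
    hq hκ hh hh' hh1 hhq (Finset.sum_nonneg fun _ _ => sq_nonneg _)
    (Finset.sum_nonneg fun _ _ => sq_nonneg _)
    (by rw [← hU]; exact Finset.sum_mul_sq_le_sq_mul_sq _ _ _)
    (Finset.sum_mul_sq_le_sq_mul_sq _ _ _)
    (by rw [← hU]; exact Finset.sum_mul_sq_le_sq_mul_sq _ _ _) hk
    (by
      refine le_trans (le_of_eq ?_) hYD
      rw [← hF, ← hU]
      simp only [Fin.sum_univ_three]
      ring)
  refine key.trans_eq ?_
  generalize 2 * e * h / q = A
  generalize e ^ 2 * h' / q = B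
  generalize e ^ 2 * h / q ^ 2 = C
  generalize e ^ 2 * h / q = ζ
  rw [← hF, ← hU]
  have hF' : v ^ 3 - v = F + 2 * κ * v := by rw [hF]; ring
  rw [hF']
  simp only [Fin.sum_univ_three]
  ring

/-- The potential part of the modified discrepancy. -/
def shiftedDisc (κ : ℝ) (u : E 3 → ℝ) (x : E 3) : ℝ :=
  gsq u x / 2 - ((u x ^ 2 - 1) / 2 - κ) ^ 2

lemma contDiff_shiftedDisc {u : E 3 → ℝ} (hu : ContDiff ℝ 2 u) (κ : ℝ) :
    ContDiff ℝ 1 (shiftedDisc κ u) := by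
  have h1 : ContDiff ℝ 1 u := hu.of_le (by norm_num)
  have h2 := contDiff_gsq hu
  unfold shiftedDisc
  fun_prop

lemma differentiableAt_gsq_div_two {u : E 3 → ℝ} (hu : ContDiff ℝ 2 u) (x : E 3) :
    DifferentiableAt ℝ (fun y => gsq u y / 2) x :=
  ((contDiff_gsq hu).div_const 2).differentiable (by norm_num) x

lemma pd_shiftedDisc {u : E 3 → ℝ} (hu : ContDiff ℝ 2 u) (κ : ℝ) (i : Fin 3) (x : E 3) :
    pd i (shiftedDisc κ u) x =
      (∑ j, pd i (pd j u) x * pd j u x) - u x * (u x ^ 2 - 1 - 2 * κ) * pd i u x := by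
  have hu1 : DifferentiableAt ℝ u x := hu.differentiable (by norm_num) x
  have h1 : HasDerivAt (fun t : ℝ => ((t ^ 2 - 1) / 2 - κ) ^ 2) (u x * (u x ^ 2 - 1 - 2 * κ))
      (u x) := by
    have := ((((hasDerivAt_pow 2 (u x)).sub_const 1).div_const 2).sub_const κ).fun_pow 2
    refine this.congr_deriv ?_
    push_cast; ring
  unfold shiftedDisc
  rw [pd_sub (differentiableAt_gsq_div_two hu x)
    (h1.differentiableAt.fun_comp' x hu1), pd_gsq hu, pd_comp h1 hu1]

lemma shiftedDisc_neg_of_gsq_eq_zero {u : E 3 → ℝ} {x : E 3} (h : gsq u x = 0) (κ : ℝ) {τ : ℝ}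
    (hτ : 0 < τ) : shiftedDisc κ u x - τ < 0 := by
  have := sq_nonneg ((u x ^ 2 - 1) / 2 - κ)
  rw [shiftedDisc, h]; linarith

/-- The test function used in the discrepancy estimate. -/
def discTest (κ τ : ℝ) (u η : E 3 → ℝ) (x : E 3) : ℝ :=
  η x ^ 2 * smoothPos τ (shiftedDisc κ u x - τ) / (gsq u x / 2)

section DiscTest

variable {u η : E 3 → ℝ} {κ τ : ℝ}

lemma discTest_eventuallyEq_zero (hu : ContDiff ℝ 2 u) (hτ : 0 < τ) {x : E 3}
    (h : gsq u x = 0) : discTest κ τ u η =ᶠ[nhds x] fun _ => 0 := by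
  have hc : Continuous fun y => shiftedDisc κ u y - τ :=
    (contDiff_shiftedDisc hu κ).continuous.sub continuous_const
  filter_upwards [hc.continuousAt.eventually_lt_const
    (shiftedDisc_neg_of_gsq_eq_zero h κ hτ)] with y hy
  simp [discTest, smoothPos_of_nonpos hy.le]

lemma contDiff_discTest (hu : ContDiff ℝ 2 u) (hη : ContDiff ℝ 1 η) (hτ : 0 < τ) :
    ContDiff ℝ 1 (discTest κ τ u η) := by
  rw [contDiff_iff_contDiffAt]
  intro x
  by_cases h : gsq u x = 0
  · exact contDiffAt_const.congr_of_eventuallyEq (discTest_eventuallyEq_zero hu hτ h)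
  · exact (((hη.pow 2).mul ((contDiff_smoothPos hτ).comp
      ((contDiff_shiftedDisc hu κ).sub contDiff_const))).contDiffAt).div
      ((contDiff_gsq hu).div_const 2).contDiffAt (by simpa using h)

lemma hasCompactSupport_discTest (hc : HasCompactSupport η) :
    HasCompactSupport (discTest κ τ u η) :=
  HasCompactSupport.intro hc fun x hx => by
    simp [discTest, image_eq_zero_of_notMem_tsupport hx]

lemma pd_div {f g : E 3 → ℝ} {x : E 3} (i : Fin 3) (hf : DifferentiableAt ℝ f x)
    (hg : DifferentiableAt ℝ g x) (h0 : g x ≠ 0) :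
    pd i (fun y => f y / g y) x = pd i f x / g x - f x * pd i g x / g x ^ 2 := by
  have hi : DifferentiableAt ℝ (fun y => (g y)⁻¹) x := hg.fun_inv h0
  simp only [div_eq_mul_inv]
  rw [pd_mul hf hi, pd_comp (hasDerivAt_inv h0) hg]
  field_simp
  ring

lemma pd_discTest (hu : ContDiff ℝ 2 u) (hη : ContDiff ℝ 1 η) (hτ : 0 < τ) {x : E 3}
    (h : gsq u x ≠ 0) (i : Fin 3) :
    pd i (discTest κ τ u η) x =
      2 * η x * smoothPos τ (shiftedDisc κ u x - τ) / (gsq u x / 2) * pd i η x +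
      η x ^ 2 * smoothPos' τ (shiftedDisc κ u x - τ) / (gsq u x / 2) *
        ((∑ j, pd i (pd j u) x * pd j u x) - u x * (u x ^ 2 - 1 - 2 * κ) * pd i u x) -
      η x ^ 2 * smoothPos τ (shiftedDisc κ u x - τ) / (gsq u x / 2) ^ 2 *
        ∑ j, pd i (pd j u) x * pd j u x := by
  have dη : DifferentiableAt ℝ η x := hη.differentiable (by norm_num) x
  have dQ : DifferentiableAt ℝ (fun y => shiftedDisc κ u y - τ) x :=
    ((contDiff_shiftedDisc hu κ).differentiable (by norm_num) x).sub_const τ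
  have dh := hasDerivAt_smoothPos hτ (shiftedDisc κ u x - τ)
  have dhQ : DifferentiableAt ℝ (fun y => smoothPos τ (shiftedDisc κ u y - τ)) x :=
    dh.differentiableAt.fun_comp' x dQ
  have hQ : pd i (fun y => shiftedDisc κ u y - τ) x = pd i (shiftedDisc κ u) x := by
    rw [pd_sub ((contDiff_shiftedDisc hu κ).differentiable (by norm_num) x)
      (differentiableAt_const τ), pd_const, sub_zero]
  unfold discTest
  rw [pd_div i ((dη.fun_pow 2).fun_mul dhQ)
    (differentiableAt_gsq_div_two hu x) (by simpa using h),
    pd_mul (dη.fun_pow 2) dhQ, pd_pow 2 dη, pd_comp dh dQ, hQ, pd_shiftedDisc hu, pd_gsq hu]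
  push_cast
  ring

lemma integral_smoothPos_shiftedDisc_le (hu : ContDiff ℝ 2 u) (huc : HasCompactSupport u)
    (hη : ContDiff ℝ 1 η) (hc : HasCompactSupport η) (hκ : 0 < κ) (hτ : 0 < τ) :
    ∫ x, 4 * κ * smoothPos τ (shiftedDisc κ u x - τ) * η x ^ 2 ≤
      ∫ x, (7 * (resid u x ^ 2 * η x ^ 2) +
        8 * (u x ^ 2 * smoothPos κ (u x ^ 2 - 1) ^ 2 * η x ^ 2) + 5 * (gsq u x * gsq η x)) := by
  have hu1 : ContDiff ℝ 1 u := hu.of_le (by norm_num)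
  have cu := hu.continuous
  have cQ : Continuous fun x => smoothPos τ (shiftedDisc κ u x - τ) :=
    (continuous_smoothPos hτ).comp ((contDiff_shiftedDisc hu κ).continuous.sub continuous_const)
  have i1 : Integrable fun x => resid u x ^ 2 * η x ^ 2 :=
    integrable_mul_sq hη hc ((continuous_resid hu).pow 2)
  have i2 : Integrable fun x => gsq u x * gsq η x := integrable_mul_gsq hη hc (continuous_gsq hu1)
  have i3 : Integrable fun x => u x ^ 2 * smoothPos κ (u x ^ 2 - 1) ^ 2 * η x ^ 2 :=
    integrable_mul_sq hη hc (g := fun x => u x ^ 2 * smoothPos κ (u x ^ 2 - 1) ^ 2)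
      ((cu.pow 2).mul (((continuous_smoothPos hκ).comp ((cu.pow 2).sub continuous_const)).pow 2))
  have i4 : Integrable fun x => 4 * κ * smoothPos τ (shiftedDisc κ u x - τ) * η x ^ 2 :=
    integrable_mul_sq hη hc (g := fun x => 4 * κ * smoothPos τ (shiftedDisc κ u x - τ))
      (continuous_const.mul cQ)
  have hζ := contDiff_discTest (κ := κ) hu hη hτ
  have hζc := hasCompactSupport_discTest (κ := κ) (τ := τ) (u := u) hc
  have hN := integral_hessian hu huc hζ hζc
  set ζ := discTest κ τ u η with hζdef
  set N : E 3 → ℝ := fun x => ∑ i, ((∑ j, pd i (pd j u) x * pd j u x) -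
    (∑ j, pd j (pd j u) x) * pd i u x) * pd i ζ x +
      ζ x * ((∑ i, ∑ j, pd i (pd j u) x ^ 2) - (∑ j, pd j (pd j u) x) ^ 2) with hNdef
  have c1 : ∀ i, Continuous (pd i u) := fun i => continuous_pd hu1
  have c2 : ∀ i j, Continuous (pd i (pd j u)) := fun i j => continuous_pd (contDiff_pd_one hu)
  have c3 : ∀ i, Continuous (pd i ζ) := fun i => continuous_pd hζ
  have iN : Integrable N := by
    refine integrable_of_tsupport hζc ?_ fun x hx => ?_
    · have := hζ.continuous
      fun_prop
    · simp only [hNdef, pd_eq_zero_of_notMem_tsupport hx, image_eq_zero_of_notMem_tsupport hx]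
      simp
  have iB : Integrable fun x => 7 * (resid u x ^ 2 * η x ^ 2) +
      8 * (u x ^ 2 * smoothPos κ (u x ^ 2 - 1) ^ 2 * η x ^ 2) + 5 * (gsq u x * gsq η x) :=
    ((i1.const_mul 7).add (i3.const_mul 8)).add (i2.const_mul 5)
  have hfin := integral_le_of_div
    (a := fun x => 4 * κ * smoothPos τ (shiftedDisc κ u x - τ) * η x ^ 2)
    (b := fun x => (7 * (resid u x ^ 2 * η x ^ 2) + 8 * (u x ^ 2 * smoothPos κ (u x ^ 2 - 1) ^ 2 *
      η x ^ 2) + 5 * (gsq u x * gsq η x)) + N x) (fun i x => 2 * κ * (u x * ζ x * pd i u x))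
    (fun i => contDiff_const.mul ((hu1.mul hζ).mul (contDiff_pd_one hu)))
    (fun i => ((hζc.mul_left (f := u)).mul_right).mul_left) i4 (iB.add iN) ?_
  · refine hfin.trans_eq ?_
    rw [integral_add iB iN, hN, add_zero]
  intro x
  have dζ : DifferentiableAt ℝ ζ x := hζ.differentiable (by norm_num) x
  have du : DifferentiableAt ℝ u x := hu.differentiable (by norm_num) x
  have dd : ∀ i, DifferentiableAt ℝ (pd i u) x := fun i =>
    (contDiff_pd_one hu).differentiable (by norm_num) x
  have hdiv : ∀ i, pd i (fun x => 2 * κ * (u x * ζ x * pd i u x)) x =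
      2 * κ * (pd i u x * ζ x * pd i u x + u x * pd i ζ x * pd i u x +
        u x * ζ x * pd i (pd i u) x) := by
    intro i
    rw [pd_const_mul _ ((du.fun_mul dζ).fun_mul (dd i)), pd_mul (du.fun_mul dζ) (dd i),
      pd_mul du dζ]
    ring
  have hh0 := smoothPos_nonneg hτ (shiftedDisc κ u x - τ)
  have hhq : smoothPos τ (shiftedDisc κ u x - τ) ≤ gsq u x / 2 := by
    refine (smoothPos_le_max hτ _).trans (max_le ?_ (by linarith [gsq_nonneg u x]))
    rw [shiftedDisc]; nlinarith [sq_nonneg ((u x ^ 2 - 1) / 2 - κ)]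
  have hgη := gsq_nonneg η x
  have hgu := gsq_nonneg u x
  simp only [hdiv]
  by_cases h : gsq u x = 0
  · have hz' : ∀ i, pd i ζ x = 0 := fun i => by
      rw [pd_congr (discTest_eventuallyEq_zero hu hτ h), pd_const]
    have hz0 : ζ x = 0 := (discTest_eventuallyEq_zero hu hτ h).eq_of_nhds
    have hh : smoothPos τ (shiftedDisc κ u x - τ) = 0 := by
      rw [h] at hhq; linarith
    have hb : 0 ≤ 7 * (resid u x ^ 2 * η x ^ 2) +
        8 * (u x ^ 2 * smoothPos κ (u x ^ 2 - 1) ^ 2 * η x ^ 2) := by positivity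
    simp only [hNdef, hz', hz0, hh, h, mul_zero, zero_mul, add_zero, Finset.sum_const_zero]
    linarith
  · have hq : 0 < gsq u x / 2 := by
      have : 0 < gsq u x := lt_of_le_of_ne hgu (Ne.symm h)
      positivity
    have key := discrepancy_vector (U := fun i => pd i u x) (N := fun i => pd i η x)
      (H := fun i j => pd i (pd j u) x) (e := η x) (q := gsq u x / 2) (v := u x)
      (h := smoothPos τ (shiftedDisc κ u x - τ)) (h' := smoothPos' τ (shiftedDisc κ u x - τ))
      (k := smoothPos κ (u x ^ 2 - 1)) (by rw [gsq]; ring) hq hκ hh0 (smoothPos'_nonneg hτ _)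
      (smoothPos'_le_one hτ _)
      ((smoothPos_le_deriv_mul hτ _).trans (mul_le_mul_of_nonneg_left
        (max_le (by rw [shiftedDisc]; nlinarith [sq_nonneg ((u x ^ 2 - 1) / 2 - κ)]) hq.le)
        (smoothPos'_nonneg hτ _))) (half_le_smoothPos hκ)
    simp only [hNdef]
    have hζx : ζ x = η x ^ 2 * smoothPos τ (shiftedDisc κ u x - τ) / (gsq u x / 2) := rfl
    simp only [hζdef, pd_discTest hu hη hτ h]
    rw [← hζdef, hζx]
    have hres : resid u x = (∑ i, pd i (pd i u) x) - (u x ^ 3 - u x) := by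
      rw [resid, lap_eq_sum_pd hu, W']
    rw [hres]
    have hg2 : gsq η x = ∑ i, pd i η x ^ 2 := rfl
    have hlast : 10 * smoothPos τ (shiftedDisc κ u x - τ) * gsq η x ≤ 5 * (gsq u x * gsq η x) := by
      nlinarith
    rw [hg2] at hlast ⊢
    linarith

/-- Estimate of the positive part of the shifted discrepancy. -/
lemma integral_shiftedDisc_le (hu : ContDiff ℝ 2 u) (huc : HasCompactSupport u)
    (hη : ContDiff ℝ 1 η) (hc : HasCompactSupport η) (hκ : 0 < κ) :
    κ * ∫ x, max (shiftedDisc κ u x) 0 * η x ^ 2 ≤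
      6 * (∫ x, resid u x ^ 2 * η x ^ 2) + 18 * ∫ x, gsq u x * gsq η x := by
  have hu1 : ContDiff ℝ 1 u := hu.of_le (by norm_num)
  have cu := hu.continuous
  have i1 : Integrable fun x => resid u x ^ 2 * η x ^ 2 :=
    integrable_mul_sq hη hc ((continuous_resid hu).pow 2)
  have i2 : Integrable fun x => gsq u x * gsq η x := integrable_mul_gsq hη hc (continuous_gsq hu1)
  have i3 : Integrable fun x => u x ^ 2 * smoothPos κ (u x ^ 2 - 1) ^ 2 * η x ^ 2 :=
    integrable_mul_sq hη hc (g := fun x => u x ^ 2 * smoothPos κ (u x ^ 2 - 1) ^ 2)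
      ((cu.pow 2).mul (((continuous_smoothPos hκ).comp ((cu.pow 2).sub continuous_const)).pow 2))
  have i5 : Integrable fun x => max (shiftedDisc κ u x) 0 * η x ^ 2 :=
    integrable_mul_sq hη hc ((contDiff_shiftedDisc hu κ).continuous.max continuous_const)
  have i6 : Integrable fun x => η x ^ 2 := by
    simpa using integrable_mul_sq hη hc (continuous_const (y := (1 : ℝ)))
  have hO := integral_outside_le hu hη hc hκ
  rw [integral_add i1 (i2.const_mul 4), integral_const_mul] at hO
  have n1 : 0 ≤ ∫ x, resid u x ^ 2 * η x ^ 2 := integral_nonneg fun x => by positivity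
  have n2 : 0 ≤ ∫ x, gsq u x * gsq η x :=
    integral_nonneg fun x => mul_nonneg (gsq_nonneg u x) (gsq_nonneg η x)
  have n6 : 0 ≤ ∫ x, η x ^ 2 := integral_nonneg fun x => sq_nonneg _
  have main : ∀ τ > 0, κ * (∫ x, max (shiftedDisc κ u x) 0 * η x ^ 2) ≤
      6 * (∫ x, resid u x ^ 2 * η x ^ 2) + 18 * (∫ x, gsq u x * gsq η x) +
        κ * (2 * ∫ x, η x ^ 2) * τ := by
    intro τ hτ
    have hS := integral_smoothPos_shiftedDisc_le hu huc hη hc hκ hτ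
    have i4 : Integrable fun x => 4 * κ * smoothPos τ (shiftedDisc κ u x - τ) * η x ^ 2 :=
      integrable_mul_sq hη hc (g := fun x => 4 * κ * smoothPos τ (shiftedDisc κ u x - τ))
        (continuous_const.mul ((continuous_smoothPos hτ).comp
          ((contDiff_shiftedDisc hu κ).continuous.sub continuous_const)))
    have hL : ∫ x, (4 * κ * (max (shiftedDisc κ u x) 0 * η x ^ 2) - 8 * κ * τ * η x ^ 2) ≤
        ∫ x, 4 * κ * smoothPos τ (shiftedDisc κ u x - τ) * η x ^ 2 := by
      refine integral_mono ((i5.const_mul _).sub (i6.const_mul _)) i4 fun x => ?_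
      have h1 := sub_le_smoothPos hτ (shiftedDisc κ u x - τ)
      have h2 : max (shiftedDisc κ u x) 0 ≤ max (shiftedDisc κ u x - τ) 0 + τ := by
        refine max_le ?_ (by positivity)
        linarith [le_max_left (shiftedDisc κ u x - τ) 0]
      have h3 : 0 ≤ 4 * κ * η x ^ 2 := by positivity
      have h4 := mul_le_mul_of_nonneg_left (show max (shiftedDisc κ u x) 0 - 2 * τ ≤
        smoothPos τ (shiftedDisc κ u x - τ) by linarith) h3
      linarith
    rw [integral_sub (i5.const_mul _) (i6.const_mul _), integral_const_mul,
      integral_const_mul] at hL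
    have i13 : Integrable fun x => 7 * (resid u x ^ 2 * η x ^ 2) +
        8 * (u x ^ 2 * smoothPos κ (u x ^ 2 - 1) ^ 2 * η x ^ 2) :=
      (i1.const_mul 7).add (i3.const_mul 8)
    rw [integral_add i13 (i2.const_mul 5),
      integral_add (i1.const_mul 7) (i3.const_mul 8), integral_const_mul, integral_const_mul,
      integral_const_mul] at hS
    linarith
  refine le_of_forall_pos_le_add fun δ hδ => ?_
  have hK : 0 ≤ κ * (2 * ∫ x, η x ^ 2) := by positivity
  refine (main (δ / (κ * (2 * ∫ x, η x ^ 2) + 1)) (by positivity)).trans ?_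
  have : κ * (2 * ∫ x, η x ^ 2) * (δ / (κ * (2 * ∫ x, η x ^ 2) + 1)) ≤ δ := by
    rw [mul_div_assoc', div_le_iff₀ (by positivity)]
    nlinarith
  linarith

end DiscTest

lemma disc_pos_le {q t σ : ℝ} (hq : 0 ≤ q) (hσ : 0 < σ) (hσ1 : σ ≤ 1) :
    max (q - t ^ 2 / 4) 0 ≤ max (q - (t / 2 - σ ^ 2) ^ 2) 0 + 8 * σ * (t ^ 2 / 4) +
      3 * (q * (σ / √(t ^ 2 + σ ^ 2)) ^ 3) := by
  have hS := sqrt_sq_add_pos hσ t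
  have hS2 : √(t ^ 2 + σ ^ 2) ^ 2 = t ^ 2 + σ ^ 2 := Real.sq_sqrt (by positivity)
  have h1 := le_max_left (q - (t / 2 - σ ^ 2) ^ 2) 0
  have h2 := le_max_right (q - (t / 2 - σ ^ 2) ^ 2) 0
  have h3 : 0 ≤ 3 * (q * (σ / √(t ^ 2 + σ ^ 2)) ^ 3) := by positivity
  have h4 : 0 ≤ 8 * σ * (t ^ 2 / 4) := by positivity
  refine max_le ?_ (by linarith)
  rcases le_total σ |t| with h | h
  · have e1 : σ ^ 4 ≤ σ * t ^ 2 := by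
      have : σ ^ 2 ≤ t ^ 2 := by rw [← sq_abs t]; gcongr
      have m : σ ^ 4 ≤ σ ^ 3 := pow_le_pow_of_le_one hσ.le hσ1 (by norm_num)
      nlinarith
    have e2 : σ ^ 2 * |t| ≤ σ * t ^ 2 := by
      rw [← sq_abs t]; nlinarith [mul_nonneg hσ.le (abs_nonneg t)]
    have e3 : -(σ ^ 2 * t) ≤ σ ^ 2 * |t| := by
      nlinarith [neg_abs_le t, sq_nonneg σ]
    nlinarith
  · have e1 : t ^ 2 ≤ σ ^ 2 := by rw [← sq_abs t]; gcongr
    have e2 : 1 ≤ 3 * (σ / √(t ^ 2 + σ ^ 2)) ^ 3 := by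
      have hr : 0 < σ / √(t ^ 2 + σ ^ 2) := by positivity
      have hr2 : 1 / 2 ≤ (σ / √(t ^ 2 + σ ^ 2)) ^ 2 := by
        rw [div_pow, hS2, div_le_div_iff₀ (by norm_num) (by positivity)]; linarith
      generalize σ / √(t ^ 2 + σ ^ 2) = r at *
      have : 2 / 3 ≤ r := by nlinarith
      nlinarith
    have e3 : q * 1 ≤ q * (3 * (σ / √(t ^ 2 + σ ^ 2)) ^ 3) := mul_le_mul_of_nonneg_left e2 hq
    nlinarith [sq_nonneg t]

/-- The discrepancy estimate. -/
lemma integral_disc_pos_le {u η : E 3 → ℝ} (hu : ContDiff ℝ 2 u) (huc : HasCompactSupport u)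
    (hη : ContDiff ℝ 1 η) (hc : HasCompactSupport η) {σ : ℝ} (hσ : 0 < σ) (hσ1 : σ ≤ 1) :
    ∫ x, max (disc u x) 0 * η x ^ 2 ≤ 8 * σ * (∫ x, edens u x * η x ^ 2) +
      1 / σ ^ 2 * (7 * (∫ x, resid u x ^ 2 * η x ^ 2) + 40 * ∫ x, edens u x * gsq η x) := by
  have hu1 : ContDiff ℝ 1 u := hu.of_le (by norm_num)
  have cu := hu.continuous
  have hκ : 0 < σ ^ 2 := by positivity
  have i1 : Integrable fun x => resid u x ^ 2 * η x ^ 2 :=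
    integrable_mul_sq hη hc ((continuous_resid hu).pow 2)
  have i2 : Integrable fun x => gsq u x * gsq η x := integrable_mul_gsq hη hc (continuous_gsq hu1)
  have i0 : Integrable fun x => gsq u x * η x ^ 2 := integrable_mul_sq hη hc (continuous_gsq hu1)
  have iW : Integrable fun x => W (u x) * η x ^ 2 :=
    integrable_mul_sq hη hc (continuous_W.comp cu)
  have iP : Integrable fun x => max (disc u x) 0 * η x ^ 2 :=
    integrable_mul_sq hη hc ((continuous_disc hu1).max continuous_const)
  have ie : Integrable fun x => edens u x * η x ^ 2 :=
    integrable_mul_sq hη hc (continuous_edens hu1)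
  have ieg : Integrable fun x => edens u x * gsq η x :=
    integrable_mul_gsq hη hc (continuous_edens hu1)
  have i5 : Integrable fun x => max (shiftedDisc (σ ^ 2) u x) 0 * η x ^ 2 :=
    integrable_mul_sq hη hc ((contDiff_shiftedDisc hu _).continuous.max continuous_const)
  have i7 : Integrable fun x => gsq u x * (σ / √((u x ^ 2 - 1) ^ 2 + σ ^ 2)) ^ 3 * η x ^ 2 := by
    refine integrable_mul_sq hη hc
      (g := fun x => gsq u x * (σ / √((u x ^ 2 - 1) ^ 2 + σ ^ 2)) ^ 3) ?_
    refine (continuous_gsq hu1).mul (Continuous.pow (Continuous.div (by fun_prop) (by fun_prop)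
      fun x => (sqrt_sq_add_pos hσ _).ne') 3)
  have hT := integral_transition_le hu hη hc hσ
  have i01 : Integrable fun x => 3 / 2 * (σ * (gsq u x * η x ^ 2)) +
      1 / 4 * (resid u x ^ 2 * η x ^ 2) := ((i0.const_mul σ).const_mul _).add (i1.const_mul _)
  rw [integral_add i01 i2, integral_add ((i0.const_mul σ).const_mul _) (i1.const_mul _),
    integral_const_mul, integral_const_mul, integral_const_mul] at hT
  have hQ := integral_shiftedDisc_le hu huc hη hc hκ
  have i5W : Integrable fun x => max (shiftedDisc (σ ^ 2) u x) 0 * η x ^ 2 +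
      8 * σ * (W (u x) * η x ^ 2) := i5.add (iW.const_mul _)
  have hle : ∫ x, max (disc u x) 0 * η x ^ 2 ≤
      ∫ x, (max (shiftedDisc (σ ^ 2) u x) 0 * η x ^ 2 + 8 * σ * (W (u x) * η x ^ 2) +
        3 / 2 * (gsq u x * (σ / √((u x ^ 2 - 1) ^ 2 + σ ^ 2)) ^ 3 * η x ^ 2)) := by
    refine integral_mono iP (i5W.add (i7.const_mul _)) fun x => ?_
    have h := disc_pos_le (q := gsq u x / 2) (t := u x ^ 2 - 1)
      (by linarith [gsq_nonneg u x]) hσ hσ1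
    have h' := mul_le_mul_of_nonneg_right h (sq_nonneg (η x))
    simp only [disc, shiftedDisc, W]
    linarith
  rw [integral_add i5W (i7.const_mul _),
    integral_add i5 (iW.const_mul _), integral_const_mul, integral_const_mul] at hle
  have hee : ∫ x, edens u x * η x ^ 2 =
      1 / 2 * (∫ x, gsq u x * η x ^ 2) + ∫ x, W (u x) * η x ^ 2 := by
    rw [← integral_const_mul, ← integral_add (i0.const_mul _) iW]
    refine integral_congr_ae (Eventually.of_forall fun x => ?_)
    simp only [edens]; ring
  have hge : ∫ x, gsq u x * gsq η x ≤ 2 * ∫ x, edens u x * gsq η x := by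
    rw [← integral_const_mul]
    refine integral_mono i2 (ieg.const_mul 2) fun x => ?_
    have := mul_nonneg (W_nonneg (u x)) (gsq_nonneg η x)
    simp only [edens]; linarith
  have n1 : 0 ≤ ∫ x, resid u x ^ 2 * η x ^ 2 := integral_nonneg fun x => by positivity
  have n0 : 0 ≤ ∫ x, gsq u x * η x ^ 2 :=
    integral_nonneg fun x => mul_nonneg (gsq_nonneg u x) (sq_nonneg _)
  have n2 : 0 ≤ ∫ x, gsq u x * gsq η x :=
    integral_nonneg fun x => mul_nonneg (gsq_nonneg u x) (gsq_nonneg η x)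
  rw [hee]
  generalize (∫ x, resid u x ^ 2 * η x ^ 2) = F at *
  generalize (∫ x, gsq u x * η x ^ 2) = G at *
  generalize (∫ x, gsq u x * gsq η x) = K at *
  generalize (∫ x, edens u x * gsq η x) = K' at *
  generalize (∫ x, W (u x) * η x ^ 2) = V at *
  have hQ' : ∫ x, max (shiftedDisc (σ ^ 2) u x) 0 * η x ^ 2 ≤ 1 / σ ^ 2 * (6 * F + 18 * K) := by
    rw [one_div, ← div_eq_inv_mul, le_div_iff₀ hκ]; linarith
  have h1 : 1 ≤ 1 / σ ^ 2 := by
    rw [le_div_iff₀ hκ]; nlinarith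
  have h2 : F + 2 * K ≤ 1 / σ ^ 2 * (F + 2 * K) := le_mul_of_one_le_left (by linarith) h1
  have h3 : 1 / σ ^ 2 * K ≤ 1 / σ ^ 2 * (2 * K') := mul_le_mul_of_nonneg_left hge (by positivity)
  have h4 : 0 ≤ σ * G := by positivity
  linarith

/-- Diffuse area of a ball at scale one. -/
def energyBall (u : E 3 → ℝ) (z : E 3) (ρ : ℝ) : ℝ := ∫ x in ball z ρ, edens u x

/-- Diffuse Willmore energy of a ball at scale one. -/
def residBall (u : E 3 → ℝ) (z : E 3) (ρ : ℝ) : ℝ := ∫ x in ball z ρ, resid u x ^ 2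

lemma integrableOn_ball {g : E 3 → ℝ} (hg : Continuous g) (z : E 3) (ρ : ℝ) :
    IntegrableOn g (ball z ρ) :=
  (hg.continuousOn.integrableOn_compact (isCompact_closedBall z ρ)).mono_set ball_subset_closedBall

lemma setIntegral_ball_mono {g : E 3 → ℝ} (hg : Continuous g) (h0 : ∀ x, 0 ≤ g x)
    {z z' : E 3} {ρ ρ' : ℝ} (h : ball z ρ ⊆ ball z' ρ') :
    ∫ x in ball z ρ, g x ≤ ∫ x in ball z' ρ', g x :=
  setIntegral_mono_set (integrableOn_ball hg z' ρ') (Eventually.of_forall h0) h.eventuallyLE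

lemma energyBall_nonneg (u : E 3 → ℝ) (z : E 3) (ρ : ℝ) : 0 ≤ energyBall u z ρ :=
  integral_nonneg fun x => edens_nonneg u x

lemma residBall_nonneg (u : E 3 → ℝ) (z : E 3) (ρ : ℝ) : 0 ≤ residBall u z ρ :=
  integral_nonneg fun _ => sq_nonneg _

lemma energyBall_mono {u : E 3 → ℝ} (hu : ContDiff ℝ 2 u) {z z' : E 3} {ρ ρ' : ℝ}
    (h : ball z ρ ⊆ ball z' ρ') : energyBall u z ρ ≤ energyBall u z' ρ' :=
  setIntegral_ball_mono (continuous_edens (hu.of_le (by norm_num))) (edens_nonneg u) h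

lemma residBall_mono {u : E 3 → ℝ} (hu : ContDiff ℝ 2 u) {z z' : E 3} {ρ ρ' : ℝ}
    (h : ball z ρ ⊆ ball z' ρ') : residBall u z ρ ≤ residBall u z' ρ' :=
  setIntegral_ball_mono ((continuous_resid hu).pow 2) (fun _ => sq_nonneg _) h

lemma norm_sub_sq_eq_sum (x z : E 3) : ‖x - z‖ ^ 2 = ∑ i, (x i - z i) ^ 2 := by
  rw [EuclideanSpace.real_norm_sq_eq]; rfl

/-- Properties of a smooth cutoff between two concentric balls. -/
structure IsCutoff (C ρ : ℝ) (z : E 3) (η : E 3 → ℝ) : Prop where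
  contDiff : ContDiff ℝ 2 η
  compact : HasCompactSupport η
  nonneg : ∀ x, 0 ≤ η x
  le_one : ∀ x, η x ≤ 1
  eq_one : ∀ x ∈ closedBall z ρ, η x = 1
  eq_zero : ∀ x ∉ ball z (2 * ρ), η x = 0
  gsq_le : ∀ x, gsq η x ≤ C / ρ ^ 2
  pd_eq_zero : ∀ i, ∀ x, x ∈ closedBall z ρ ∨ x ∉ ball z (2 * ρ) → pd i η x = 0

lemma pd_comp_affine {b : E 3 → ℝ} (i : Fin 3) {c : ℝ} {z x : E 3}
    (hb : DifferentiableAt ℝ b (c • (x - z))) :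
    pd i (fun y => b (c • (y - z))) x = c * pd i b (c • (x - z)) := by
  have h : HasFDerivAt (fun y : E 3 => c • (y - z)) (c • ContinuousLinearMap.id ℝ (E 3)) x :=
    ((hasFDerivAt_id x).sub_const z).const_smul c
  have := (HasFDerivAt.comp x hb.hasFDerivAt h).fderiv
  simp only [Function.comp_def] at this
  simp [pd, this]

lemma exists_isCutoff : ∃ C > 0, ∀ ρ > 0, ∀ z : E 3, ∃ η, IsCutoff C ρ z η := by
  let b : ContDiffBump (0 : E 3) := ⟨1, 2, by norm_num, by norm_num⟩
  have hb : ContDiff ℝ 2 b := b.contDiff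
  have hb1 : ContDiff ℝ 1 b := b.contDiff
  have hbd : Differentiable ℝ b := hb.differentiable (by norm_num)
  obtain ⟨C1, hC1⟩ := exists_bound_of_hasCompactSupport (g := gsq b) (continuous_gsq hb1)
    (HasCompactSupport.intro b.hasCompactSupport fun x hx => gsq_eq_zero_of_notMem_tsupport hx)
  refine ⟨max C1 1, by positivity, fun ρ hρ z => ?_⟩
  set C := max C1 1
  set η : E 3 → ℝ := fun x => b (ρ⁻¹ • (x - z)) with hη
  have hin : ∀ x, x ∈ closedBall z ρ → ρ⁻¹ • (x - z) ∈ closedBall (0 : E 3) 1 := fun x hx => by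
    rw [mem_closedBall_zero_iff, norm_smul, norm_inv, Real.norm_of_nonneg hρ.le,
      inv_mul_le_iff₀ hρ, mul_one]
    simpa [dist_eq_norm] using hx
  have hout : ∀ x, x ∉ ball z (2 * ρ) → ρ⁻¹ • (x - z) ∉ ball (0 : E 3) 2 := fun x hx h => by
    rw [mem_ball_zero_iff, norm_smul, norm_inv, Real.norm_of_nonneg hρ.le,
      inv_mul_lt_iff₀ hρ] at h
    exact hx (by rw [mem_ball, dist_eq_norm]; linarith)
  have h1 : ∀ x ∈ closedBall z ρ, η x = 1 := fun x hx => b.one_of_mem_closedBall (hin x hx)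
  have h0 : ∀ x ∉ ball z (2 * ρ), η x = 0 := fun x hx => by
    refine b.zero_of_le_dist ?_
    simpa [mem_ball] using hout x hx
  have hηc : ContDiff ℝ 2 η := hb.comp (g := b) (by fun_prop)
  have hpd : ∀ i x, pd i η x = ρ⁻¹ * pd i b (ρ⁻¹ • (x - z)) := fun i x => pd_comp_affine i (hbd _)
  refine ⟨η, hηc, HasCompactSupport.intro (isCompact_closedBall z (2 * ρ))
    fun x hx => h0 x fun h => hx (ball_subset_closedBall h), fun x => b.nonneg, fun x => b.le_one,
    h1, h0, fun x => ?_, fun i x hx => ?_⟩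
  · have : gsq η x = ρ⁻¹ ^ 2 * gsq b (ρ⁻¹ • (x - z)) := by
      simp only [gsq, hpd, Finset.mul_sum, mul_pow]
    rw [this, div_eq_inv_mul, ← inv_pow]
    gcongr
    exact (le_abs_self _).trans ((hC1 _).trans (le_max_left _ _))
  · have : fderiv ℝ η x = 0 := by
      rcases hx with hx | hx
      · exact IsLocalMax.fderiv_eq_zero (Eventually.of_forall fun y => by
          rw [h1 x hx]; exact b.le_one)
      · exact IsLocalMin.fderiv_eq_zero (Eventually.of_forall fun y => by
          rw [h0 x hx]; exact b.nonneg)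
    simp [pd, this]

/-- The weight in the monotonicity formula. -/
def wt (s : ℝ) (z x : E 3) : ℝ := 1 / (s ^ 2 + ∑ i, (x i - z i) ^ 2)

section Weight

variable {s : ℝ} {z : E 3}

lemma wt_den_pos (hs : 0 < s) (x : E 3) : 0 < s ^ 2 + ∑ i, (x i - z i) ^ 2 := by
  have := Finset.sum_nonneg fun (i : Fin 3) (_ : i ∈ Finset.univ) => sq_nonneg (x i - z i)
  positivity

lemma wt_pos (hs : 0 < s) (x : E 3) : 0 < wt s z x := one_div_pos.2 (wt_den_pos hs x)

lemma wt_eq (x : E 3) : wt s z x = 1 / (s ^ 2 + ‖x - z‖ ^ 2) := by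
  rw [wt, norm_sub_sq_eq_sum]

lemma contDiff_wt (hs : 0 < s) : ContDiff ℝ 1 (wt s z) := by
  refine contDiff_const.div ?_ fun x => (wt_den_pos hs x).ne'
  fun_prop

lemma pd_wt (hs : 0 < s) (i : Fin 3) (x : E 3) :
    pd i (wt s z) x = -2 * wt s z x ^ 2 * (x i - z i) := by
  have hd : ∀ j, DifferentiableAt ℝ (fun y : E 3 => y j - z j) x := fun j => by fun_prop
  have h := wt_den_pos (z := z) hs x
  have hden : pd i (fun y : E 3 => s ^ 2 + ∑ j, (y j - z j) ^ 2) x = 2 * (x i - z i) := by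
    rw [pd_add (differentiableAt_const _) (by fun_prop), pd_const,
      pd_sum _ fun j _ => (hd j).fun_pow 2]
    simp only [pd_pow 2 (hd _), pd_coord_sub]
    simp
  rw [show wt s z = fun y : E 3 => 1 / (s ^ 2 + ∑ j, (y j - z j) ^ 2) from rfl,
    pd_div i (differentiableAt_const _) (by fun_prop) h.ne', hden, pd_const]
  field_simp
  ring

end Weight

lemma monotonicity_pointwise {y U N : Fin 3 → ℝ} {H : Fin 3 → Fin 3 → ℝ}
    {ψ χ e P s w f m : ℝ} (hH : ∀ i j, H i j = H j i) (hU : ∑ i, U i ^ 2 = e + P)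
    (hPe : P ≤ e) (he : 0 ≤ e) (hψ : 0 ≤ ψ) (hχ : 0 < χ)
    (hs : χ * (s ^ 2 + ∑ i, y i ^ 2) = 1) (hf : ∑ i, H i i = w + f) (hm : 0 ≤ m)
    (hN : (∑ i, y i ^ 2) * ∑ i, N i ^ 2 ≤ m ^ 2) :
    ψ * (2 * s ^ 2 * χ ^ 2 * e + χ * max (-P) 0) -
        (ψ * χ * max P 0 + 1 / 4 * (ψ * f ^ 2) + 3 * m * (χ * e)) ≤
      ∑ i, -((N i * χ + ψ * (-2 * χ ^ 2 * y i)) * ((∑ j, y j * U j) * U i - e * y i) +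
        ψ * χ * ((U i + ∑ j, y j * H i j) * U i + (∑ j, y j * U j) * H i i -
          (((∑ j, H i j * U j) + w * U i) * y i + e))) := by
  obtain ⟨g, hg⟩ : ∃ g, g = ∑ j, y j * U j := ⟨_, rfl⟩
  obtain ⟨a, ha⟩ : ∃ a, a = ∑ j, N j * U j := ⟨_, rfl⟩
  obtain ⟨c, hc⟩ : ∃ c, c = ∑ j, y j * N j := ⟨_, rfl⟩
  have e1 : ∑ i, -((N i * χ + ψ * (-2 * χ ^ 2 * y i)) * ((∑ j, y j * U j) * U i - e * y i) +
        ψ * χ * ((U i + ∑ j, y j * H i j) * U i + (∑ j, y j * U j) * H i i -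
          (((∑ j, H i j * U j) + w * U i) * y i + e))) =
      -χ * (g * a - e * c) + 2 * ψ * χ ^ 2 * g ^ 2 - 2 * ψ * χ ^ 2 * e * (∑ i, y i ^ 2) -
        ψ * χ * ((∑ i, U i ^ 2) + g * (∑ i, H i i) - w * g - 3 * e) := by
    rw [hg, ha, hc]
    simp only [Fin.sum_univ_three, hH 1 0, hH 2 0, hH 2 1]
    ring
  rw [e1, hU, hf]
  have hg2 : g ^ 2 ≤ (∑ i, y i ^ 2) * (e + P) := by
    rw [hg, ← hU]; exact Finset.sum_mul_sq_le_sq_mul_sq _ _ _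
  have ha2 : a ^ 2 ≤ (∑ i, N i ^ 2) * (e + P) := by
    rw [ha, ← hU]; exact Finset.sum_mul_sq_le_sq_mul_sq _ _ _
  have hc2 : c ^ 2 ≤ m ^ 2 := by
    rw [hc]; exact (Finset.sum_mul_sq_le_sq_mul_sq _ _ _).trans hN
  have hyn : 0 ≤ ∑ i, y i ^ 2 := Finset.sum_nonneg fun _ _ => sq_nonneg _
  have hNn : 0 ≤ ∑ i, N i ^ 2 := Finset.sum_nonneg fun _ _ => sq_nonneg _
  have hUn : 0 ≤ e + P := by rw [← hU]; exact Finset.sum_nonneg fun _ _ => sq_nonneg _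
  generalize (∑ i, y i ^ 2) = Y at *
  generalize (∑ i, N i ^ 2) = M at *
  have hga : g * a ≤ m * (2 * e) := by
    refine le_trans ?_ (mul_le_mul_of_nonneg_left (show e + P ≤ 2 * e by linarith) hm)
    refine le_of_sq_le_sq ?_ (by positivity)
    calc (g * a) ^ 2 = g ^ 2 * a ^ 2 := by ring
      _ ≤ (Y * (e + P)) * (M * (e + P)) := by gcongr
      _ = (Y * M) * (e + P) ^ 2 := by ring
      _ ≤ m ^ 2 * (e + P) ^ 2 := by gcongr
      _ = _ := by ring
  have hec : -(e * c) ≤ m * e := by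
    have : -c ≤ m := by linarith [(abs_le_of_sq_le_sq' hc2 hm).1]
    nlinarith
  have hbd := mul_le_mul_of_nonneg_left (add_le_add hga hec) hχ.le
  have hPP : max P 0 - max (-P) 0 = P := by
    rcases le_total P 0 with h | h
    · rw [max_eq_right h, max_eq_left (by linarith)]; ring
    · rw [max_eq_left h, max_eq_right (by linarith)]; ring
  have hY : χ * Y = 1 - χ * s ^ 2 := by linarith
  have hsq : 0 ≤ ψ * (f / 2 - χ * g) ^ 2 := by positivity
  have hsq' : 0 ≤ ψ * (χ * g) ^ 2 := by positivity
  have k1 : 2 * ψ * χ ^ 2 * e * Y = 2 * ψ * χ * e * (1 - χ * s ^ 2) := by rw [← hY]; ring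
  rw [k1]
  have k2 : ψ * χ * max P 0 - ψ * χ * max (-P) 0 = ψ * χ * P := by rw [← mul_sub, hPP]
  linarith

/-- The localised monotonicity formula at scale one. -/
lemma integral_monotonicity {u ψ : E 3 → ℝ} (hu : ContDiff ℝ 2 u) {C ρ s : ℝ} {z : E 3}
    (hρ : 0 < ρ) (hs : 0 < s) (hψ : IsCutoff C ρ z ψ) {m : ℝ} (hm : 0 ≤ m) (hmC : 4 * C ≤ m ^ 2) :
    ∫ x, ψ x * (2 * s ^ 2 * wt s z x ^ 2 * edens u x + wt s z x * max (-disc u x) 0) ≤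
      (∫ x, ψ x * (wt s z x * max (disc u x) 0)) + 1 / 4 * (∫ x, ψ x * resid u x ^ 2) +
        3 * m / ρ ^ 2 * energyBall u z (2 * ρ) := by
  have hu1 : ContDiff ℝ 1 u := hu.of_le (by norm_num)
  have hψ1 : ContDiff ℝ 1 ψ := hψ.contDiff.of_le (by norm_num)
  have cw := (contDiff_wt (z := z) hs).continuous
  have ce := continuous_edens hu1
  have cd := continuous_disc hu1
  have cf := continuous_resid hu
  have cψ := hψ1.continuous
  have int : ∀ g : E 3 → ℝ, Continuous g → Integrable fun x => ψ x * g x := fun g hg =>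
    (cψ.mul hg).integrable_of_hasCompactSupport hψ.compact.mul_right
  have i1 := int (fun x => 2 * s ^ 2 * wt s z x ^ 2 * edens u x + wt s z x * max (-disc u x) 0)
    (by fun_prop)
  have i2 := int (fun x => wt s z x * max (disc u x) 0) (by fun_prop)
  have i3 := int (fun x => resid u x ^ 2) (by fun_prop)
  have i4 : Integrable ((ball z (2 * ρ)).indicator (edens u)) :=
    (integrableOn_ball ce z _).integrable_indicator measurableSet_ball
  have i23 : Integrable fun x => ψ x * (wt s z x * max (disc u x) 0) +
      1 / 4 * (ψ x * resid u x ^ 2) := i2.add (i3.const_mul _)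
  have hd : ∀ j x, DifferentiableAt ℝ (fun y : E 3 => y j - z j) x := fun j x => by fun_prop
  have key := integral_le_of_div
    (a := fun x => ψ x * (2 * s ^ 2 * wt s z x ^ 2 * edens u x + wt s z x * max (-disc u x) 0))
    (b := fun x => (ψ x * (wt s z x * max (disc u x) 0) + 1 / 4 * (ψ x * resid u x ^ 2)) +
      3 * m / ρ ^ 2 * (ball z (2 * ρ)).indicator (edens u) x)
    (fun i x => -1 * (ψ x * wt s z x * ((∑ j, (x j - z j) * pd j u x) * pd i u x -
      edens u x * (x i - z i)))) ?_ ?_ i1 (i23.add (i4.const_mul _)) ?_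
  · refine key.trans_eq ?_
    rw [integral_add i23 (i4.const_mul _), integral_add i2 (i3.const_mul _), integral_const_mul,
      integral_const_mul, integral_indicator measurableSet_ball]
    rfl
  · intro i
    have h1 : ∀ j, ContDiff ℝ 1 (pd j u) := fun j => contDiff_pd_one hu
    have h2 := contDiff_wt (z := z) hs
    have h3 : ContDiff ℝ 1 (edens u) := by
      have := contDiff_gsq hu
      unfold edens W
      fun_prop
    fun_prop
  · intro i
    exact ((hψ.compact.mul_right).mul_right).mul_left
  · intro x
    have du : DifferentiableAt ℝ u x := hu1.differentiable (by norm_num) x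
    have dψ : DifferentiableAt ℝ ψ x := hψ1.differentiable (by norm_num) x
    have dw : DifferentiableAt ℝ (wt s z) x := (contDiff_wt hs).differentiable (by norm_num) x
    have dp : ∀ j, DifferentiableAt ℝ (pd j u) x := fun j =>
      (contDiff_pd_one hu).differentiable (by norm_num) x
    have dW : HasDerivAt W (W' (u x)) (u x) := by
      have := (((hasDerivAt_pow 2 (u x)).sub_const 1).fun_pow 2).div_const 4
      refine this.congr_deriv ?_
      simp only [W']; push_cast; ring
    have dWu : DifferentiableAt ℝ (fun y => W (u y)) x := dW.differentiableAt.fun_comp' x du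
    have de : DifferentiableAt ℝ (edens u) x := (differentiableAt_gsq_div_two hu x).fun_add dWu
    have dg : DifferentiableAt ℝ (fun y => ∑ j, (y j - z j) * pd j u y) x :=
      DifferentiableAt.fun_sum fun j _ => (hd j x).fun_mul (dp j)
    have pe : ∀ i, pd i (edens u) x = (∑ j, pd i (pd j u) x * pd j u x) + W' (u x) * pd i u x := by
      intro i
      rw [show edens u = fun y => gsq u y / 2 + W (u y) from rfl,
        pd_add (differentiableAt_gsq_div_two hu x) dWu, pd_gsq hu, pd_comp dW du]
    have pg : ∀ i, pd i (fun y => ∑ j, (y j - z j) * pd j u y) x =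
        pd i u x + ∑ j, (x j - z j) * pd i (pd j u) x := by
      intro i
      rw [pd_sum _ fun j _ => (hd j x).fun_mul (dp j)]
      simp only [pd_mul (hd _ x) (dp _), pd_coord_sub, Finset.sum_add_distrib]
      simp
    have hF : ∀ i, pd i (fun x => -1 * (ψ x * wt s z x * ((∑ j, (x j - z j) * pd j u x) * pd i u x -
        edens u x * (x i - z i)))) x =
        -((pd i ψ x * wt s z x + ψ x * (-2 * wt s z x ^ 2 * (x i - z i))) *
          ((∑ j, (x j - z j) * pd j u x) * pd i u x - edens u x * (x i - z i)) +
          ψ x * wt s z x * ((pd i u x + ∑ j, (x j - z j) * pd i (pd j u) x) * pd i u x +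
            (∑ j, (x j - z j) * pd j u x) * pd i (pd i u) x -
            (((∑ j, pd i (pd j u) x * pd j u x) + W' (u x) * pd i u x) * (x i - z i) +
              edens u x))) := by
      intro i
      have d1 := dψ.fun_mul dw
      have d2 := dg.fun_mul (dp i)
      have d3 := de.fun_mul (hd i x)
      rw [pd_const_mul _ (d1.fun_mul (d2.fun_sub d3)), pd_mul d1 (d2.fun_sub d3), pd_mul dψ dw,
        pd_sub d2 d3, pd_mul dg (dp i), pd_mul de (hd i x), pd_wt hs, pe, pg, pd_coord_sub]
      simp
    simp only [hF]
    have hden := wt_den_pos (z := z) hs x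
    have hbd : ∃ m', 0 ≤ m' ∧ (∑ i, (x i - z i) ^ 2) * ∑ i, pd i ψ x ^ 2 ≤ m' ^ 2 ∧
        3 * m' * (wt s z x * edens u x) ≤
          3 * m / ρ ^ 2 * (ball z (2 * ρ)).indicator (edens u) x := by
      by_cases hx : x ∈ closedBall z ρ ∨ x ∉ ball z (2 * ρ)
      · refine ⟨0, le_rfl, by simp [hψ.pd_eq_zero _ x hx], ?_⟩
        have : 0 ≤ (ball z (2 * ρ)).indicator (edens u) x :=
          indicator_nonneg (fun y _ => edens_nonneg u y) x
        simp only [mul_zero, zero_mul]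
        positivity
      · push Not at hx
        obtain ⟨hx1, hx2⟩ := hx
        rw [mem_closedBall, dist_eq_norm, not_le] at hx1
        have hx3 : ‖x - z‖ < 2 * ρ := by rw [← dist_eq_norm]; exact hx2
        refine ⟨m, hm, ?_, ?_⟩
        · rw [← norm_sub_sq_eq_sum]
          have h4 : ‖x - z‖ ^ 2 ≤ 4 * ρ ^ 2 := by nlinarith [norm_nonneg (x - z)]
          have h5 := hψ.gsq_le x
          have h6 := gsq_nonneg ψ x
          calc _ ≤ 4 * ρ ^ 2 * (C / ρ ^ 2) := mul_le_mul h4 h5 h6 (by positivity)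
            _ = 4 * C := by field_simp
            _ ≤ m ^ 2 := hmC
        · rw [indicator_of_mem hx2, div_mul_eq_mul_div, mul_div_assoc]
          have : wt s z x ≤ 1 / ρ ^ 2 := by
            rw [wt_eq]
            refine one_div_le_one_div_of_le (by positivity) ?_
            nlinarith [sq_nonneg s]
          have h7 := mul_le_mul_of_nonneg_right this (edens_nonneg u x)
          rw [div_mul_eq_mul_div, one_mul] at h7
          exact mul_le_mul_of_nonneg_left h7 (by positivity)
    obtain ⟨m', hm0, hm1, hm2⟩ := hbd
    have hres : ∑ i, pd i (pd i u) x = W' (u x) + resid u x := by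
      rw [resid, lap_eq_sum_pd hu]; ring
    have := monotonicity_pointwise (y := fun i => x i - z i) (U := fun i => pd i u x)
      (N := fun i => pd i ψ x) (H := fun i j => pd i (pd j u) x) (ψ := ψ x) (χ := wt s z x)
      (e := edens u x) (P := disc u x) (s := s) (w := W' (u x)) (f := resid u x) (m := m')
      (fun i j => pd_comm hu i j) (by simp only [edens, disc, gsq]; ring)
      (by have := W_nonneg (u x); simp only [edens, disc]; linarith) (edens_nonneg u x)
      (hψ.nonneg x) (wt_pos hs x) (by rw [wt]; field_simp) hres hm0 hm1
    linarith

lemma le_setIntegral_of_le_one {η g : E 3 → ℝ} {z : E 3} {ρ : ℝ} (hη : Continuous η)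
    (hg : Continuous g) (h0 : ∀ x ∉ ball z ρ, η x = 0) (h1 : ∀ x, η x ≤ 1)
    (hg0 : ∀ x, 0 ≤ g x) : ∫ x, η x * g x ≤ ∫ x in ball z ρ, g x := by
  rw [← setIntegral_eq_integral_of_forall_compl_eq_zero (s := ball z ρ)
    fun x hx => by rw [h0 x hx, zero_mul]]
  exact setIntegral_mono (integrableOn_ball (hη.mul hg) z ρ) (integrableOn_ball hg z ρ)
    fun x => mul_le_of_le_one_left (hg0 x) (h1 x)

lemma setIntegral_le_of_eq_one {η g : E 3 → ℝ} {z : E 3} {ρ : ℝ} (hη : Continuous η)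
    (hc : HasCompactSupport η) (hg : Continuous g) (h0 : ∀ x, 0 ≤ η x)
    (h1 : ∀ x ∈ ball z ρ, η x = 1) (hg0 : ∀ x, 0 ≤ g x) :
    ∫ x in ball z ρ, g x ≤ ∫ x, η x * g x := by
  calc ∫ x in ball z ρ, g x = ∫ x in ball z ρ, η x * g x :=
        setIntegral_congr_fun measurableSet_ball fun x hx => by simp [h1 x hx]
    _ ≤ _ := setIntegral_le_integral ((hη.mul hg).integrable_of_hasCompactSupport hc.mul_right)
        (Eventually.of_forall fun x => mul_nonneg (h0 x) (hg0 x))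

lemma IsCutoff.sq_eq_one {C ρ : ℝ} {z : E 3} {η : E 3 → ℝ} (h : IsCutoff C ρ z η) (x : E 3)
    (hx : x ∈ ball z ρ) : η x ^ 2 = 1 := by
  rw [h.eq_one x (ball_subset_closedBall hx), one_pow]

/-- The discrepancy estimate on balls. -/
lemma exists_setIntegral_disc_le : ∃ C > 0, ∀ u : E 3 → ℝ, ContDiff ℝ 2 u → HasCompactSupport u →
    ∀ z : E 3, ∀ ρ > 0, ∀ σ > 0, σ ≤ 1 →
    ∫ x in ball z ρ, max (disc u x) 0 ≤ 8 * σ * energyBall u z (2 * ρ) +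
      1 / σ ^ 2 * (7 * residBall u z (2 * ρ) + C / ρ ^ 2 * energyBall u z (2 * ρ)) := by
  obtain ⟨C, hC, hcut⟩ := exists_isCutoff
  refine ⟨40 * C, by positivity, fun u hu huc z ρ hρ σ hσ hσ1 => ?_⟩
  obtain ⟨η, hη⟩ := hcut ρ hρ z
  have hu1 : ContDiff ℝ 1 u := hu.of_le (by norm_num)
  have hη1 : ContDiff ℝ 1 η := hη.contDiff.of_le (by norm_num)
  have cη := hη1.continuous
  have cη2 : Continuous fun x => η x ^ 2 := cη.pow 2
  have hc2 := hasCompactSupport_sq hη.compact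
  have h02 : ∀ x ∉ ball z (2 * ρ), η x ^ 2 = 0 := fun x hx => by rw [hη.eq_zero x hx]; ring
  have h12 : ∀ x, η x ^ 2 ≤ 1 := fun x => pow_le_one₀ (hη.nonneg x) (hη.le_one x)
  have key := integral_disc_pos_le hu huc hη1 hη.compact hσ hσ1
  have k1 := setIntegral_le_of_eq_one cη2 hc2 (g := fun x => max (disc u x) 0) (z := z) (ρ := ρ)
    ((continuous_disc hu1).max continuous_const) (fun x => sq_nonneg _) hη.sq_eq_one
    fun x => le_max_right _ _
  have k2 := le_setIntegral_of_le_one cη2 (continuous_edens hu1) h02 h12 (edens_nonneg u)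
  have k3 := le_setIntegral_of_le_one cη2 (g := fun x => resid u x ^ 2)
    ((continuous_resid hu).pow 2) h02 h12
    (fun x => sq_nonneg _)
  have k4 : ∫ x, edens u x * gsq η x ≤ C / ρ ^ 2 * energyBall u z (2 * ρ) := by
    rw [← setIntegral_eq_integral_of_forall_compl_eq_zero (s := ball z (2 * ρ))
      (fun x hx => by simp [gsq, hη.pd_eq_zero _ x (Or.inr hx)]), energyBall, ← integral_const_mul]
    refine setIntegral_mono (integrableOn_ball ((continuous_edens hu1).mul
      (continuous_gsq hη1)) _ _) (integrableOn_ball (continuous_const.mul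
      (continuous_edens hu1)) _ _) fun x => ?_
    rw [mul_comm]
    exact mul_le_mul_of_nonneg_right (hη.gsq_le x) (edens_nonneg u x)
  simp only [mul_comm (η _ ^ 2)] at k1 k2 k3
  refine k1.trans (key.trans ?_)
  rw [show 40 * C / ρ ^ 2 = 40 * (C / ρ ^ 2) by ring]
  have m1 := mul_le_mul_of_nonneg_left k2 (show 0 ≤ 8 * σ by positivity)
  have m2 := mul_le_mul_of_nonneg_left (add_le_add (mul_le_mul_of_nonneg_left k3
    (show (0 : ℝ) ≤ 7 by norm_num)) (mul_le_mul_of_nonneg_left k4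
    (show (0 : ℝ) ≤ 40 by norm_num))) (show 0 ≤ 1 / σ ^ 2 by positivity)
  simp only [energyBall, residBall] at *
  linarith

/-- The monotonicity formula on balls. -/
lemma exists_setIntegral_monotonicity : ∃ C > 0, ∀ u : E 3 → ℝ, ContDiff ℝ 2 u →
    ∀ z : E 3, ∀ ρ > 0, ∀ s > 0,
    ∫ x in ball z ρ, (2 * s ^ 2 * wt s z x ^ 2 * edens u x + wt s z x * max (-disc u x) 0) ≤
      (∫ x in ball z (2 * ρ), wt s z x * max (disc u x) 0) + 1 / 4 * residBall u z (2 * ρ) +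
        C / ρ ^ 2 * energyBall u z (2 * ρ) := by
  obtain ⟨C, hC, hcut⟩ := exists_isCutoff
  refine ⟨3 * √(4 * C), by positivity, fun u hu z ρ hρ s hs => ?_⟩
  obtain ⟨ψ, hψ⟩ := hcut ρ hρ z
  have hu1 : ContDiff ℝ 1 u := hu.of_le (by norm_num)
  have cψ := hψ.contDiff.continuous
  have cw := (contDiff_wt (z := z) hs).continuous
  have ce := continuous_edens hu1
  have cd := continuous_disc hu1
  have key := integral_monotonicity hu hρ hs hψ (Real.sqrt_nonneg (4 * C))
    (Real.sq_sqrt (by positivity)).ge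
  have hw := fun x => (wt_pos (z := z) hs x).le
  have k1 := setIntegral_le_of_eq_one cψ hψ.compact (z := z) (ρ := ρ) (g := fun x =>
    2 * s ^ 2 * wt s z x ^ 2 * edens u x + wt s z x * max (-disc u x) 0) (by fun_prop) hψ.nonneg
    (fun x hx => hψ.eq_one x (ball_subset_closedBall hx)) fun x => by
      have := hw x
      have := edens_nonneg u x
      have := le_max_right (-disc u x) 0
      positivity
  have k2 := le_setIntegral_of_le_one cψ (g := fun x => wt s z x * max (disc u x) 0)
    (by fun_prop) hψ.eq_zero hψ.le_one fun x => mul_nonneg (hw x) (le_max_right _ _)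
  have k3 := le_setIntegral_of_le_one cψ (g := fun x => resid u x ^ 2)
    ((continuous_resid hu).pow 2) hψ.eq_zero hψ.le_one
    (fun x => sq_nonneg _)
  simp only [residBall]
  linarith


lemma wt_le_of_le {s t : ℝ} (hs : 0 < s) (h : s ≤ t) (z x : E 3) : wt t z x ≤ wt s z x := by
  rw [wt_eq, wt_eq]
  exact one_div_le_one_div_of_le (by positivity) (by gcongr)

lemma wt_le_inv_sq {s : ℝ} (hs : 0 < s) (z x : E 3) : wt s z x ≤ 1 / s ^ 2 := by
  rw [wt_eq]
  exact one_div_le_one_div_of_le (by positivity) (by linarith [sq_nonneg ‖x - z‖])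

lemma wt_le_of_notMem_ball {s r : ℝ} (hr : 0 < r) {z x : E 3} (hx : x ∉ ball z r) :
    wt s z x ≤ 1 / r ^ 2 := by
  rw [wt_eq]
  rw [mem_ball, dist_eq_norm, not_lt] at hx
  exact one_div_le_one_div_of_le (by positivity) (by nlinarith [sq_nonneg s])

lemma le_wt_of_mem_ball {s r : ℝ} (hs : 0 < s) (hr : s ≤ r) {z x : E 3} (hx : x ∈ ball z r) :
    1 / (2 * r ^ 2) ≤ wt s z x := by
  rw [wt_eq]
  rw [mem_ball, dist_eq_norm] at hx
  exact one_div_le_one_div_of_le (by positivity) (by nlinarith [norm_nonneg (x - z)])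

/-- Dyadic decomposition of the weighted integral. -/
lemma setIntegral_wt_le_sum {g : E 3 → ℝ} (hg : Continuous g) (hg0 : ∀ x, 0 ≤ g x) {s : ℝ}
    (hs : 0 < s) (z : E 3) (n : ℕ) :
    ∫ x in ball z (2 ^ n * s), wt s z x * g x ≤
      ∑ j ∈ Finset.range (n + 1), 4 / (2 ^ j * s) ^ 2 * ∫ x in ball z (2 ^ j * s), g x := by
  have cw := (contDiff_wt (z := z) hs).continuous
  induction n with
  | zero =>
    simp only [zero_add, Finset.sum_range_one, pow_zero, one_mul]
    rw [← integral_const_mul]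
    refine setIntegral_mono (integrableOn_ball (cw.mul hg) _ _)
      (integrableOn_ball (continuous_const.mul hg) _ _) fun x => ?_
    refine mul_le_mul_of_nonneg_right ((wt_le_inv_sq hs z x).trans ?_) (hg0 x)
    gcongr; norm_num
  | succ n ih =>
    rw [Finset.sum_range_succ]
    refine le_trans ?_ (add_le_add_left ih _)
    have hsub : ball z (2 ^ n * s) ⊆ ball z (2 ^ (n + 1) * s) :=
      ball_subset_ball (by gcongr <;> simp)
    have hi : Integrable ((ball z (2 ^ n * s)).indicator fun x => wt s z x * g x) :=
      (integrableOn_ball (cw.mul hg) z _).integrable_indicator measurableSet_ball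
    have h1 : ∫ x in ball z (2 ^ n * s), wt s z x * g x = ∫ x in ball z (2 ^ (n + 1) * s),
        (ball z (2 ^ n * s)).indicator (fun x => wt s z x * g x) x := by
      rw [setIntegral_indicator measurableSet_ball, inter_eq_self_of_subset_right hsub]
    have hj : IntegrableOn (fun x => 4 / (2 ^ (n + 1) * s) ^ 2 * g x)
        (ball z (2 ^ (n + 1) * s)) := integrableOn_ball (continuous_const.mul hg) _ _
    rw [h1, ← integral_const_mul, ← integral_add hi.integrableOn hj]
    refine setIntegral_mono (integrableOn_ball (cw.mul hg) _ _)
      (hi.integrableOn.add hj) fun x => ?_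
    by_cases hx : x ∈ ball z (2 ^ n * s)
    · simp only [indicator_of_mem hx]
      have : 0 ≤ 4 / (2 ^ (n + 1) * s) ^ 2 * g x := mul_nonneg (by positivity) (hg0 x)
      linarith
    · simp only [indicator_of_notMem hx, zero_add]
      refine mul_le_mul_of_nonneg_right ((wt_le_of_notMem_ball (by positivity) hx).trans_eq ?_)
        (hg0 x)
      field_simp; ring

/-- Lower dyadic bound of the weighted integral. -/
lemma sum_le_setIntegral_wt {g : E 3 → ℝ} (hg : Continuous g) (hg0 : ∀ x, 0 ≤ g x) {s : ℝ}
    (hs : 0 < s) (z : E 3) (n : ℕ) :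
    (∑ j ∈ Finset.range (n + 1), 1 / (2 ^ j * s) ^ 2 * ∫ x in ball z (2 ^ j * s), g x) +
        1 / 3 * (1 / (2 ^ n * s) ^ 2 * ∫ x in ball z (2 ^ n * s), g x) ≤
      8 / 3 * ∫ x in ball z (2 ^ n * s), wt s z x * g x := by
  have cw := (contDiff_wt (z := z) hs).continuous
  induction n with
  | zero =>
    simp only [zero_add, Finset.sum_range_one, pow_zero, one_mul]
    have : 1 / (2 * s ^ 2) * ∫ x in ball z s, g x ≤ ∫ x in ball z s, wt s z x * g x := by
      rw [← integral_const_mul]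
      refine setIntegral_mono_on (integrableOn_ball (continuous_const.mul hg) _ _)
        (integrableOn_ball (cw.mul hg) _ _) measurableSet_ball fun x hx => ?_
      exact mul_le_mul_of_nonneg_right (le_wt_of_mem_ball hs le_rfl hx) (hg0 x)
    have e : 1 / (2 * s ^ 2) = 1 / 2 * (1 / s ^ 2) := by field_simp
    rw [e] at this
    linarith
  | succ n ih =>
    rw [Finset.sum_range_succ]
    have hsub : ball z (2 ^ n * s) ⊆ ball z (2 ^ (n + 1) * s) :=
      ball_subset_ball (by gcongr <;> simp)
    have d1 := setIntegral_sdiff measurableSet_ball (integrableOn_ball hg z (2 ^ (n + 1) * s)) hsub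
    have d2 := setIntegral_sdiff measurableSet_ball
      (integrableOn_ball (cw.mul hg) z (2 ^ (n + 1) * s)) hsub
    have d3 : 1 / (2 * (2 ^ (n + 1) * s) ^ 2) *
        ∫ x in ball z (2 ^ (n + 1) * s) \ ball z (2 ^ n * s), g x ≤
        ∫ x in ball z (2 ^ (n + 1) * s) \ ball z (2 ^ n * s), wt s z x * g x := by
      rw [← integral_const_mul]
      refine setIntegral_mono_on
        ((integrableOn_ball (continuous_const.mul hg) _ _).mono_set sdiff_subset)
        ((integrableOn_ball (cw.mul hg) _ _).mono_set sdiff_subset)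
        (measurableSet_ball.diff measurableSet_ball) fun x hx => ?_
      refine mul_le_mul_of_nonneg_right (le_wt_of_mem_ball hs ?_ hx.1) (hg0 x)
      exact le_mul_of_one_le_left hs.le (one_le_pow₀ (by norm_num))
    have e1 : 1 / (2 * (2 ^ (n + 1) * s) ^ 2) = 1 / 2 * (1 / (2 ^ (n + 1) * s) ^ 2) := by
      field_simp
    have e2 : 1 / (2 ^ n * s) ^ 2 = 4 * (1 / (2 ^ (n + 1) * s) ^ 2) := by
      field_simp; ring
    simp only [Pi.mul_apply] at d2
    rw [e1, d1, d2, mul_sub] at d3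
    rw [e2] at ih
    linarith

lemma sum_geom_le {r : ℝ} (h0 : 0 ≤ r) (h1 : r < 1) (n : ℕ) :
    ∑ j ∈ Finset.range n, r ^ j ≤ (1 - r)⁻¹ := by
  rw [← tsum_geometric_of_lt_one h0 h1]
  exact (summable_geometric_of_lt_one h0 h1).sum_le_tsum _ fun i _ => pow_nonneg h0 i


/-- Energy density bounds at all dyadic scales from those at the largest scale. -/
lemma exists_density_bound : ∃ s ≥ 1, ∃ C > 0, ∀ u : E 3 → ℝ, ContDiff ℝ 2 u →
    HasCompactSupport u → ∀ (z : E 3) (N : ℕ),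
    (∀ i ≤ N + 2, energyBall u z (2 ^ i * s) / (2 ^ i * s) ^ 2 ≤
      C * (residBall u z (2 ^ (N + 2) * s) +
        energyBall u z (2 ^ (N + 2) * s) / (2 ^ (N + 2) * s) ^ 2)) ∧
    ∫ x in ball z (2 ^ N * s), wt s z x * max (-disc u x) 0 ≤
      C * (residBall u z (2 ^ (N + 2) * s) +
        energyBall u z (2 ^ (N + 2) * s) / (2 ^ (N + 2) * s) ^ 2) := by
  obtain ⟨C4, hC4, H4⟩ := exists_setIntegral_disc_le
  obtain ⟨C5, hC5, H5⟩ := exists_setIntegral_monotonicity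
  set s : ℝ := 3072 * (768 * C4 + 84) with hs
  have hs0 : 0 < s := by positivity
  refine ⟨s, by nlinarith, 2 * (5 / 2 + 32 * C5 + 4), by positivity, fun u hu huc z N => ?_⟩
  have hu1 : ContDiff ℝ 1 u := hu.of_le (by norm_num)
  set a : ℕ → ℝ := fun i => energyBall u z (2 ^ i * s) / (2 ^ i * s) ^ 2 with ha
  set F := residBall u z (2 ^ (N + 2) * s) with hF
  have hρ : ∀ i : ℕ, 0 < 2 ^ i * s := fun i => by positivity
  have hA : ∀ i, energyBall u z (2 ^ i * s) = a i * (2 ^ i * s) ^ 2 := fun i => by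
    simp only [ha]; rw [div_mul_cancel₀ _ (pow_pos (hρ i) 2).ne']
  have h2ρ : ∀ i : ℕ, 2 * (2 ^ i * s) = 2 ^ (i + 1) * s := fun i => by ring
  have ha0 : ∀ i, 0 ≤ a i := fun i => div_nonneg (energyBall_nonneg _ _ _) (sq_nonneg _)
  have hF0 : 0 ≤ F := residBall_nonneg _ _ _
  have hsubset : ∀ i j : ℕ, i ≤ j → ball z (2 ^ i * s) ⊆ ball z (2 ^ j * s) := fun i j h =>
    ball_subset_ball (by gcongr; norm_num)
  have hFi : ∀ i ≤ N + 2, residBall u z (2 ^ i * s) ≤ F := fun i hi =>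
    residBall_mono hu (hsubset i _ hi)
  have hlast : a (N + 1) ≤ 4 * a (N + 2) := by
    have := energyBall_mono hu (hsubset (N + 1) (N + 2) (by lia))
    rw [hA, hA] at this
    have e : (2 ^ (N + 2) * s) ^ 2 = 4 * (2 ^ (N + 1) * s) ^ 2 := by ring
    rw [e] at this
    have hp := pow_pos (hρ (N + 1)) 2
    refine le_of_mul_le_mul_right ?_ hp
    linarith
  obtain ⟨i0, hi0, hmax⟩ := Finset.exists_max_image (Finset.range (N + 3)) a ⟨0, by simp⟩
  set M := a i0 with hM
  have hle : ∀ i ≤ N + 2, a i ≤ M := fun i hi => hmax i (Finset.mem_range.2 (by lia))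
  have hM0 : 0 ≤ M := ha0 i0
  have hτ : 1 / (768 * C4 + 84) ^ 2 * (768 * C4 + 84) ≤ 1 := by
    have : 1 ≤ 768 * C4 + 84 := by linarith
    rw [one_div_mul_eq_div, div_le_one (by positivity)]
    nlinarith
  set τ := 1 / (768 * C4 + 84) ^ 2 with hτdef
  have hτ0 : 0 < τ := by positivity
  have hterm : ∀ j ≤ N + 1, 4 / (2 ^ j * s) ^ 2 * (∫ x in ball z (2 ^ j * s), max (disc u x) 0) ≤
      M / 24 * (2 / 3) ^ j + τ * (28 * F + 16 * C4 * M) * (9 / 16) ^ j := by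
    intro j hj
    have h := H4 u hu huc z (2 ^ j * s) (hρ j) (1 / 3072 * (2 / 3) ^ j) (by positivity)
      (mul_le_one₀ (by norm_num) (by positivity) (pow_le_one₀ (by norm_num) (by norm_num)))
    rw [h2ρ, hA] at h
    have hFj := hFi (j + 1) (by lia)
    have haj := hle (j + 1) (by lia)
    have hp := pow_pos (hρ j) 2
    calc _ ≤ 4 / (2 ^ j * s) ^ 2 * _ := mul_le_mul_of_nonneg_left h (by positivity)
      _ = a (j + 1) / 24 * (2 / 3) ^ j + τ * (28 * residBall u z (2 ^ (j + 1) * s) +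
          16 * C4 * a (j + 1)) * (9 / 16) ^ j := by
        have e1 : (9 / 16 : ℝ) ^ j * ((2 / 3) ^ j) ^ 2 * (2 ^ j) ^ 2 = 1 := by
          rw [← pow_mul, ← pow_mul, mul_comm j 2, pow_mul, pow_mul, ← mul_pow, ← mul_pow]
          norm_num
        have e2 : (2 ^ (j + 1) * s) ^ 2 = 4 * (2 ^ j * s) ^ 2 := by ring
        have e3 : τ * (9 / 16) ^ j = 1 / ((1 / 3072 * (2 / 3) ^ j) ^ 2 * (2 ^ j * s) ^ 2) := by
          rw [eq_div_iff (by positivity), hτdef, hs]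
          have : (768 * C4 + 84) ^ 2 ≠ 0 := by positivity
          calc _ = 1 / (768 * C4 + 84) ^ 2 * (768 * C4 + 84) ^ 2 *
              ((9 / 16 : ℝ) ^ j * ((2 / 3) ^ j) ^ 2 * (2 ^ j) ^ 2) := by ring
            _ = 1 := by rw [e1, mul_one, one_div_mul_cancel this]
        rw [mul_right_comm τ, e3, e2]
        generalize (2 ^ j * s) ^ 2 = R at *
        field_simp
        ring
      _ ≤ _ := by gcongr
  have hw : ∀ t, s ≤ t → ∫ x in ball z (2 ^ (N + 1) * s), wt t z x * max (disc u x) 0 ≤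
      3 / 16 * M + F := by
    intro t ht
    have cd : Continuous fun x => max (disc u x) 0 := (continuous_disc hu1).max continuous_const
    have c1 := (contDiff_wt (z := z) hs0).continuous
    have c2 := (contDiff_wt (z := z) (hs0.trans_le ht)).continuous
    have h1 : ∫ x in ball z (2 ^ (N + 1) * s), wt t z x * max (disc u x) 0 ≤
        ∫ x in ball z (2 ^ (N + 1) * s), wt s z x * max (disc u x) 0 :=
      setIntegral_mono (integrableOn_ball (c2.mul cd) _ _) (integrableOn_ball (c1.mul cd) _ _)
        fun x => mul_le_mul_of_nonneg_right (wt_le_of_le hs0 ht z x) (le_max_right _ _)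
    have h2 := setIntegral_wt_le_sum cd (fun x => le_max_right _ _) hs0 z (N + 1)
    have h3 := Finset.sum_le_sum fun j (hj : j ∈ Finset.range (N + 1 + 1)) =>
      hterm j (by have := Finset.mem_range.1 hj; lia)
    rw [Finset.sum_add_distrib, ← Finset.mul_sum, ← Finset.mul_sum] at h3
    have g1 := sum_geom_le (r := 2 / 3) (by norm_num) (by norm_num) (N + 1 + 1)
    have g2 := sum_geom_le (r := 9 / 16) (by norm_num) (by norm_num) (N + 1 + 1)
    have m1 := mul_le_mul_of_nonneg_left g1 (show 0 ≤ M / 24 by positivity)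
    have m2 := mul_le_mul_of_nonneg_left (g2.trans (show (1 - 9 / 16 : ℝ)⁻¹ ≤ 3 by norm_num))
      (show 0 ≤ τ * (28 * F + 16 * C4 * M) by positivity)
    have m3 : τ * C4 * M ≤ 1 / 768 * M := by
      refine mul_le_mul_of_nonneg_right ?_ hM0
      nlinarith
    have m4 : τ * F ≤ 1 / 84 * F := by
      refine mul_le_mul_of_nonneg_right ?_ hF0
      nlinarith
    norm_num at m1
    linarith
  have hmain : ∀ t, s ≤ t → ∫ x in ball z (2 ^ N * s),
      (2 * t ^ 2 * wt t z x ^ 2 * edens u x + wt t z x * max (-disc u x) 0) ≤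
      3 / 16 * M + (5 / 4 + 16 * C5) * (F + a (N + 2)) := by
    intro t ht
    have h := H5 u hu z (2 ^ N * s) (hρ N) t (hs0.trans_le ht)
    rw [h2ρ, hA] at h
    have h1 := hw t ht
    have h2 := hFi (N + 1) (by lia)
    have e : C5 / (2 ^ N * s) ^ 2 * (a (N + 1) * (2 ^ (N + 1) * s) ^ 2) = 4 * C5 * a (N + 1) := by
      have := (pow_pos (hρ N) 2).ne'
      rw [pow_succ 2 N]; field_simp; norm_num
    rw [e] at h
    have h3 := mul_le_mul_of_nonneg_left hlast hC5.le
    have h4 := ha0 (N + 2)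
    have h5 := mul_nonneg hC5.le hF0
    linarith
  have hsplit : ∀ t, s ≤ t → Continuous (fun x => 2 * t ^ 2 * wt t z x ^ 2 * edens u x) ∧
      Continuous fun x => wt t z x * max (-disc u x) 0 := by
    intro t ht
    have c2 := (contDiff_wt (z := z) (hs0.trans_le ht)).continuous
    have ce := continuous_edens hu1
    have cd := continuous_disc hu1
    constructor <;> fun_prop
  have hB0 : 0 ≤ F + a (N + 2) := add_nonneg hF0 (ha0 _)
  have hall : ∀ i ≤ N + 2, a i ≤ 3 / 8 * M + (5 / 2 + 32 * C5 + 4) * (F + a (N + 2)) := by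
    intro i hi
    have hCB : 0 ≤ C5 * (F + a (N + 2)) := by positivity
    rcases Nat.lt_or_ge N i with h | h
    · have : a i ≤ 4 * a (N + 2) := by
        rcases (show i = N + 1 ∨ i = N + 2 by lia) with rfl | rfl
        · exact hlast
        · linarith [ha0 (N + 2)]
      linarith
    · have hti : s ≤ 2 ^ i * s := le_mul_of_one_le_left hs0.le (one_le_pow₀ (by norm_num))
      have h1 := hmain _ hti
      have h2 : 1 / (2 * (2 ^ i * s) ^ 2) * energyBall u z (2 ^ i * s) ≤
          ∫ x in ball z (2 ^ i * s), (2 * (2 ^ i * s) ^ 2 * wt (2 ^ i * s) z x ^ 2 * edens u x +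
            wt (2 ^ i * s) z x * max (-disc u x) 0) := by
        rw [energyBall, ← integral_const_mul]
        refine setIntegral_mono_on (integrableOn_ball (continuous_const.mul
          (continuous_edens hu1)) _ _) (integrableOn_ball ((hsplit _ hti).1.add
          (hsplit _ hti).2) _ _) measurableSet_ball fun x hx => ?_
        have hwx := le_wt_of_mem_ball (hρ i) le_rfl hx
        have hw0 := (wt_pos (z := z) (hρ i) x).le
        have h3 : 0 ≤ wt (2 ^ i * s) z x * max (-disc u x) 0 :=
          mul_nonneg hw0 (le_max_right _ _)
        have h4 : 1 / (2 * (2 ^ i * s) ^ 2) ≤ 2 * (2 ^ i * s) ^ 2 * wt (2 ^ i * s) z x ^ 2 := by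
          have hp := pow_pos (hρ i) 2
          calc 1 / (2 * (2 ^ i * s) ^ 2) =
              2 * (2 ^ i * s) ^ 2 * (1 / (2 * (2 ^ i * s) ^ 2)) ^ 2 := by field_simp
            _ ≤ _ := by gcongr
        have h5 := mul_le_mul_of_nonneg_right h4 (edens_nonneg u x)
        linarith
      have h3 : ∫ x in ball z (2 ^ i * s), (2 * (2 ^ i * s) ^ 2 * wt (2 ^ i * s) z x ^ 2 *
          edens u x + wt (2 ^ i * s) z x * max (-disc u x) 0) ≤ ∫ x in ball z (2 ^ N * s),
          (2 * (2 ^ i * s) ^ 2 * wt (2 ^ i * s) z x ^ 2 * edens u x +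
            wt (2 ^ i * s) z x * max (-disc u x) 0) := by
        refine setIntegral_ball_mono ((hsplit _ hti).1.add (hsplit _ hti).2) (fun x => ?_)
          (hsubset i N h)
        exact add_nonneg (mul_nonneg (by positivity) (edens_nonneg u x))
          (mul_nonneg (wt_pos (hρ i) x).le (le_max_right _ _))
      have e : 1 / (2 * (2 ^ i * s) ^ 2) * energyBall u z (2 ^ i * s) = a i / 2 := by
        rw [hA]
        have := (pow_pos (hρ i) 2).ne'
        field_simp
      linarith
  have hMB : M ≤ 8 / 5 * ((5 / 2 + 32 * C5 + 4) * (F + a (N + 2))) := by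
    have := hall i0 (by have := Finset.mem_range.1 hi0; lia)
    linarith
  have hpos : 0 ≤ (5 / 2 + 32 * C5 + 4) * (F + a (N + 2)) := by positivity
  refine ⟨fun i hi => (hle i hi).trans (by linarith), ?_⟩
  have h1 := hmain s le_rfl
  have h2 : ∫ x in ball z (2 ^ N * s), wt s z x * max (-disc u x) 0 ≤
      ∫ x in ball z (2 ^ N * s),
        (2 * s ^ 2 * wt s z x ^ 2 * edens u x + wt s z x * max (-disc u x) 0) := by
    refine setIntegral_mono (integrableOn_ball (hsplit s le_rfl).2 _ _) (integrableOn_ball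
      ((hsplit s le_rfl).1.add (hsplit s le_rfl).2) _ _) fun x => ?_
    have h3 : 0 ≤ 2 * s ^ 2 * wt s z x ^ 2 * edens u x := by
      have := edens_nonneg u x
      positivity
    simp only
    linarith
  have hCB : 0 ≤ C5 * (F + a (N + 2)) := by positivity
  linarith

lemma wt_mul_den {s : ℝ} {z : E 3} (hs : 0 < s) (x : E 3) :
    wt s z x * (s ^ 2 + ∑ i, (x i - z i) ^ 2) = 1 := by
  have h := (wt_den_pos (z := z) hs x).ne'
  rw [wt, one_div, inv_mul_cancel₀ h]

/-- A Hardy type inequality with a regularised inverse square weight. -/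
lemma integral_wt_mul_sq_le {g : E 3 → ℝ} (hg : ContDiff ℝ 1 g) (hc : HasCompactSupport g)
    {s : ℝ} (hs : 0 < s) (z : E 3) :
    ∫ x, wt s z x * g x ^ 2 ≤ 4 * ∫ x, gsq g x := by
  have hw := contDiff_wt (z := z) hs
  have key : ∫ x, 1 / 2 * (wt s z x * g x ^ 2) ≤ ∫ x, 2 * gsq g x := by
    refine integral_le_of_div (fun i x => (x i - z i) * (wt s z x * g x ^ 2)) (fun i => ?_)
      (fun i => ?_) ?_ ?_ fun x => ?_
    · fun_prop
    · exact HasCompactSupport.intro hc fun x hx => by simp [image_eq_zero_of_notMem_tsupport hx]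
    · refine integrable_of_tsupport hc ?_ fun x hx => by
        simp [image_eq_zero_of_notMem_tsupport hx]
      have := hw.continuous
      have := hg.continuous
      fun_prop
    · exact integrable_of_tsupport hc ((continuous_gsq hg).const_mul 2) fun x hx => by
        simp [gsq_eq_zero_of_notMem_tsupport hx]
    · have dw := hw.differentiable (by norm_num) x
      have dg := hg.differentiable (by norm_num) x
      have hp : ∀ i, pd i (fun x => (x i - z i) * (wt s z x * g x ^ 2)) x =
          wt s z x * g x ^ 2 + (x i - z i) * (-2 * wt s z x ^ 2 * (x i - z i) * g x ^ 2 +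
            wt s z x * (2 * g x * pd i g x)) := fun i => by
        rw [pd_mul (by fun_prop) (dw.fun_mul (dg.fun_pow 2)), pd_coord_sub,
          pd_mul dw (dg.fun_pow 2), pd_wt hs, pd_pow 2 dg]
        simp
      simp only [hp, gsq, Fin.sum_univ_three]
      have h1 := wt_mul_den (z := z) hs x
      have h2 := wt_pos (z := z) hs x
      simp only [Fin.sum_univ_three] at h1
      generalize wt s z x = w at *
      generalize pd 0 g x = a at *
      generalize pd 1 g x = b at *
      generalize pd 2 g x = c at *
      generalize x 0 - z 0 = p at *
      generalize x 1 - z 1 = q at *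
      generalize x 2 - z 2 = r at *
      generalize g x = t at *
      have h3 : w ^ 2 * (p ^ 2 + q ^ 2 + r ^ 2) ≤ w := by
        have : w * (w * (p ^ 2 + q ^ 2 + r ^ 2)) ≤ w * 1 := by
          gcongr
          linarith [mul_nonneg h2.le (sq_nonneg s)]
        linarith
      linarith [mul_le_mul_of_nonneg_right h3 (sq_nonneg t), sq_nonneg (w * t * p + 2 * a),
        sq_nonneg (w * t * q + 2 * b), sq_nonneg (w * t * r + 2 * c)]
  rw [integral_const_mul, integral_const_mul] at key
  linarith

/-- The unnormalised Poisson type kernel used to recover point values. -/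
def peak (x : E 3) : ℝ := 3 * (1 + ‖x‖ ^ 2) ^ (-5 / 2 : ℝ)

lemma peak_pos (x : E 3) : 0 < peak x := by unfold peak; positivity

lemma integrable_peak : Integrable peak :=
  (integrable_rpow_neg_one_add_norm_sq (r := 5) (by simp; norm_num)).const_mul 3

lemma integral_peak_pos : 0 < ∫ x, peak x := by
  rw [integral_pos_iff_support_of_nonneg (fun x => (peak_pos x).le) integrable_peak]
  rw [show Function.support peak = univ from eq_univ_of_forall fun x => (peak_pos x).ne']
  simp

lemma tendsto_norm_pow_mul_peak :
    Tendsto (fun x : E 3 => ‖x‖ ^ 3 * peak x) (Bornology.cobounded (E 3)) (nhds 0) := by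
  have h1 : Tendsto (fun x : E 3 => 3 * ‖x‖⁻¹ ^ 2) (Bornology.cobounded (E 3)) (nhds 0) := by
    have := ((tendsto_inv_atTop_zero.comp (tendsto_norm_cobounded_atTop (E := E 3))).pow 2).const_mul
      3
    simpa using this
  refine tendsto_of_tendsto_of_tendsto_of_le_of_le' tendsto_const_nhds h1
    (Eventually.of_forall fun x => mul_nonneg (by positivity) (peak_pos x).le) ?_
  filter_upwards [tendsto_norm_cobounded_atTop.eventually_gt_atTop 0] with x hx
  have h2 : (1 + ‖x‖ ^ 2) ^ (-5 / 2 : ℝ) ≤ (‖x‖ ^ 2) ^ (-5 / 2 : ℝ) :=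
    Real.rpow_le_rpow_of_nonpos (by positivity) (by linarith) (by norm_num)
  have h3 : (‖x‖ ^ 2) ^ (-5 / 2 : ℝ) = (‖x‖ ^ 5)⁻¹ := by
    rw [← Real.rpow_natCast_mul hx.le, ← Real.rpow_natCast, ← Real.rpow_neg hx.le]
    norm_num
  calc ‖x‖ ^ 3 * peak x ≤ ‖x‖ ^ 3 * (3 * (‖x‖ ^ 5)⁻¹) := by
        unfold peak; rw [← h3]; gcongr
    _ = 3 * ‖x‖⁻¹ ^ 2 := by field_simp

lemma integral_peak_mul_le {v a : E 3 → ℝ} (hv : ContDiff ℝ 1 v) (hc : HasCompactSupport v)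
    (ha : Continuous a) (hac : HasCompactSupport a) (h0 : ∀ x, 0 ≤ a x)
    (hva : ∀ x, gsq v x ≤ a x ^ 2) {c : ℝ} (hcp : 0 < c) (z : E 3) :
    ∫ x, c ^ 3 * peak (c • (z - x)) * v x ≤ ∫ x, wt (1 / c) z x * a x := by
  have hcp' : 0 < 1 / c := by positivity
  have hD : ∀ x : E 3, 0 < 1 + c ^ 2 * ∑ j, (x j - z j) ^ 2 := fun x => by
    have := Finset.sum_nonneg fun (i : Fin 3) (_ : i ∈ Finset.univ) => sq_nonneg (x i - z i)
    positivity
  have hpk : ∀ x, peak (c • (z - x)) = 3 * (1 + c ^ 2 * ∑ j, (x j - z j) ^ 2) ^ (-5 / 2 : ℝ) :=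
    fun x => by rw [peak, norm_smul, mul_pow, norm_sub_rev, norm_sub_sq_eq_sum]; simp
  have hDc : ContDiff ℝ 1 fun x : E 3 => 1 + c ^ 2 * ∑ j, (x j - z j) ^ 2 := by fun_prop
  have hR : ∀ p : ℝ, ContDiff ℝ 1 fun x : E 3 => (1 + c ^ 2 * ∑ j, (x j - z j) ^ 2) ^ p :=
    fun p => hDc.rpow_const_of_ne fun x => (hD x).ne'
  have cpk : Continuous fun x => peak (c • (z - x)) := by
    simp only [hpk]; exact (hR _).continuous.const_mul 3
  have hw := contDiff_wt (z := z) hcp'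
  refine integral_le_of_div (fun i x => c ^ 3 * ((x i - z i) *
    ((1 + c ^ 2 * ∑ j, (x j - z j) ^ 2) ^ (-3 / 2 : ℝ) * v x))) (fun i => ?_)
      (fun i => ?_) ?_ ?_ fun x => ?_
  · have := hR (-3 / 2)
    fun_prop
  · exact HasCompactSupport.intro hc fun x hx => by simp [image_eq_zero_of_notMem_tsupport hx]
  · refine integrable_of_tsupport hc ?_ fun x hx => by
      simp [image_eq_zero_of_notMem_tsupport hx]
    have := hv.continuous
    fun_prop
  · exact (hw.continuous.mul ha).integrable_of_hasCompactSupport hac.mul_left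
  · have dv := hv.differentiable (by norm_num) x
    have dR := (hR (-3 / 2)).differentiable (by norm_num) x
    have hden : ∀ i, pd i (fun y : E 3 => 1 + c ^ 2 * ∑ j, (y j - z j) ^ 2) x =
        c ^ 2 * (2 * (x i - z i)) := fun i => by
      have hd : ∀ j, DifferentiableAt ℝ (fun y : E 3 => y j - z j) x := fun j => by fun_prop
      rw [pd_add (differentiableAt_const _) (by fun_prop), pd_const,
        pd_const_mul _ (by fun_prop), pd_sum _ fun j _ => (hd j).fun_pow 2]
      simp only [pd_pow 2 (hd _), pd_coord_sub]
      simp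
    have hp : ∀ i, pd i (fun x => c ^ 3 * ((x i - z i) *
        ((1 + c ^ 2 * ∑ j, (x j - z j) ^ 2) ^ (-3 / 2 : ℝ) * v x))) x =
        c ^ 3 * ((1 + c ^ 2 * ∑ j, (x j - z j) ^ 2) ^ (-3 / 2 : ℝ) * v x + (x i - z i) *
          ((-3 / 2) * (1 + c ^ 2 * ∑ j, (x j - z j) ^ 2) ^ (-5 / 2 : ℝ) *
            (c ^ 2 * (2 * (x i - z i))) * v x +
            (1 + c ^ 2 * ∑ j, (x j - z j) ^ 2) ^ (-3 / 2 : ℝ) * pd i v x)) := fun i => by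
      have hder := Real.hasDerivAt_rpow_const (x := 1 + c ^ 2 * ∑ j, (x j - z j) ^ 2)
        (p := -3 / 2) (Or.inl (hD x).ne')
      rw [show (-3 / 2 - 1 : ℝ) = -5 / 2 by norm_num] at hder
      rw [pd_const_mul _ (by fun_prop), pd_mul (by fun_prop) (dR.fun_mul dv), pd_coord_sub,
        pd_mul dR dv, pd_comp (f := fun y : E 3 => 1 + c ^ 2 * ∑ j, (y j - z j) ^ 2) hder
          (hDc.differentiable (by norm_num) x), hden]
      simp
    simp only [hp]
    have hq : (1 + c ^ 2 * ∑ j, (x j - z j) ^ 2) ^ (-3 / 2 : ℝ) =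
        (1 + c ^ 2 * ∑ j, (x j - z j) ^ 2) * (1 + c ^ 2 * ∑ j, (x j - z j) ^ 2) ^ (-5 / 2 : ℝ) := by
      rw [← Real.rpow_one_add' (hD x).le (by norm_num)]; norm_num
    have hq2 : (1 + c ^ 2 * ∑ j, (x j - z j) ^ 2) *
        ((1 + c ^ 2 * ∑ j, (x j - z j) ^ 2) ^ (-3 / 2 : ℝ)) ^ 2 *
        (1 + c ^ 2 * ∑ j, (x j - z j) ^ 2) ^ 2 = 1 := by
      rw [← Real.rpow_mul_natCast (hD x).le]
      have : (1 + c ^ 2 * ∑ j, (x j - z j) ^ 2) ^ (-3 / 2 * (2 : ℕ) : ℝ) =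
        ((1 + c ^ 2 * ∑ j, (x j - z j) ^ 2) ^ 3)⁻¹ := by
        rw [← Real.rpow_natCast (1 + c ^ 2 * ∑ j, (x j - z j) ^ 2), ← Real.rpow_neg (hD x).le]
        norm_num
      rw [this]
      have := (hD x).ne'
      field_simp
    have hwt : wt (1 / c) z x * (1 + c ^ 2 * ∑ j, (x j - z j) ^ 2) = c ^ 2 := by
      have := wt_mul_den (z := z) hcp' x
      calc _ = c ^ 2 * (wt (1 / c) z x * ((1 / c) ^ 2 + ∑ j, (x j - z j) ^ 2)) := by
            field_simp
        _ = c ^ 2 := by rw [this]; ring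
    have hcs : (∑ j, (x j - z j) * pd j v x) ^ 2 ≤ (∑ j, (x j - z j) ^ 2) * a x ^ 2 :=
      (Finset.sum_mul_sq_le_sq_mul_sq _ _ _).trans (by
        gcongr
        exact hva x)
    rw [hpk]
    have hDx := hD x
    have hRp : 0 < (1 + c ^ 2 * ∑ j, (x j - z j) ^ 2) ^ (-3 / 2 : ℝ) := Real.rpow_pos_of_pos hDx _
    have hS : 0 ≤ ∑ j, (x j - z j) ^ 2 := Finset.sum_nonneg fun _ _ => sq_nonneg _
    have ha0 := h0 x
    have hsum : ∀ R Q : ℝ, ∑ i, c ^ 3 * (R * v x + (x i - z i) *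
        ((-3 / 2) * Q * (c ^ 2 * (2 * (x i - z i))) * v x + R * pd i v x)) =
        c ^ 3 * (3 * R * v x - 3 * Q * c ^ 2 * (∑ j, (x j - z j) ^ 2) * v x +
          R * ∑ j, (x j - z j) * pd j v x) := fun R Q => by
      simp only [Fin.sum_univ_three]; ring
    rw [hsum]
    generalize (1 + c ^ 2 * ∑ j, (x j - z j) ^ 2) ^ (-3 / 2 : ℝ) = R at *
    generalize (1 + c ^ 2 * ∑ j, (x j - z j) ^ 2) ^ (-5 / 2 : ℝ) = Q at *
    generalize ∑ j, (x j - z j) ^ 2 = S at *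
    generalize ∑ j, (x j - z j) * pd j v x = Y at *
    generalize wt (1 / c) z x = w at *
    have hY : |c ^ 3 * R * Y| ≤ w * a x := by
      have hw0 : w = c ^ 2 / (1 + c ^ 2 * S) := by field_simp; exact hwt
      have hw1 : 0 ≤ w := by rw [hw0]; positivity
      refine abs_le_of_sq_le_sq ?_ (by positivity)
      have hw2 : w ^ 2 = c ^ 4 * ((1 + c ^ 2 * S) * R ^ 2) := by
        have h2 : (1 + c ^ 2 * S) * R ^ 2 = 1 / (1 + c ^ 2 * S) ^ 2 := by
          field_simp; linarith
        rw [h2, hw0]; field_simp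
      calc (c ^ 3 * R * Y) ^ 2 = c ^ 6 * R ^ 2 * Y ^ 2 := by ring
        _ ≤ c ^ 6 * R ^ 2 * (S * a x ^ 2) := by gcongr
        _ = c ^ 4 * ((c ^ 2 * S) * R ^ 2) * a x ^ 2 := by ring
        _ ≤ c ^ 4 * ((1 + c ^ 2 * S) * R ^ 2) * a x ^ 2 := by gcongr; linarith
        _ = (w * a x) ^ 2 := by rw [← hw2]; ring
    have := (abs_le.1 hY).1
    rw [hq] at this ⊢
    linarith

lemma integral_peak_mul_le_of_forall {v a : E 3 → ℝ} (hv : ContDiff ℝ 1 v)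
    (hc : HasCompactSupport v) (ha : Continuous a) (hac : HasCompactSupport a)
    (h0 : ∀ x, 0 ≤ a x) (hva : ∀ x, gsq v x ≤ a x ^ 2) {z : E 3} {M : ℝ}
    (hM : ∀ s, 0 < s → ∫ x, wt s z x * a x ≤ M) : (∫ x, peak x) * v z ≤ M := by
  have hI := integral_peak_pos
  have h := tendsto_integral_comp_smul_smul_of_integrable' (μ := volume) (F := E 3)
    (φ := fun x => peak x / ∫ y, peak y) (fun x => div_nonneg (peak_pos x).le hI.le)
    (by rw [integral_div, div_self hI.ne'])
    (by
      have := tendsto_norm_pow_mul_peak.div_const (∫ y, peak y)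
      simpa [mul_div_assoc] using this)
    (g := v) (x₀ := z) (hv.continuous.integrable_of_hasCompactSupport hc)
    hv.continuous.continuousAt
  have h2 : v z ≤ M / ∫ y, peak y := by
    refine le_of_tendsto h ?_
    filter_upwards [eventually_gt_atTop 0] with c hcp
    rw [le_div_iff₀ hI, ← integral_mul_const]
    refine le_trans (le_of_eq ?_) ((integral_peak_mul_le hv hc ha hac h0 hva hcp z).trans
      (hM _ (by positivity)))
    congr 1
    ext x
    simp only [finrank_euclideanSpace, Fintype.card_fin, smul_eq_mul]
    field_simp
  rw [le_div_iff₀ hI] at h2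
  linarith

lemma gsq_mul_le {f g : E 3 → ℝ} (hf : ContDiff ℝ 1 f) (hg : ContDiff ℝ 1 g) (x : E 3) :
    gsq (fun y => f y * g y) x ≤ 2 * (gsq g x * f x ^ 2) + 2 * (g x ^ 2 * gsq f x) := by
  have hp : ∀ i, pd i (fun y => f y * g y) x = pd i f x * g x + f x * pd i g x := fun i =>
    pd_mul (hf.differentiable (by norm_num) x) (hg.differentiable (by norm_num) x)
  simp only [gsq, hp, Fin.sum_univ_three]
  linarith [sq_nonneg (pd 0 f x * g x - f x * pd 0 g x),
    sq_nonneg (pd 1 f x * g x - f x * pd 1 g x),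
    sq_nonneg (pd 2 f x * g x - f x * pd 2 g x)]

lemma integral_hessian_sq_le {u η : E 3 → ℝ} (hu : ContDiff ℝ 2 u) (huc : HasCompactSupport u)
    (hη : ContDiff ℝ 1 η) (hc : HasCompactSupport η) :
    ∫ x, (∑ i, gsq (pd i u) x) * η x ^ 2 ≤
      4 * (∫ x, lap u x ^ 2 * η x ^ 2) + 6 * ∫ x, gsq u x * gsq η x := by
  have hu1 : ContDiff ℝ 1 u := hu.of_le (by norm_num)
  have hH := integral_hessian hu huc (hη.pow 2) (hasCompactSupport_sq hc)
  have i1 : Integrable fun x => (∑ i, gsq (pd i u) x) * η x ^ 2 :=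
    integrable_mul_sq hη hc (continuous_finsetSum _ fun i _ => continuous_gsq (contDiff_pd_one hu))
  have i2 : Integrable fun x => lap u x ^ 2 * η x ^ 2 :=
    integrable_mul_sq hη hc ((continuous_lap hu).pow 2)
  have i3 : Integrable fun x => gsq u x * gsq η x := integrable_mul_gsq hη hc (continuous_gsq hu1)
  have i4 : Integrable fun x => 1 / 2 * ((∑ i, gsq (pd i u) x) * η x ^ 2) -
      2 * (lap u x ^ 2 * η x ^ 2) := (i1.const_mul _).sub (i2.const_mul _)
  have i5 : Integrable fun x => 1 / 2 * ((∑ i, gsq (pd i u) x) * η x ^ 2) -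
      2 * (lap u x ^ 2 * η x ^ 2) - 3 * (gsq u x * gsq η x) := i4.sub (i3.const_mul _)
  have key : ∫ x, (1 / 2 * ((∑ i, gsq (pd i u) x) * η x ^ 2) -
      2 * (lap u x ^ 2 * η x ^ 2) - 3 * (gsq u x * gsq η x)) ≤ 0 := by
    rw [← hH]
    refine integral_mono i5 ?_ fun x => ?_
    · have cη := hη.continuous
      have c2 : ∀ i j, Continuous (pd i (pd j u)) := fun i j => continuous_pd (contDiff_pd_one hu)
      have c1 : ∀ i, Continuous (pd i u) := fun i => continuous_pd hu1
      have c3 : ∀ i, Continuous (pd i fun x => η x ^ 2) := fun i => continuous_pd (hη.pow 2)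
      refine integrable_of_tsupport hc (by fun_prop) fun x hx => ?_
      have h0 := image_eq_zero_of_notMem_tsupport hx
      have : ∀ i, pd i (fun x => η x ^ 2) x = 0 := fun i => by
        rw [pd_pow 2 (hη.differentiable (by norm_num) x), h0]; simp
      simp [this, h0]
    · have hp : ∀ i, pd i (fun x => η x ^ 2) x = 2 * η x * pd i η x := fun i => by
        rw [pd_pow 2 (hη.differentiable (by norm_num) x)]; simp
      simp only [hp]
      rw [lap_eq_sum_pd hu]
      have h1 : -(η x * ∑ i, ∑ j, pd i (pd j u) x * (pd j u x * pd i η x)) ≤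
          1 / 4 * (η x ^ 2 * ∑ i, ∑ j, pd i (pd j u) x ^ 2) + gsq u x * gsq η x := by
        have : gsq u x * gsq η x = ∑ i, ∑ j, (pd j u x * pd i η x) ^ 2 := by
          simp only [gsq, Finset.sum_mul_sum, mul_pow]
          rw [Finset.sum_comm]
        rw [this, Finset.mul_sum, Finset.mul_sum, Finset.mul_sum, ← Finset.sum_neg_distrib,
          ← Finset.sum_add_distrib]
        refine Finset.sum_le_sum fun i _ => ?_
        rw [Finset.mul_sum, Finset.mul_sum, Finset.mul_sum, ← Finset.sum_neg_distrib,
          ← Finset.sum_add_distrib]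
        refine Finset.sum_le_sum fun j _ => ?_
        linarith [sq_nonneg (η x * pd i (pd j u) x / 2 + pd j u x * pd i η x)]
      have h2 := gdot_sq_le u η x
      have h3 := sq_nonneg (η x * (∑ j, pd j (pd j u) x) - gdot u η x)
      have h4 : ∑ i, gsq (pd i u) x = ∑ i, ∑ j, pd i (pd j u) x ^ 2 := by
        simp only [gsq]; rw [Finset.sum_comm]
      have h5 : ∑ i, ((∑ j, pd i (pd j u) x * pd j u x) - (∑ j, pd j (pd j u) x) * pd i u x) *
          (2 * η x * pd i η x) = 2 * (η x * ∑ i, ∑ j, pd i (pd j u) x * (pd j u x * pd i η x)) -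
            2 * (η x * (∑ j, pd j (pd j u) x) * gdot u η x) := by
        simp only [gdot, Fin.sum_univ_three]; ring
      rw [h4, h5]
      nlinarith [h1, h2, h3]
  rw [integral_sub i4 (i3.const_mul _), integral_sub (i1.const_mul _) (i2.const_mul _),
    integral_const_mul, integral_const_mul, integral_const_mul] at key
  linarith

lemma W'_sq_le (t : ℝ) : W' t ^ 2 ≤ 8 * W t + 4 * (t ^ 2 * smoothPos 1 (t ^ 2 - 1) ^ 2) := by
  have h : W' t ^ 2 = t ^ 2 * (t ^ 2 - 1) ^ 2 := by unfold W'; ring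
  rw [h]
  rcases le_total (t ^ 2 - 1) 1 with h1 | h1
  · have : t ^ 2 * (t ^ 2 - 1) ^ 2 ≤ 2 * (t ^ 2 - 1) ^ 2 := by gcongr; linarith
    have h3 : 0 ≤ t ^ 2 * smoothPos 1 (t ^ 2 - 1) ^ 2 := by positivity
    unfold W
    linarith
  · have h2 := half_le_smoothPos one_pos h1
    have : (t ^ 2 - 1) ^ 2 ≤ (2 * smoothPos 1 (t ^ 2 - 1)) ^ 2 := by
      gcongr
      linarith
    linarith [mul_le_mul_of_nonneg_left this (sq_nonneg t), W_nonneg t]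

lemma integral_lap_sq_le {u η : E 3 → ℝ} (hu : ContDiff ℝ 2 u)
    (hη : ContDiff ℝ 1 η) (hc : HasCompactSupport η) :
    ∫ x, lap u x ^ 2 * η x ^ 2 ≤ 18 * (∫ x, resid u x ^ 2 * η x ^ 2) +
      16 * (∫ x, W (u x) * η x ^ 2) + 64 * ∫ x, gsq u x * gsq η x := by
  have hu1 : ContDiff ℝ 1 u := hu.of_le (by norm_num)
  have cu := hu.continuous
  have csp := continuous_smoothPos (τ := 1) one_pos
  have i0 : Integrable fun x => lap u x ^ 2 * η x ^ 2 :=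
    integrable_mul_sq hη hc ((continuous_lap hu).pow 2)
  have i1 : Integrable fun x => resid u x ^ 2 * η x ^ 2 :=
    integrable_mul_sq hη hc ((continuous_resid hu).pow 2)
  have i2 : Integrable fun x => W (u x) * η x ^ 2 :=
    integrable_mul_sq hη hc (continuous_W.comp cu)
  have i3 : Integrable fun x => gsq u x * gsq η x := integrable_mul_gsq hη hc (continuous_gsq hu1)
  have i4 : Integrable fun x => u x ^ 2 * smoothPos 1 (u x ^ 2 - 1) ^ 2 * η x ^ 2 :=
    integrable_mul_sq hη hc (by fun_prop)
  have h := integral_outside_le hu hη hc one_pos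
  rw [integral_add i1 (i3.const_mul 4), integral_const_mul] at h
  have i12 : Integrable fun x => 2 * (resid u x ^ 2 * η x ^ 2) + 16 * (W (u x) * η x ^ 2) :=
    (i1.const_mul _).add (i2.const_mul _)
  have key : ∫ x, lap u x ^ 2 * η x ^ 2 ≤ ∫ x, (2 * (resid u x ^ 2 * η x ^ 2) +
      16 * (W (u x) * η x ^ 2) + 8 * (u x ^ 2 * smoothPos 1 (u x ^ 2 - 1) ^ 2 * η x ^ 2)) := by
    refine integral_mono i0 (i12.add (i4.const_mul _)) fun x => ?_
    have h1 : lap u x ^ 2 ≤ 2 * resid u x ^ 2 + 2 * W' (u x) ^ 2 := by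
      have : lap u x = resid u x + W' (u x) := by unfold resid; ring
      rw [this]
      linarith [sq_nonneg (resid u x - W' (u x))]
    have h2 := h1.trans (add_le_add_right
      (mul_le_mul_of_nonneg_left (W'_sq_le (u x)) zero_le_two) _)
    have h3 := mul_le_mul_of_nonneg_right h2 (sq_nonneg (η x))
    simp only
    linarith
  rw [integral_add i12 (i4.const_mul _), integral_add (i1.const_mul _) (i2.const_mul _),
    integral_const_mul, integral_const_mul, integral_const_mul] at key
  linarith

section Cutoff

variable {C ρ : ℝ} {z : E 3} {η g : E 3 → ℝ}

lemma IsCutoff.integral_mul_sq_le (hη : IsCutoff C ρ z η) (hg : Continuous g) (h0 : ∀ x, 0 ≤ g x) :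
    ∫ x, g x * η x ^ 2 ≤ ∫ x in ball z (2 * ρ), g x := by
  rw [← integral_indicator measurableSet_ball]
  refine integral_mono (integrable_mul_sq (hη.contDiff.of_le (by norm_num)) hη.compact hg)
    ((integrableOn_ball hg z _).integrable_indicator measurableSet_ball) fun x => ?_
  simp only
  by_cases hx : x ∈ ball z (2 * ρ)
  · rw [indicator_of_mem hx]
    exact mul_le_of_le_one_right (h0 x) (pow_le_one₀ (hη.nonneg x) (hη.le_one x))
  · rw [indicator_of_notMem hx, hη.eq_zero x hx]; simp

lemma IsCutoff.integral_mul_gsq_le (hη : IsCutoff C ρ z η) (hg : Continuous g)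
    (h0 : ∀ x, 0 ≤ g x) :
    ∫ x, g x * gsq η x ≤ C / ρ ^ 2 * ∫ x in ball z (2 * ρ), g x := by
  rw [← integral_indicator measurableSet_ball, ← integral_const_mul]
  refine integral_mono (integrable_mul_gsq (hη.contDiff.of_le (by norm_num)) hη.compact hg)
    (((integrableOn_ball hg z _).integrable_indicator measurableSet_ball).const_mul _) fun x => ?_
  simp only
  by_cases hx : x ∈ ball z (2 * ρ)
  · rw [indicator_of_mem hx, mul_comm]
    exact mul_le_mul_of_nonneg_right (hη.gsq_le x) (h0 x)
  · rw [indicator_of_notMem hx]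
    simp [gsq, hη.pd_eq_zero _ x (Or.inr hx)]

end Cutoff

lemma gsq_cutoff_mul_le {u η : E 3 → ℝ} (hu : ContDiff ℝ 1 u) (hη : ContDiff ℝ 1 η) {δ : ℝ}
    (hδ : 0 < δ) (x : E 3) :
    gsq (fun y => η y ^ 2 * (1 - u y ^ 2)) x ≤
      (δ * (η x * u x) ^ 2 + δ * η x ^ 2 + 1 / δ * (gsq u x * η x ^ 2) +
        1 / δ * (gsq η x * (4 * W (u x)))) ^ 2 := by
  have du := hu.differentiable (by norm_num) x
  have dη := hη.differentiable (by norm_num) x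
  have hp : ∀ i, pd i (fun y => η y ^ 2 * (1 - u y ^ 2)) x =
      2 * η x * (1 - u x ^ 2) * pd i η x - 2 * η x ^ 2 * u x * pd i u x := fun i => by
    rw [pd_mul (dη.fun_pow 2) ((differentiableAt_const _).fun_sub (du.fun_pow 2)),
      pd_pow 2 dη, pd_sub (differentiableAt_const _) (du.fun_pow 2), pd_const, pd_pow 2 du]
    simp; ring
  have hexp : gsq (fun y => η y ^ 2 * (1 - u y ^ 2)) x =
      (2 * η x * (1 - u x ^ 2)) ^ 2 * gsq η x + (2 * η x ^ 2 * u x) ^ 2 * gsq u x -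
        2 * (2 * η x * (1 - u x ^ 2)) * (2 * η x ^ 2 * u x) * gdot u η x := by
    simp only [gsq, gdot, hp, Fin.sum_univ_three]; ring
  have hcs := gdot_sq_le u η x
  have hA := Real.sq_sqrt (gsq_nonneg η x)
  have hB := Real.sq_sqrt (gsq_nonneg u x)
  have hA0 := Real.sqrt_nonneg (gsq η x)
  have hB0 := Real.sqrt_nonneg (gsq u x)
  rw [hexp]
  unfold W
  rw [← hA, ← hB] at hcs ⊢
  generalize √(gsq η x) = A at *
  generalize √(gsq u x) = B at *
  have hcs' : |gdot u η x| ≤ B * A := abs_le_of_sq_le_sq (by linarith) (by positivity)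
  generalize gdot u η x = D at *
  generalize η x = h at *
  generalize u x = w at *
  set p := 2 * h * (1 - w ^ 2)
  set q := 2 * h ^ 2 * w
  have h1 : p ^ 2 * A ^ 2 + q ^ 2 * B ^ 2 - 2 * p * q * D ≤ (|p| * A + |q| * B) ^ 2 := by
    have h2 : -(p * q * D) ≤ |p| * |q| * (B * A) := by
      refine (neg_le_abs _).trans ?_
      rw [abs_mul, abs_mul]
      gcongr
    have e1 := sq_abs p
    have e2 := sq_abs q
    calc _ ≤ p ^ 2 * A ^ 2 + q ^ 2 * B ^ 2 + 2 * (|p| * |q| * (B * A)) := by linarith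
      _ = (|p| * A + |q| * B) ^ 2 := by rw [← e1, ← e2]; ring
  refine h1.trans ?_
  have key : ∀ a b : ℝ, 2 * (a * b) ≤ δ * a ^ 2 + 1 / δ * b ^ 2 := fun a b => by
    have := sq_nonneg (δ * a - b)
    have h3 : δ * a ^ 2 + 1 / δ * b ^ 2 - 2 * (a * b) = (δ * a - b) ^ 2 / δ := by
      field_simp; ring
    have h4 : 0 ≤ (δ * a - b) ^ 2 / δ := by positivity
    linarith
  have k1 := key |h| (A * |1 - w ^ 2|)
  have k2 := key |h * w| (B * |h|)
  have e3 : |p| = 2 * |h| * |1 - w ^ 2| := by simp [p, abs_mul]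
  have e4 : |q| = 2 * |h| * |h * w| := by
    rw [show q = 2 * h * (h * w) by ring, abs_mul, abs_mul]; simp
  rw [e3, e4]
  refine pow_le_pow_left₀ (by positivity) ?_ 2
  rw [mul_pow, sq_abs, sq_abs] at k1 k2
  have e5 : (1 - w ^ 2) ^ 2 = 4 * ((w ^ 2 - 1) ^ 2 / 4) := by ring
  rw [e5] at k1
  linarith

/-- A point where the phase is far from the wells carries a definite amount of energy. -/
lemma exists_energy_lower_bound {b : ℝ} (hb0 : 0 ≤ b) (hb : b < 1) :
    ∃ c > 0, ∀ u : E 3 → ℝ, ContDiff ℝ 2 u → HasCompactSupport u → ∀ z, |u z| ≤ b →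
      c ≤ energyBall u z 2 + residBall u z 2 := by
  obtain ⟨C, hC, hcut⟩ := exists_isCutoff
  set V : ℝ := volume.real (ball (0 : E 3) 2) with hV
  have hV0 : 0 ≤ V := measureReal_nonneg
  set κ : ℝ := ∫ x, peak x with hκdef
  have hκ : 0 < κ := integral_peak_pos
  have main : ∀ u : E 3 → ℝ, ContDiff ℝ 2 u → HasCompactSupport u → ∀ z, |u z| ≤ b →
      ∀ δ > 0, κ * (1 - b ^ 2) ≤
        δ * (4 * (4 * energyBall u z 2 + 2 * C * (2 * V + energyBall u z 2)) + 4 * C * V) +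
        1 / δ * (4 * (2 * (4 * (18 * residBall u z 2 + 16 * energyBall u z 2 +
          64 * (C * (2 * energyBall u z 2))) + 6 * (C * (2 * energyBall u z 2))) +
          2 * (C * (2 * energyBall u z 2))) + 4 * (C * energyBall u z 2)) := by
    intro u hu huc z hz δ hδ
    obtain ⟨η, hη⟩ := hcut 1 one_pos z
    have hη1 : ContDiff ℝ 1 η := hη.contDiff.of_le (by norm_num)
    have hu1 : ContDiff ℝ 1 u := hu.of_le (by norm_num)
    have cu := hu.continuous
    have cη := hη1.continuous
    have cg := continuous_gsq hu1
    have cgη := continuous_gsq hη1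
    have cW := continuous_W
    have ce := continuous_edens hu1
    have sq1 : ∀ g : E 3 → ℝ, Continuous g → (∀ x, 0 ≤ g x) →
        ∫ x, g x * η x ^ 2 ≤ ∫ x in ball z 2, g x := fun g hg h0 => by
      simpa using hη.integral_mul_sq_le hg h0
    have sq2 : ∀ g : E 3 → ℝ, Continuous g → (∀ x, 0 ≤ g x) →
        ∫ x, g x * gsq η x ≤ C * ∫ x in ball z 2, g x := fun g hg h0 => by
      simpa using hη.integral_mul_gsq_le hg h0
    have hgE : ∫ x in ball z 2, gsq u x ≤ 2 * energyBall u z 2 := by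
      rw [energyBall, ← integral_const_mul]
      refine integral_mono (integrableOn_ball cg z 2) ((integrableOn_ball ce z 2).const_mul 2)
        fun x => ?_
      simp only [edens]; linarith [W_nonneg (u x)]
    have hWE : ∫ x in ball z 2, W (u x) ≤ energyBall u z 2 := by
      refine integral_mono (integrableOn_ball (cW.comp cu) z 2) (integrableOn_ball ce z 2)
        fun x => ?_
      simp only [edens]; linarith [gsq_nonneg u x]
    have hVz : ∫ x in ball z 2, (1 : ℝ) = V := by
      simp [hV, Measure.real, Measure.addHaar_ball_center]
    have huE : ∫ x in ball z 2, u x ^ 2 ≤ 2 * V + energyBall u z 2 := by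
      have : ∫ x in ball z 2, u x ^ 2 ≤ ∫ x in ball z 2, ((2 : ℝ) * 1 + W (u x)) := by
        refine integral_mono (integrableOn_ball (cu.pow 2) z 2)
          (integrableOn_ball (by fun_prop) z 2) fun x => ?_
        simp only [W]; linarith [sq_nonneg (u x ^ 2 - 1 - 2)]
      rw [integral_add (integrableOn_ball (by fun_prop) z 2)
        (integrableOn_ball (by fun_prop) z 2), integral_const_mul, hVz] at this
      linarith
    have hA1 : ∫ x, gsq (fun y => η y * u y) x ≤
        4 * energyBall u z 2 + 2 * C * (2 * V + energyBall u z 2) := by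
      have i1 := integrable_mul_sq hη1 hη.compact cg
      have i2 : Integrable fun x => u x ^ 2 * gsq η x :=
        integrable_mul_gsq hη1 hη.compact (cu.pow 2)
      have : ∫ x, gsq (fun y => η y * u y) x ≤
          ∫ x, (2 * (gsq u x * η x ^ 2) + 2 * (u x ^ 2 * gsq η x)) :=
        integral_mono (integrable_of_tsupport (hη.compact.mul_right (f' := u))
          (continuous_gsq (hη1.mul hu1)) fun x hx => gsq_eq_zero_of_notMem_tsupport hx)
          ((i1.const_mul 2).add (i2.const_mul 2)) fun x => gsq_mul_le hη1 hu1 x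
      rw [integral_add (i1.const_mul 2) (i2.const_mul 2), integral_const_mul,
        integral_const_mul] at this
      have a1 := sq1 _ cg (gsq_nonneg u)
      have a2 := sq2 _ (cu.pow 2) fun x => sq_nonneg _
      have a3 := mul_le_mul_of_nonneg_left huE hC.le
      simp only [Pi.pow_apply] at a2
      linarith
    have hA2 : ∫ x, gsq η x ≤ C * V := by
      have := sq2 (fun _ => 1) continuous_const fun _ => zero_le_one
      rw [hVz] at this
      simpa using this
    have hgg : ∫ x, gsq u x * gsq η x ≤ C * (2 * energyBall u z 2) :=
      (sq2 _ cg (gsq_nonneg u)).trans (mul_le_mul_of_nonneg_left hgE hC.le)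
    have hlap := integral_lap_sq_le hu hη1 hη.compact
    have hf := sq1 _ ((continuous_resid hu).pow 2) fun x => sq_nonneg (resid u x)
    have hWW := (sq1 _ (cW.comp cu) fun x => W_nonneg (u x)).trans hWE
    have hhes := integral_hessian_sq_le hu huc hη1 hη.compact
    have hA3 : ∀ s > 0, ∫ x, wt s z x * (gsq u x * η x ^ 2) ≤
        4 * (2 * (∫ x, (∑ i, gsq (pd i u) x) * η x ^ 2) + 2 * ∫ x, gsq u x * gsq η x) := by
      intro s hs
      have cw := (contDiff_wt (z := z) hs).continuous
      have hpi : ∀ i, ContDiff ℝ 1 (pd i u) := fun i => contDiff_pd_one hu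
      have hv : ∀ i, ContDiff ℝ 1 fun y => η y * pd i u y := fun i => hη1.mul (hpi i)
      have hvc : ∀ i, HasCompactSupport fun y => η y * pd i u y := fun i => hη.compact.mul_right
      have i0 : ∀ i, Integrable fun x => wt s z x * (η x * pd i u x) ^ 2 := fun i =>
        (integrable_mul_sq (hv i) (hvc i) cw)
      have i1 : ∀ i, Integrable fun x => gsq (pd i u) x * η x ^ 2 := fun i =>
        integrable_mul_sq hη1 hη.compact (continuous_gsq (hpi i))
      have i2 : ∀ i, Integrable fun x => pd i u x ^ 2 * gsq η x := fun i =>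
        integrable_mul_gsq hη1 hη.compact ((hpi i).continuous.pow 2)
      calc ∫ x, wt s z x * (gsq u x * η x ^ 2)
          = ∑ i, ∫ x, wt s z x * (η x * pd i u x) ^ 2 := by
            rw [← integral_finsetSum _ fun i _ => i0 i]
            congr 1; ext x
            simp only [gsq, Fin.sum_univ_three]; ring
        _ ≤ ∑ i, 4 * (2 * (∫ x, gsq (pd i u) x * η x ^ 2) + 2 * ∫ x, pd i u x ^ 2 * gsq η x) := by
            refine Finset.sum_le_sum fun i _ => (integral_wt_mul_sq_le (hv i) (hvc i) hs z).trans ?_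
            rw [← integral_const_mul 2, ← integral_const_mul 2,
              ← integral_add ((i1 i).const_mul 2) ((i2 i).const_mul 2)]
            refine mul_le_mul_of_nonneg_left ?_ (by norm_num)
            exact integral_mono (integrable_of_tsupport (hvc i)
              (continuous_gsq (hv i)) fun x hx => gsq_eq_zero_of_notMem_tsupport hx)
              (((i1 i).const_mul 2).add ((i2 i).const_mul 2)) fun x => gsq_mul_le hη1 (hpi i) x
        _ = _ := by
            rw [← Finset.mul_sum, Finset.sum_add_distrib, ← Finset.mul_sum, ← Finset.mul_sum,
              ← integral_finsetSum _ fun i _ => i1 i, ← integral_finsetSum _ fun i _ => i2 i]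
            simp only [Finset.sum_mul, gsq]
    have hA4 : ∀ s > 0, ∫ x, wt s z x * (gsq η x * (4 * W (u x))) ≤ 4 * (C * energyBall u z 2) := by
      intro s hs
      have cw := (contDiff_wt (z := z) hs).continuous
      calc ∫ x, wt s z x * (gsq η x * (4 * W (u x))) ≤ ∫ x, 4 * (W (u x) * gsq η x) := by
            refine integral_mono (integrable_of_tsupport hη.compact (by fun_prop) fun x hx => by
                simp [gsq_eq_zero_of_notMem_tsupport hx])
              ((integrable_mul_gsq hη1 hη.compact (cW.comp cu)).const_mul 4) fun x => ?_
            simp only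
            by_cases hx : x ∈ closedBall z 1
            · simp [gsq, hη.pd_eq_zero _ x (Or.inl hx)]
            · have h1 : wt s z x ≤ 1 := by
                rw [mem_closedBall, dist_eq_norm, not_le] at hx
                rw [wt_eq, div_le_one (by positivity)]
                have : (1 : ℝ) ≤ ‖x - z‖ ^ 2 := one_le_pow₀ hx.le
                linarith [sq_nonneg s]
              have h2 : 0 ≤ gsq η x * (4 * W (u x)) :=
                mul_nonneg (gsq_nonneg η x) (mul_nonneg (by norm_num) (W_nonneg _))
              linarith [mul_le_of_le_one_left h2 h1]
        _ ≤ _ := by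
            rw [integral_const_mul]
            have := (sq2 _ (cW.comp cu) fun x => W_nonneg (u x)).trans
              (mul_le_mul_of_nonneg_left hWE hC.le)
            simp only [Function.comp] at this
            linarith
    have hηz : η z = 1 := hη.eq_one z (mem_closedBall_self zero_le_one)
    have hfin := integral_peak_mul_le_of_forall (z := z)
      (v := fun y => η y ^ 2 * (1 - u y ^ 2))
      (a := fun x => δ * (η x * u x) ^ 2 + δ * η x ^ 2 + 1 / δ * (gsq u x * η x ^ 2) +
        1 / δ * (gsq η x * (4 * W (u x))))
      (M := δ * (4 * (4 * energyBall u z 2 + 2 * C * (2 * V + energyBall u z 2)) + 4 * C * V) +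
        1 / δ * (4 * (2 * (4 * (18 * residBall u z 2 + 16 * energyBall u z 2 +
          64 * (C * (2 * energyBall u z 2))) + 6 * (C * (2 * energyBall u z 2))) +
          2 * (C * (2 * energyBall u z 2))) + 4 * (C * energyBall u z 2)))
      (by fun_prop)
      (HasCompactSupport.intro hη.compact fun x hx => by
        simp [image_eq_zero_of_notMem_tsupport hx]) (by fun_prop)
      (HasCompactSupport.intro hη.compact fun x hx => by
        simp [image_eq_zero_of_notMem_tsupport hx, gsq_eq_zero_of_notMem_tsupport hx])
      (fun x => by
        have := gsq_nonneg u x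
        have := gsq_nonneg η x
        have := W_nonneg (u x)
        positivity) (fun x => gsq_cutoff_mul_le hu1 hη1 hδ x) ?_
    · refine le_trans ?_ hfin
      rw [hηz]
      have : u z ^ 2 ≤ b ^ 2 := sq_le_sq' (abs_le.1 hz).1 (abs_le.1 hz).2
      refine mul_le_mul_of_nonneg_left ?_ hκ.le
      linarith
    · intro s hs
      have cw := (contDiff_wt (z := z) hs).continuous
      have hv : ContDiff ℝ 1 fun y => η y * u y := hη1.mul hu1
      have hvc : HasCompactSupport fun y => η y * u y := hη.compact.mul_right
      have j1 : Integrable fun x => δ * (wt s z x * (η x * u x) ^ 2) :=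
        (integrable_mul_sq hv hvc cw).const_mul _
      have j2 : Integrable fun x => δ * (wt s z x * η x ^ 2) :=
        (integrable_mul_sq hη1 hη.compact cw).const_mul _
      have j3 : Integrable fun x => 1 / δ * (wt s z x * (gsq u x * η x ^ 2)) := by
        refine Integrable.const_mul ?_ _
        refine integrable_of_tsupport hη.compact (by fun_prop) fun x hx => by
          simp [image_eq_zero_of_notMem_tsupport hx]
      have j4 : Integrable fun x => 1 / δ * (wt s z x * (gsq η x * (4 * W (u x)))) := by
        refine Integrable.const_mul ?_ _
        refine integrable_of_tsupport hη.compact (by fun_prop) fun x hx => by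
          simp [gsq_eq_zero_of_notMem_tsupport hx]
      have j12 : Integrable fun x => δ * (wt s z x * (η x * u x) ^ 2) +
          δ * (wt s z x * η x ^ 2) := j1.add j2
      have j123 : Integrable fun x => δ * (wt s z x * (η x * u x) ^ 2) +
          δ * (wt s z x * η x ^ 2) + 1 / δ * (wt s z x * (gsq u x * η x ^ 2)) := j12.add j3
      have hsplit : ∫ x, wt s z x * (δ * (η x * u x) ^ 2 + δ * η x ^ 2 +
          1 / δ * (gsq u x * η x ^ 2) + 1 / δ * (gsq η x * (4 * W (u x)))) =
          δ * (∫ x, wt s z x * (η x * u x) ^ 2) + δ * (∫ x, wt s z x * η x ^ 2) +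
          1 / δ * (∫ x, wt s z x * (gsq u x * η x ^ 2)) +
          1 / δ * ∫ x, wt s z x * (gsq η x * (4 * W (u x))) := by
        rw [← integral_const_mul, ← integral_const_mul, ← integral_const_mul,
          ← integral_const_mul, ← integral_add j1 j2, ← integral_add j12 j3,
          ← integral_add j123 j4]
        congr 1; ext x; ring
      rw [hsplit]
      have b1 := (integral_wt_mul_sq_le hv hvc hs z).trans
        (mul_le_mul_of_nonneg_left hA1 (by norm_num))
      have b2 := (integral_wt_mul_sq_le hη1 hη.compact hs z).trans
        (mul_le_mul_of_nonneg_left hA2 (by norm_num))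
      have b3 := hA3 s hs
      have b4 := hA4 s hs
      have b3' : ∫ x, wt s z x * (gsq u x * η x ^ 2) ≤
          4 * (2 * (4 * (18 * residBall u z 2 + 16 * energyBall u z 2 +
          64 * (C * (2 * energyBall u z 2))) + 6 * (C * (2 * energyBall u z 2))) +
          2 * (C * (2 * energyBall u z 2))) := by
        simp only [Function.comp, Pi.pow_apply] at hWW hf
        unfold residBall
        linarith
      have hd' : 0 ≤ 1 / δ := by positivity
      linarith [mul_le_mul_of_nonneg_left b1 hδ.le, mul_le_mul_of_nonneg_left b2 hδ.le,
        mul_le_mul_of_nonneg_left b3' hd', mul_le_mul_of_nonneg_left b4 hd']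
  set A1 : ℝ := 4 * (4 + 2 * C * (2 * V + 1)) + 4 * C * V with hA1
  set A2 : ℝ := 4 * (2 * (4 * (18 + 16 + 64 * (C * 2)) + 6 * (C * 2)) + 2 * (C * 2)) + 4 * C
    with hA2
  have hA1p : 0 < A1 := by positivity
  have hA2p : 0 < A2 := by positivity
  have hβ : 0 < κ * (1 - b ^ 2) := by
    have : b ^ 2 < 1 := by nlinarith
    exact mul_pos hκ (by linarith)
  set δ := κ * (1 - b ^ 2) / (2 * A1) with hδdef
  have hδ : 0 < δ := by positivity
  refine ⟨min 1 (δ * (κ * (1 - b ^ 2)) / (2 * A2)), by positivity, fun u hu huc z hz => ?_⟩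
  by_contra! hlt
  rw [lt_min_iff] at hlt
  obtain ⟨hl1, hl2⟩ := hlt
  have hE := energyBall_nonneg u z 2
  have hF := residBall_nonneg u z 2
  have hm := main u hu huc z hz δ hδ
  set e := energyBall u z 2
  set f := residBall u z 2
  have h1 : δ * (4 * (4 * e + 2 * C * (2 * V + e)) + 4 * C * V) ≤ δ * A1 := by
    rw [hA1]
    have : e ≤ 1 := by linarith
    gcongr
    linarith
  have h2 : 4 * (2 * (4 * (18 * f + 16 * e + 64 * (C * (2 * e))) + 6 * (C * (2 * e))) +
          2 * (C * (2 * e))) + 4 * (C * e) ≤ A2 * (e + f) := by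
    have hCf : 0 ≤ C * f := by positivity
    rw [hA2]
    linarith
  have h3 : 1 / δ * (A2 * (e + f)) < κ * (1 - b ^ 2) / 2 := by
    rw [lt_div_iff₀ (by positivity)] at hl2
    rw [one_div, inv_mul_lt_iff₀ hδ]
    linarith
  have h4 : δ * A1 = κ * (1 - b ^ 2) / 2 := by rw [hδdef]; field_simp
  have h5 := mul_le_mul_of_nonneg_left h2 (show 0 ≤ 1 / δ by positivity)
  linarith

/-- Density bounds of both kinds at the dyadic scales `2 ^ i * s`. -/
lemma exists_density_bounds : ∃ s ≥ 1, ∃ C > 0, (∀ u : E 3 → ℝ, ContDiff ℝ 2 u →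
    HasCompactSupport u → ∀ (z : E 3) (N : ℕ),
    (∀ i ≤ N + 2, energyBall u z (2 ^ i * s) / (2 ^ i * s) ^ 2 ≤
      C * (residBall u z (2 ^ (N + 2) * s) +
        energyBall u z (2 ^ (N + 2) * s) / (2 ^ (N + 2) * s) ^ 2)) ∧
    ∫ x in ball z (2 ^ N * s), wt s z x * max (-disc u x) 0 ≤
      C * (residBall u z (2 ^ (N + 2) * s) +
        energyBall u z (2 ^ (N + 2) * s) / (2 ^ (N + 2) * s) ^ 2)) ∧
    ∀ b, 0 ≤ b → b < 1 → ∃ δ > 0, ∃ c > 0, ∀ u : E 3 → ℝ, ContDiff ℝ 2 u →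
      HasCompactSupport u → ∀ (z : E 3) (N : ℕ), |u z| ≤ b →
      residBall u z (2 ^ (N + 2) * s) ≤ δ →
        c ≤ energyBall u z (2 ^ (N + 2) * s) / (2 ^ (N + 2) * s) ^ 2 := by
  obtain ⟨s, hs, C, hC, H⟩ := exists_density_bound
  refine ⟨s, hs, C, hC, H, fun b hb0 hb => ?_⟩
  obtain ⟨c, hc, hlow⟩ := exists_energy_lower_bound hb0 hb
  have hs0 : 0 < s := by linarith
  refine ⟨c / (2 * (4 * s ^ 2 * C + 1)), by positivity, c / (8 * s ^ 2 * C), by positivity,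
    fun u hu huc z N hz hF => ?_⟩
  have h1 := (H u hu huc z N).1 1 (by omega)
  have h2 := hlow u hu huc z hz
  have h3 : energyBall u z 2 ≤ energyBall u z (2 ^ 1 * s) :=
    energyBall_mono hu (ball_subset_ball (by linarith))
  have h4 : residBall u z 2 ≤ residBall u z (2 ^ (N + 2) * s) := by
    refine residBall_mono hu (ball_subset_ball ?_)
    have : (2 : ℝ) ^ 2 ≤ 2 ^ (N + 2) := pow_le_pow_right₀ one_le_two (by omega)
    nlinarith
  rw [div_le_iff₀ (by positivity)] at h1
  rw [le_div_iff₀ (by positivity)] at hF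
  rw [div_le_iff₀ (by positivity)]
  generalize energyBall u z (2 ^ (N + 2) * s) / (2 ^ (N + 2) * s) ^ 2 = X at h1 ⊢
  generalize residBall u z (2 ^ (N + 2) * s) = F at h1 h4 hF
  have h5 : C * (F + X) * (2 ^ 1 * s) ^ 2 = 4 * s ^ 2 * C * F + X * (4 * s ^ 2 * C) := by ring
  linarith

lemma wt_comm (s : ℝ) (x y : E 3) : wt s x y = wt s y x := by
  rw [wt_eq, wt_eq, norm_sub_rev]

lemma setIntegral_ball_swap {e p : E 3 → ℝ} (he : Continuous e) (hp : Continuous p) {s : ℝ}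
    (hs : 0 < s) (z : E 3) (r : ℝ) :
    IntegrableOn (fun x => ∫ y in ball z r, e x * (wt s x y * p y)) (ball z r) ∧
    IntegrableOn (fun y => ∫ x in ball z r, e x * (wt s x y * p y)) (ball z r) ∧
    ∫ x in ball z r, ∫ y in ball z r, e x * (wt s x y * p y) =
      ∫ y in ball z r, ∫ x in ball z r, e x * (wt s x y * p y) := by
  have hw : Continuous fun q : E 3 × E 3 => wt s q.1 q.2 := by
    unfold wt
    exact continuous_const.div (by fun_prop) fun q => (wt_den_pos hs q.2).ne'
  have hc : Continuous (Function.uncurry fun x y => e x * (wt s x y * p y)) := by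
    unfold Function.uncurry
    fun_prop
  have hi : Integrable (Function.uncurry fun x y => e x * (wt s x y * p y))
      ((volume.restrict (ball z r)).prod (volume.restrict (ball z r))) := by
    rw [Measure.prod_restrict]
    have := hc.continuousOn.integrableOn_compact (μ := (volume : Measure (E 3)).prod volume)
      ((isCompact_closedBall z r).prod (isCompact_closedBall z r))
    exact this.mono_set (prod_mono ball_subset_closedBall ball_subset_closedBall)
  exact ⟨hi.integral_prod_left, hi.integral_prod_right, integral_integral_swap hi⟩

/-- The negative part of the discrepancy in the transition region is logarithmically small. -/
lemma exists_disc_neg_bound : ∃ s ≥ 1, ∀ b, 0 ≤ b → b < 1 → ∃ δ > 0, ∀ A ≥ 0, ∃ K > 0,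
    ∀ u : E 3 → ℝ, ContDiff ℝ 2 u → HasCompactSupport u → ∀ (z : E 3) (n : ℕ),
    energyBall u z (2 ^ (n + 6) * s) ≤ A * (2 ^ n * s) ^ 2 →
    residBall u z (2 ^ (n + 6) * s) ≤ δ →
    n * ∫ x in ball z (2 ^ (n + 1) * s),
      {x | |u x| ≤ b}.indicator (fun x => max (-disc u x) 0) x ≤ K * (2 ^ n * s) ^ 2 := by
  obtain ⟨s, hs, C, hC, H, Hb⟩ := exists_density_bounds
  have hs0 : 0 < s := by linarith
  refine ⟨s, hs, fun b hb0 hb => ?_⟩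
  obtain ⟨δ, hδ, c, hc, hlow⟩ := Hb b hb0 hb
  refine ⟨δ, hδ, fun A hA => ⟨8 / 3 * (C * (δ + A) * A) / c + 1, by positivity,
    fun u hu huc z n hE hF => ?_⟩⟩
  have hu1 : ContDiff ℝ 1 u := hu.of_le (by norm_num)
  have ce := continuous_edens hu1
  have cp : Continuous fun x => max (-disc u x) 0 := (continuous_disc hu1).neg.max continuous_const
  have hp0 : ∀ x, 0 ≤ max (-disc u x) 0 := fun x => le_max_right _ _
  have pw : ∀ k : ℕ, (2 : ℝ) ^ (n + k) * s = 2 ^ k * (2 ^ n * s) := fun k => by ring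
  set R := (2 : ℝ) ^ n * s with hR
  have hR0 : 0 < R := by positivity
  obtain ⟨I1, I2, hswap⟩ := setIntegral_ball_swap ce cp hs0 z (2 ^ (n + 2) * s)
  have upper : ∫ x in ball z (2 ^ (n + 2) * s), ∫ y in ball z (2 ^ (n + 2) * s),
      edens u x * (wt s x y * max (-disc u y) 0) ≤ C * (δ + A) * A * R ^ 2 := by
    have hx : ∀ x ∈ ball z (2 ^ (n + 2) * s), ∫ y in ball z (2 ^ (n + 2) * s),
        edens u x * (wt s x y * max (-disc u y) 0) ≤ C * (δ + A) * edens u x := by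
      intro x hx
      have hsub1 : ball z (2 ^ (n + 2) * s) ⊆ ball x (2 ^ (n + 3) * s) := by
        refine ball_subset_ball' ?_
        rw [mem_ball, dist_comm] at hx
        rw [pw] at hx ⊢
        rw [pw]
        linarith
      have hsub2 : ball x (2 ^ (n + 3 + 2) * s) ⊆ ball z (2 ^ (n + 6) * s) := by
        refine ball_subset_ball' ?_
        rw [mem_ball] at hx
        rw [show n + 3 + 2 = n + 5 from rfl, pw, pw]
        rw [pw] at hx
        linarith
      have h1 := (H u hu huc x (n + 3)).2
      have cw := (contDiff_wt (z := x) hs0).continuous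
      have h2 : ∫ y in ball z (2 ^ (n + 2) * s), wt s x y * max (-disc u y) 0 ≤
          ∫ y in ball x (2 ^ (n + 3) * s), wt s x y * max (-disc u y) 0 :=
        setIntegral_ball_mono (cw.mul cp) (fun y => mul_nonneg (wt_pos hs0 y).le (hp0 y)) hsub1
      have h3 : residBall u x (2 ^ (n + 3 + 2) * s) ≤ δ := (residBall_mono hu hsub2).trans hF
      have h4 : energyBall u x (2 ^ (n + 3 + 2) * s) / (2 ^ (n + 3 + 2) * s) ^ 2 ≤ A := by
        have hle : R ≤ 2 ^ (n + 3 + 2) * s := by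
          rw [show n + 3 + 2 = n + 5 from rfl, pw]
          linarith
        rw [div_le_iff₀ (by positivity)]
        exact ((energyBall_mono hu hsub2).trans hE).trans
          (mul_le_mul_of_nonneg_left (pow_le_pow_left₀ hR0.le hle 2) hA)
      rw [integral_const_mul, mul_comm]
      refine mul_le_mul_of_nonneg_right ?_ (edens_nonneg u x)
      exact h2.trans (h1.trans (mul_le_mul_of_nonneg_left (add_le_add h3 h4) hC.le))
    refine (setIntegral_mono_on I1 ((integrableOn_ball ce _ _).const_mul _) measurableSet_ball
      hx).trans ?_
    rw [integral_const_mul, mul_assoc (C * (δ + A))]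
    refine mul_le_mul_of_nonneg_left ?_ (by positivity)
    refine le_trans (energyBall_mono hu (ball_subset_ball ?_)) hE
    rw [pw, pw]; linarith
  have J0 : ∀ y, 0 ≤ ∫ x in ball z (2 ^ (n + 2) * s),
      edens u x * (wt s x y * max (-disc u y) 0) := fun y =>
    integral_nonneg fun x => mul_nonneg (edens_nonneg u x) (mul_nonneg (wt_pos hs0 _).le (hp0 y))
  have hS : MeasurableSet {x | |u x| ≤ b} :=
    (isClosed_le (hu.continuous.abs) continuous_const).measurableSet
  have hsub : ball z (2 ^ (n + 1) * s) ⊆ ball z (2 ^ (n + 2) * s) :=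
    ball_subset_ball (by rw [pw, pw]; linarith)
  have lower : 3 / 8 * (n * c) * ∫ y in ball z (2 ^ (n + 1) * s),
      {x | |u x| ≤ b}.indicator (fun x => max (-disc u x) 0) y ≤
      ∫ y in ball z (2 ^ (n + 2) * s), ∫ x in ball z (2 ^ (n + 2) * s),
        edens u x * (wt s x y * max (-disc u y) 0) := by
    refine le_trans ?_ (setIntegral_mono_set I2 (Eventually.of_forall J0) hsub.eventuallyLE)
    rw [← integral_const_mul]
    refine setIntegral_mono_on (((integrableOn_ball cp _ _).indicator hS).const_mul _)
      (I2.mono_set hsub) measurableSet_ball fun y hy => ?_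
    by_cases hyb : |u y| ≤ b
    · rw [indicator_of_mem (show y ∈ {x | |u x| ≤ b} from hyb)]
      have cw := (contDiff_wt (z := y) hs0).continuous
      have hsub3 : ball y (2 ^ (n + 1) * s) ⊆ ball z (2 ^ (n + 2) * s) := by
        refine ball_subset_ball' ?_
        rw [mem_ball] at hy
        rw [pw] at hy ⊢
        rw [pw]
        linarith
      have h1 := sum_le_setIntegral_wt ce (edens_nonneg u) hs0 y (n + 1)
      have h2 : ∫ x in ball y (2 ^ (n + 1) * s), wt s y x * edens u x ≤
          ∫ x in ball z (2 ^ (n + 2) * s), wt s y x * edens u x :=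
        setIntegral_ball_mono (cw.mul ce) (fun x => mul_nonneg (wt_pos hs0 x).le
          (edens_nonneg u x)) hsub3
      have h3 : (n : ℝ) * c ≤ ∑ j ∈ Finset.range (n + 1 + 1),
          1 / (2 ^ j * s) ^ 2 * ∫ x in ball y (2 ^ j * s), edens u x := by
        have h4 : ∑ j ∈ Finset.Ico 2 (n + 2),
            1 / (2 ^ j * s) ^ 2 * ∫ x in ball y (2 ^ j * s), edens u x ≤
            ∑ j ∈ Finset.range (n + 1 + 1),
              1 / (2 ^ j * s) ^ 2 * ∫ x in ball y (2 ^ j * s), edens u x := by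
          refine Finset.sum_le_sum_of_subset_of_nonneg (fun j hj => ?_) fun j _ _ =>
            mul_nonneg (by positivity) (energyBall_nonneg u y _)
          simp only [Finset.mem_Ico, Finset.mem_range] at hj ⊢
          omega
        refine le_trans ?_ h4
        have h5 := Finset.card_nsmul_le_sum (Finset.Ico 2 (n + 2))
          (fun j => 1 / (2 ^ j * s) ^ 2 * ∫ x in ball y (2 ^ j * s), edens u x) c fun j hj => by
            rw [Finset.mem_Ico] at hj
            obtain ⟨k, rfl⟩ := Nat.exists_eq_add_of_le' hj.1
            have hsub4 : ball y (2 ^ (k + 2) * s) ⊆ ball y (2 ^ (n + 1) * s) :=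
              ball_subset_ball (mul_le_mul_of_nonneg_right
                (pow_le_pow_right₀ one_le_two (by omega)) hs0.le)
            have hsub5 : ball z (2 ^ (n + 2) * s) ⊆ ball z (2 ^ (n + 6) * s) :=
              ball_subset_ball (by rw [pw, pw]; linarith)
            rw [one_div, inv_mul_eq_div]
            exact hlow u hu huc y k hyb
              ((residBall_mono hu ((hsub4.trans hsub3).trans hsub5)).trans hF)
        simpa using h5
      have h7 : ∫ x in ball z (2 ^ (n + 2) * s), edens u x * (wt s x y * max (-disc u y) 0) =
          (∫ x in ball z (2 ^ (n + 2) * s), wt s y x * edens u x) * max (-disc u y) 0 := by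
        rw [← integral_mul_const]
        congr 1; ext x
        rw [wt_comm]; ring
      rw [h7]
      refine mul_le_mul_of_nonneg_right ?_ (hp0 y)
      have h8 : 0 ≤ 1 / 3 * (1 / (2 ^ (n + 1) * s) ^ 2 *
          ∫ x in ball y (2 ^ (n + 1) * s), edens u x) :=
        mul_nonneg (by norm_num) (mul_nonneg (by positivity) (energyBall_nonneg u y _))
      linarith
    · rw [indicator_of_notMem (show y ∉ {x | |u x| ≤ b} from hyb), mul_zero]
      exact J0 y
  rw [← hswap] at lower
  have h9 := lower.trans upper
  rw [add_mul, div_mul_eq_mul_div]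
  have h10 : c * (n * ∫ x in ball z (2 ^ (n + 1) * s),
      {x | |u x| ≤ b}.indicator (fun x => max (-disc u x) 0) x) ≤
      8 / 3 * (C * (δ + A) * A) * R ^ 2 := by linarith
  have h11 := (le_div_iff₀' hc).2 h10
  have : 0 < R ^ 2 := by positivity
  linarith

lemma hasDerivAt_max_sq (t : ℝ) : HasDerivAt (fun t : ℝ => max t 0 ^ 2) (2 * max t 0) t := by
  have h : ∀ t : ℝ, max t 0 ^ 2 = smoothPos 1 t * (1 + t) + (smoothPos 1 t - smoothPos 1 t) := by
    intro t
    rcases le_total t 0 with h | h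
    · simp [smoothPos, h]
    · have : t + 1 ≠ 0 := by positivity
      simp only [smoothPos, max_eq_left h]
      field_simp
      ring
  have h1 := (hasDerivAt_smoothPos one_pos t).fun_mul ((hasDerivAt_id t).const_add 1)
  simp only [h, sub_self, add_zero]
  refine h1.congr_deriv ?_
  rcases le_total t 0 with h | h
  · simp [smoothPos, smoothPos', h]
  · have : t + 1 ≠ 0 := by positivity
    simp only [smoothPos, smoothPos', max_eq_left h, id]
    field_simp
    ring

/-- The test nonlinearity for functions taking values in `(s₀, ∞)`. -/
lemma exists_test {s₀ : ℝ} (h0 : -1 < s₀) : ∃ G G' : ℝ → ℝ,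
    (∀ t, HasDerivAt G (G' t) t) ∧ Continuous G' ∧
    (∀ t, s₀ < t → t < 1 → G t = -(1 - t) / (1 + t) ∧ G' t = 2 / (1 + t) ^ 2) ∧
    ∀ t, 1 ≤ t → G t = (t - 1) / 2 ∧ G' t = 1 / 2 := by
  set τ := (1 + s₀) / 2 with hτ
  have hτ0 : 0 < τ := by rw [hτ]; linarith
  have hD : ∀ t, 0 < 1 + t + smoothPos τ (s₀ - t) := fun t => by
    have h2 := sub_le_smoothPos hτ0 (s₀ - t)
    have h3 := le_max_left (s₀ - t) 0
    linarith
  have dm : ∀ t : ℝ, HasDerivAt (fun t : ℝ => max (1 - t) 0 ^ 2) (-(2 * max (1 - t) 0)) t := by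
    intro t
    exact ((hasDerivAt_max_sq (1 - t)).comp t ((hasDerivAt_id t).const_sub 1)).congr_deriv (by ring)
  have dD : ∀ t : ℝ, HasDerivAt (fun t : ℝ => 2 * (1 + t + smoothPos τ (s₀ - t)))
      (2 * (1 - smoothPos' τ (s₀ - t))) t := by
    intro t
    have h2 := (hasDerivAt_smoothPos hτ0 (s₀ - t)).comp t ((hasDerivAt_id t).const_sub s₀)
    have h3 := (((hasDerivAt_id t).const_add 1).add h2).const_mul 2
    refine (h3.congr_deriv ?_)
    ring
  have dl : ∀ t : ℝ, HasDerivAt (fun t : ℝ => (t - 1) / 2) (1 / 2) t := fun t =>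
    ((hasDerivAt_id t).sub_const 1).div_const 2
  refine ⟨fun t => (t - 1) / 2 - max (1 - t) 0 ^ 2 / (2 * (1 + t + smoothPos τ (s₀ - t))),
    fun t => 1 / 2 - (-(2 * max (1 - t) 0) * (2 * (1 + t + smoothPos τ (s₀ - t))) -
      max (1 - t) 0 ^ 2 * (2 * (1 - smoothPos' τ (s₀ - t)))) /
        (2 * (1 + t + smoothPos τ (s₀ - t))) ^ 2, fun t => ?_, ?_, fun t ht ht' => ?_,
    fun t ht => ?_⟩
  · exact (dl t).fun_sub ((dm t).fun_div (dD t) (mul_pos two_pos (hD t)).ne')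
  · have c1 := continuous_smoothPos hτ0
    have c2 := continuous_smoothPos' hτ0
    exact continuous_const.sub (Continuous.div (by fun_prop) (by fun_prop) fun t =>
      pow_ne_zero 2 (mul_pos two_pos (hD t)).ne')
  · have h2 : 1 + t ≠ 0 := by linarith
    have h3 : smoothPos' τ (s₀ - t) = 0 := by
      simp [smoothPos', max_eq_right (show s₀ - t ≤ 0 by linarith)]
    simp only [smoothPos_of_nonpos (show s₀ - t ≤ 0 by linarith), h3,
      max_eq_left (show 0 ≤ 1 - t by linarith), add_zero]
    constructor <;> field_simp <;> ring
  · simp [max_eq_right (show 1 - t ≤ 0 by linarith)]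

/-- Pointwise coercivity of the test nonlinearity. -/
lemma test_lower_bound {s₀ t q G G' : ℝ} (h0 : -1 < s₀) (hq : 0 ≤ q) (ht : s₀ < t)
    (hlt : t < 1 → G = -(1 - t) / (1 + t) ∧ G' = 2 / (1 + t) ^ 2)
    (hge : 1 ≤ t → G = (t - 1) / 2 ∧ G' = 1 / 2) :
    (q / 2 + W t) / 2 - 4 / (1 + s₀) ^ 2 *
      (if |t| ≤ max |s₀| (1 / 2) then max (-(q / 2 - W t)) 0 else 0) ≤ G' * q + G * W' t ∧
    G ^ 2 ≤ (4 / (1 + s₀) ^ 4 + 1) * W t := by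
  have hs : 0 < 1 + s₀ := by linarith
  have h1t : 0 < 1 + t := by linarith
  have hW := W_nonneg t
  have hC4 : 0 ≤ 4 / (1 + s₀) ^ 4 := by positivity
  rcases lt_or_ge t 1 with h1 | h1
  · obtain ⟨rfl, rfl⟩ := hlt h1
    have hWt : (1 - t) ^ 2 = 4 * W t / (1 + t) ^ 2 := by
      rw [W, eq_div_iff (by positivity)]; ring
    constructor
    · have e1 : 2 / (1 + t) ^ 2 * q + -(1 - t) / (1 + t) * W' t =
          4 * (W t * t) / (1 + t) ^ 2 + 2 * q / (1 + t) ^ 2 := by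
        have : -(1 - t) / (1 + t) * W' t = t * (1 - t) ^ 2 := by
          rw [W']; field_simp; ring
        rw [this, hWt]; ring
      rw [e1]
      split_ifs with hb
      · have e2 : 4 * (W t * t) / (1 + t) ^ 2 + 2 * q / (1 + t) ^ 2 =
            4 * W t / (1 + t) + 4 / (1 + t) ^ 2 * (q / 2 - W t) := by
          field_simp; ring
        have e3 : 2 * W t ≤ 4 * W t / (1 + t) := by
          rw [le_div_iff₀ h1t]
          nlinarith
        have e4 : 1 ≤ 4 / (1 + t) ^ 2 := by
          rw [le_div_iff₀ (by positivity)]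
          nlinarith
        have e5 : 4 / (1 + t) ^ 2 ≤ 4 / (1 + s₀) ^ 2 := by
          gcongr
        rw [e2]
        generalize 4 / (1 + t) ^ 2 = c at *
        generalize 4 / (1 + s₀) ^ 2 = c' at *
        rcases le_total (q / 2 - W t) 0 with hP | hP
        · rw [max_eq_left (by linarith)]
          nlinarith
        · rw [max_eq_right (by linarith)]
          nlinarith
      · have hb' : 1 / 2 ≤ t := by
          push Not at hb
          have hm1 := le_max_left |s₀| (1 / 2)
          have hm2 := le_max_right |s₀| (1 / 2)
          rcases lt_abs.1 hb with h | h
          · linarith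
          · have := neg_abs_le s₀
            linarith
        have e3 : W t / 2 ≤ 4 * (W t * t) / (1 + t) ^ 2 := by
          rw [le_div_iff₀ (by positivity)]
          have : (1 + t) ^ 2 ≤ 8 * t := by nlinarith
          nlinarith
        have e4 : q / 2 ≤ 2 * q / (1 + t) ^ 2 := by
          rw [le_div_iff₀ (by positivity)]
          have : (1 + t) ^ 2 ≤ 4 := by nlinarith
          nlinarith
        linarith
    · have e1 : (-(1 - t) / (1 + t)) ^ 2 = 4 / (1 + t) ^ 4 * W t := by
        rw [div_pow, neg_sq, hWt]; field_simp
      rw [e1]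
      have e5 : 4 / (1 + t) ^ 4 ≤ 4 / (1 + s₀) ^ 4 := by
        gcongr
      nlinarith
  · obtain ⟨rfl, rfl⟩ := hge h1
    have hWt : W t = (t - 1) ^ 2 * (t + 1) ^ 2 / 4 := by rw [W]; ring
    constructor
    · have e1 : 0 ≤ 4 / (1 + s₀) ^ 2 *
          (if |t| ≤ max |s₀| (1 / 2) then max (-(q / 2 - W t)) 0 else 0) := by
        refine mul_nonneg (by positivity) ?_
        split_ifs
        · exact le_max_right _ _
        · exact le_rfl
      have e2 : W t ≤ (t - 1) / 2 * W' t := by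
        have : (t - 1) / 2 * W' t - W t = (t - 1) ^ 3 * (t + 1) / 4 := by
          rw [hWt, W']; ring
        have h2 : 0 ≤ (t - 1) ^ 3 * (t + 1) / 4 := by
          have : 0 ≤ t - 1 := by linarith
          positivity
        linarith
      linarith
    · have e1 : ((t - 1) / 2) ^ 2 ≤ W t := by
        rw [hWt]
        have : 1 ≤ (t + 1) ^ 2 := by nlinarith
        nlinarith [sq_nonneg (t - 1)]
      nlinarith

/-- The energy is controlled by the negative discrepancy where `u` omits values below `s₀`. -/
lemma energyBall_le_of_gt {u η : E 3 → ℝ} {C ρ s₀ : ℝ} {z : E 3} (hu : ContDiff ℝ 2 u)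
    (hη : IsCutoff C ρ z η) (h0 : -1 < s₀)
    (hgt : ∀ x ∈ ball z (2 * ρ), s₀ < u x) :
    energyBall u z ρ / 4 ≤ 4 / (1 + s₀) ^ 2 * (∫ x in ball z (2 * ρ),
        {x | |u x| ≤ max |s₀| (1 / 2)}.indicator (fun x => max (-disc u x) 0) x) +
      2 * (4 / (1 + s₀) ^ 4 + 1) * residBall u z (2 * ρ) +
      16 * (4 / (1 + s₀) ^ 4 + 1) * (C / ρ ^ 2 * energyBall u z (2 * ρ)) := by
  have hu1 : ContDiff ℝ 1 u := hu.of_le (by norm_num)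
  have hη1 : ContDiff ℝ 1 η := hη.contDiff.of_le (by norm_num)
  obtain ⟨G, G', hG, hG', hlt, hge⟩ := exists_test h0
  set b := max |s₀| (1 / 2) with hb
  set M := 4 / (1 + s₀) ^ 4 + 1 with hM
  set D := 4 / (1 + s₀) ^ 2 with hD
  have hs : 0 < 1 + s₀ := by linarith
  have hM0 : 0 < M := by positivity
  have hD0 : 0 ≤ D := by positivity
  have ce := continuous_edens hu1
  have cp : Continuous fun x => max (-disc u x) 0 := (continuous_disc hu1).neg.max continuous_const
  have hS : MeasurableSet {x | |u x| ≤ b} :=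
    (isClosed_le (hu.continuous.abs) continuous_const).measurableSet
  have i0 : Integrable fun x => edens u x * η x ^ 2 := integrable_mul_sq hη1 hη.compact ce
  have i1 : Integrable fun x => {x | |u x| ≤ b}.indicator
      (fun x => max (-disc u x) 0 * η x ^ 2) x :=
    (integrable_mul_sq hη1 hη.compact cp).indicator hS
  have i2 : Integrable fun x => resid u x ^ 2 * η x ^ 2 :=
    integrable_mul_sq hη1 hη.compact ((continuous_resid hu).pow 2)
  have i3 : Integrable fun x => edens u x * gsq η x := integrable_mul_gsq hη1 hη.compact ce
  have j12 : Integrable fun x => D * {x | |u x| ≤ b}.indicator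
      (fun x => max (-disc u x) 0 * η x ^ 2) x + 2 * M * (resid u x ^ 2 * η x ^ 2) :=
    (i1.const_mul D).add (i2.const_mul (2 * M))
  have key := integral_le_of_test hu (hη1.pow 2) (hasCompactSupport_sq hη.compact) hG hG'
    (i0.const_mul (1 / 4)) (j12.add (i3.const_mul (16 * M))) fun x => by
      simp only [Pi.add_apply]
      rw [gdot_sq_right hη1]
      have hi : {x | |u x| ≤ b}.indicator (fun x => max (-disc u x) 0 * η x ^ 2) x =
          (if |u x| ≤ b then max (-(gsq u x / 2 - W (u x))) 0 else 0) * η x ^ 2 := by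
        by_cases hx : |u x| ≤ b
        · rw [indicator_of_mem (show x ∈ {x | |u x| ≤ b} from hx), if_pos hx]; rfl
        · rw [indicator_of_notMem (show x ∉ {x | |u x| ≤ b} from hx), if_neg hx, zero_mul]
      rw [hi]
      have hcs := gdot_sq_le u η x
      have hq := gsq_nonneg u x
      have hg := gsq_nonneg η x
      have hW := W_nonneg (u x)
      have he : edens u x = gsq u x / 2 + W (u x) := rfl
      rw [he]
      by_cases hx : x ∈ ball z (2 * ρ)
      · obtain ⟨k1, k2⟩ := test_lower_bound h0 hq (hgt x hx) (hlt _ (hgt x hx)) (hge _)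
        rw [← hD, ← hb] at k1
        rw [← hM] at k2
        generalize (if |u x| ≤ b then max (-(gsq u x / 2 - W (u x))) 0 else 0) = p at *
        generalize G (u x) = g at *
        generalize G' (u x) = g' at *
        generalize gsq u x = q at *
        generalize gsq η x = h at *
        generalize gdot u η x = d at *
        generalize resid u x = f at *
        generalize η x = e at *
        generalize W (u x) = w at *
        generalize W' (u x) = w' at *
        have k3 : -(w / 8) - 2 * M * f ^ 2 ≤ g * f := by
          have h2 : 0 ≤ (g + 4 * M * f) ^ 2 := sq_nonneg _
          have h3 : 0 ≤ M * (w / 8 + 2 * M * f ^ 2 + g * f) := by nlinarith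
          have := nonneg_of_mul_nonneg_right h3 hM0
          linarith
        have k4 : -(w / 8 * e ^ 2) - 8 * M * (q * h) ≤ g * (2 * e * d) := by
          have h2 : 0 ≤ (g * e + 8 * M * d) ^ 2 := sq_nonneg _
          have h4 : g ^ 2 * e ^ 2 ≤ M * w * e ^ 2 := mul_le_mul_of_nonneg_right k2 (sq_nonneg e)
          have h5 : M ^ 2 * d ^ 2 ≤ M ^ 2 * (q * h) := mul_le_mul_of_nonneg_left hcs (sq_nonneg M)
          have h3 : 0 ≤ M * (w / 8 * e ^ 2 + 8 * M * (q * h) + g * (2 * e * d)) := by nlinarith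
          have := nonneg_of_mul_nonneg_right h3 hM0
          linarith
        have k5 := mul_le_mul_of_nonneg_right k1 (sq_nonneg e)
        have k6 := mul_le_mul_of_nonneg_right k3 (sq_nonneg e)
        have k7 : 0 ≤ M * (w * h) := by positivity
        have k8 : 0 ≤ q * e ^ 2 := by positivity
        linarith
      · rw [hη.eq_zero x hx]
        have : 0 ≤ M * ((gsq u x / 2 + W (u x)) * gsq η x) := by positivity
        linarith
  simp only [Pi.add_apply] at key
  rw [integral_add j12 (i3.const_mul _), integral_add (i1.const_mul D) (i2.const_mul _)] at key
  simp only [integral_const_mul] at key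
  have l0 : energyBall u z ρ ≤ ∫ x, edens u x * η x ^ 2 := by
    rw [energyBall, ← integral_indicator measurableSet_ball]
    refine integral_mono ((integrableOn_ball ce z ρ).integrable_indicator measurableSet_ball) i0
      fun x => ?_
    simp only
    by_cases hx : x ∈ ball z ρ
    · rw [indicator_of_mem hx, hη.eq_one x (ball_subset_closedBall hx)]; simp
    · rw [indicator_of_notMem hx]
      exact mul_nonneg (edens_nonneg u x) (sq_nonneg _)
  have l1 : ∫ x, {x | |u x| ≤ b}.indicator (fun x => max (-disc u x) 0 * η x ^ 2) x ≤
      ∫ x in ball z (2 * ρ), {x | |u x| ≤ b}.indicator (fun x => max (-disc u x) 0) x := by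
    rw [← integral_indicator measurableSet_ball]
    refine integral_mono i1 (((integrableOn_ball cp z _).indicator hS).integrable_indicator
      measurableSet_ball) fun x => ?_
    simp only
    have hp : 0 ≤ max (-disc u x) 0 := le_max_right _ _
    by_cases hx : x ∈ ball z (2 * ρ)
    · rw [indicator_of_mem hx]
      refine indicator_le_indicator ?_
      exact mul_le_of_le_one_right hp (pow_le_one₀ (hη.nonneg x) (hη.le_one x))
    · rw [indicator_of_notMem hx, indicator_apply]
      simp [hη.eq_zero x hx]
  have l2 : ∫ x, resid u x ^ 2 * η x ^ 2 ≤ residBall u z (2 * ρ) :=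
    hη.integral_mul_sq_le ((continuous_resid hu).pow 2) fun _ => sq_nonneg _
  have l3 : ∫ x, edens u x * gsq η x ≤ C / ρ ^ 2 * energyBall u z (2 * ρ) :=
    hη.integral_mul_gsq_le ce (edens_nonneg u)
  have m1 := mul_le_mul_of_nonneg_left l1 hD0
  have m2 := mul_le_mul_of_nonneg_left l2 (by positivity : 0 ≤ 2 * M)
  have m3 := mul_le_mul_of_nonneg_left l3 (by positivity : 0 ≤ 16 * M)
  linarith

lemma pd_neg_fun (i : Fin 3) (g : E 3 → ℝ) (x : E 3) : pd i (fun y => -g y) x = -pd i g x := by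
  simp [pd]

lemma edens_neg (u : E 3 → ℝ) : edens (fun x => -u x) = edens u := by
  ext x
  simp [edens, gsq, pd_neg_fun, W]

lemma resid_neg_sq {u : E 3 → ℝ} (hu : ContDiff ℝ 2 u) (x : E 3) :
    resid (fun x => -u x) x ^ 2 = resid u x ^ 2 := by
  have h : ∀ i, pd i (fun x => -u x) = fun x => -pd i u x := fun i =>
    funext fun x => pd_neg_fun i u x
  have hl : resid (fun x => -u x) x = -resid u x := by
    simp only [resid, lap_eq_sum_pd hu, lap_eq_sum_pd hu.neg, h, pd_neg_fun, W',
      Finset.sum_neg_distrib]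
    ring
  rw [hl, neg_sq]

/-- If `u` omits a value in `(-1, 1)`, its energy density is logarithmically small. -/
lemma exists_energy_decay : ∃ s ≥ 1, ∀ s₀, -1 < s₀ → s₀ < 1 → ∃ δ > 0, ∀ A ≥ 0, ∃ K > 0,
    ∀ u : E 3 → ℝ, ContDiff ℝ 2 u → HasCompactSupport u → ∀ (z : E 3) (n : ℕ),
    energyBall u z (2 ^ (n + 6) * s) ≤ A * (2 ^ n * s) ^ 2 →
    residBall u z (2 ^ (n + 6) * s) ≤ δ →
    (∀ x ∈ ball z (2 ^ (n + 1) * s), u x ≠ s₀) →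
    n * energyBall u z (2 ^ n * s) ≤ K * (2 ^ n * s) ^ 2 := by
  obtain ⟨s, hs, H⟩ := exists_disc_neg_bound
  obtain ⟨C, hC, hcut⟩ := exists_isCutoff
  have hs0 : 0 < s := by linarith
  have main : ∀ s₀, -1 < s₀ → s₀ < 1 → ∃ δ > 0, ∀ A ≥ 0, ∃ K > 0,
      ∀ u : E 3 → ℝ, ContDiff ℝ 2 u → HasCompactSupport u → ∀ (z : E 3) (n : ℕ),
      energyBall u z (2 ^ (n + 6) * s) ≤ A * (2 ^ n * s) ^ 2 →
      residBall u z (2 ^ (n + 6) * s) ≤ δ →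
      (∀ x ∈ ball z (2 ^ (n + 1) * s), s₀ < u x) →
      n * energyBall u z (2 ^ n * s) ≤ K * (2 ^ n * s) ^ 2 := by
    intro s₀ h0 h1
    have hb1 : max |s₀| (1 / 2) < 1 := max_lt (abs_lt.2 ⟨h0, h1⟩) (by norm_num)
    have hb0 : 0 ≤ max |s₀| (1 / 2) := le_max_of_le_left (abs_nonneg _)
    obtain ⟨δ, hδ, HA⟩ := H _ hb0 hb1
    refine ⟨δ, hδ, fun A hA => ?_⟩
    obtain ⟨K, hK, HK⟩ := HA A hA
    have hpos : 0 < 1 + s₀ := by linarith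
    refine ⟨4 * (4 / (1 + s₀) ^ 2 * K + 2 * (4 / (1 + s₀) ^ 4 + 1) * δ +
      16 * (4 / (1 + s₀) ^ 4 + 1) * (C * A)), by positivity, fun u hu huc z n hE hF hgt => ?_⟩
    have hρ : (0 : ℝ) < 2 ^ n * s := by positivity
    have hpow : 2 * ((2 : ℝ) ^ n * s) = 2 ^ (n + 1) * s := by ring
    obtain ⟨η, hη⟩ := hcut _ hρ z
    have hk := HK u hu huc z n hE hF
    have hle := energyBall_le_of_gt hu hη h0 (by rwa [hpow])
    rw [hpow] at hle
    have hsub : ball z (2 ^ (n + 1) * s) ⊆ ball z (2 ^ (n + 6) * s) :=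
      ball_subset_ball (mul_le_mul_of_nonneg_right
        (pow_le_pow_right₀ one_le_two (by omega)) hs0.le)
    have hE' := (energyBall_mono hu hsub).trans hE
    have hF' := (residBall_mono hu hsub).trans hF
    have hn : (n : ℝ) ≤ (2 ^ n * s) ^ 2 := by
      have h2 : (n : ℝ) < 2 ^ n := by exact_mod_cast Nat.lt_two_pow_self
      have h3 : (1 : ℝ) ≤ 2 ^ n := one_le_pow₀ one_le_two
      have h4 : (2 : ℝ) ^ n ≤ 2 ^ n * s := le_mul_of_one_le_right (by positivity) hs
      nlinarith
    have hE2 : C / (2 ^ n * s) ^ 2 * energyBall u z (2 ^ (n + 1) * s) ≤ C * A := by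
      rw [div_mul_eq_mul_div, div_le_iff₀ (by positivity), mul_assoc]
      exact mul_le_mul_of_nonneg_left hE' hC.le
    have hM0 : 0 < 4 / (1 + s₀) ^ 4 + 1 := by positivity
    have hD0 : 0 ≤ 4 / (1 + s₀) ^ 2 := by positivity
    generalize 4 / (1 + s₀) ^ 4 + 1 = M at *
    generalize 4 / (1 + s₀) ^ 2 = D at *
    generalize C / (2 ^ n * s) ^ 2 * energyBall u z (2 ^ (n + 1) * s) = X at *
    generalize residBall u z (2 ^ (n + 1) * s) = F at *
    generalize (∫ x in ball z (2 ^ (n + 1) * s), {x | |u x| ≤ max |s₀| (1 / 2)}.indicator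
      (fun x => max (-disc u x) 0) x) = J at *
    generalize energyBall u z (2 ^ n * s) = Y at *
    generalize ((2 : ℝ) ^ n * s) ^ 2 = R at *
    have hn0 : (0 : ℝ) ≤ n := Nat.cast_nonneg n
    generalize (n : ℝ) = m at *
    have q1 : m * Y ≤ 4 * (D * (m * J)) + 4 * (m * (2 * M * δ + 16 * M * (C * A))) := by
      have r1 := mul_le_mul_of_nonneg_left hF' (by positivity : 0 ≤ 2 * M)
      have r2 := mul_le_mul_of_nonneg_left hE2 (by positivity : 0 ≤ 16 * M)
      have r3 : Y / 4 ≤ D * J + (2 * M * δ + 16 * M * (C * A)) := by linarith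
      have r4 := mul_le_mul_of_nonneg_left r3 hn0
      linarith
    have q2 := mul_le_mul_of_nonneg_left hk hD0
    have q3 : m * (2 * M * δ + 16 * M * (C * A)) ≤ R * (2 * M * δ + 16 * M * (C * A)) :=
      mul_le_mul_of_nonneg_right hn (by positivity)
    linarith
  refine ⟨s, hs, fun s₀ h0 h1 => ?_⟩
  obtain ⟨δ₁, hδ₁, H₁⟩ := main s₀ h0 h1
  obtain ⟨δ₂, hδ₂, H₂⟩ := main (-s₀) (by linarith) (by linarith)
  refine ⟨min δ₁ δ₂, lt_min hδ₁ hδ₂, fun A hA => ?_⟩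
  obtain ⟨K₁, hK₁, H₁⟩ := H₁ A hA
  obtain ⟨K₂, hK₂, H₂⟩ := H₂ A hA
  refine ⟨max K₁ K₂, lt_max_of_lt_left hK₁, fun u hu huc z n hE hF hne => ?_⟩
  have hconn : IsPreconnected (u '' ball z (2 ^ (n + 1) * s)) :=
    (convex_ball _ _).isPreconnected.image u hu.continuous.continuousOn
  have hρ : (0 : ℝ) < 2 ^ (n + 1) * s := by positivity
  have hz := mem_ball_self (x := z) hρ
  have hsq : (0 : ℝ) ≤ (2 ^ n * s) ^ 2 := by positivity
  have hno : s₀ ∉ u '' ball z (2 ^ (n + 1) * s) := fun ⟨x, hx, h⟩ => hne x hx h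
  rcases lt_or_gt_of_ne (hne z hz) with hlt | hgt
  · have hall : ∀ x ∈ ball z (2 ^ (n + 1) * s), -s₀ < -u x := fun x hx => by
      by_contra hcon
      exact hno (hconn.ordConnected.out (mem_image_of_mem u hz) (mem_image_of_mem u hx)
        ⟨hlt.le, by linarith⟩)
    have eN : ∀ ρ, energyBall (fun x => -u x) z ρ = energyBall u z ρ := fun ρ => by
      simp [energyBall, edens_neg]
    have rN : ∀ ρ, residBall (fun x => -u x) z ρ = residBall u z ρ := fun ρ => by
      simp [residBall, resid_neg_sq hu]
    have hcn : HasCompactSupport fun x => -u x := huc.neg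
    have := H₂ (fun x => -u x) hu.neg hcn z n (by rwa [eN])
      (by rw [rN]; exact hF.trans (min_le_right _ _)) hall
    rw [eN] at this
    exact this.trans (mul_le_mul_of_nonneg_right (le_max_right _ _) hsq)
  · have hall : ∀ x ∈ ball z (2 ^ (n + 1) * s), s₀ < u x := fun x hx => by
      by_contra hcon
      exact hno (hconn.ordConnected.out (mem_image_of_mem u hx) (mem_image_of_mem u hz)
        ⟨by linarith, hgt.le⟩)
    exact (H₁ u hu huc z n hE (hF.trans (min_le_left _ _)) hall).trans
      (mul_le_mul_of_nonneg_right (le_max_left _ _) hsq)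

lemma pd_comp_add_smul {w : E 3 → ℝ} (i : Fin 3) {c : ℝ} {x y : E 3}
    (hw : DifferentiableAt ℝ w (x + c • y)) :
    pd i (fun y => w (x + c • y)) y = c * pd i w (x + c • y) := by
  have h : HasFDerivAt (fun y : E 3 => x + c • y) (c • ContinuousLinearMap.id ℝ (E 3)) y :=
    ((hasFDerivAt_id y).const_smul c).const_add x
  have := (HasFDerivAt.comp y hw.hasFDerivAt h).fderiv
  simp only [Function.comp_def] at this
  simp [pd, this]

lemma contDiff_comp_add_smul {w : E 3 → ℝ} (hw : ContDiff ℝ 2 w) (c : ℝ) (x : E 3) :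
    ContDiff ℝ 2 fun y => w (x + c • y) :=
  hw.comp (by fun_prop)

lemma edens_comp_add_smul {w : E 3 → ℝ} (hw : ContDiff ℝ 2 w) {ε : ℝ} (hε : 0 < ε) (x y : E 3) :
    edens (fun y => w (x + ε • y)) y = ε * areaDensity ε w (x + ε • y) := by
  have hd := hw.differentiable (by norm_num)
  simp only [edens, areaDensity, gsq, norm_fderiv_sq, pd_comp_add_smul _ (hd _), Fin.sum_univ_three]
  field_simp

lemma resid_comp_add_smul {w : E 3 → ℝ} (hw : ContDiff ℝ 2 w) {ε : ℝ} (hε : 0 < ε) (x y : E 3) :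
    resid (fun y => w (x + ε • y)) y ^ 2 = ε ^ 2 * willDensity ε w (x + ε • y) := by
  have hd := hw.differentiable (by norm_num)
  have h1 : ∀ i, pd i (fun y => w (x + ε • y)) = fun y => ε * pd i w (x + ε • y) := fun i =>
    funext fun y => pd_comp_add_smul i (hd _)
  have h2 : ∀ i, pd i (fun y => ε * pd i w (x + ε • y)) y = ε ^ 2 * pd i (pd i w) (x + ε • y) := by
    intro i
    have hd1 := (contDiff_pd_one (i := i) hw).differentiable (by norm_num)
    have hd2 : DifferentiableAt ℝ (fun y => pd i w (x + ε • y)) y :=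
      (hd1 _).comp y (by fun_prop)
    rw [pd_const_mul _ hd2, pd_comp_add_smul i (hd1 _)]
    ring
  simp only [resid, willDensity, lap_eq_sum_pd hw, lap_eq_sum_pd (contDiff_comp_add_smul hw ε x),
    h1, h2, ← Finset.mul_sum]
  field_simp

lemma setIntegral_ball_comp_add_smul (g : E 3 → ℝ) {ε : ℝ} (hε : 0 < ε) (x : E 3) (ρ : ℝ) :
    ∫ y in ball 0 ρ, g (x + ε • y) = (ε ^ 3)⁻¹ * ∫ y in ball x (ε * ρ), g y := by
  rw [← integral_indicator measurableSet_ball, ← integral_indicator measurableSet_ball]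
  have h1 : (ball (0 : E 3) ρ).indicator (fun y => g (x + ε • y)) =
      fun y => (fun y' => (ball x (ε * ρ)).indicator g (x + y')) (ε • y) := by
    ext y
    have : y ∈ ball (0 : E 3) ρ ↔ x + ε • y ∈ ball x (ε * ρ) := by
      rw [mem_ball_zero_iff, mem_ball_iff_norm, add_sub_cancel_left, norm_smul, Real.norm_eq_abs,
        abs_of_pos hε, mul_lt_mul_iff_right₀ hε]
    simp only
    by_cases hy : y ∈ ball (0 : E 3) ρ
    · rw [indicator_of_mem hy, indicator_of_mem (this.1 hy)]
    · rw [indicator_of_notMem hy, indicator_of_notMem (fun h => hy (this.2 h))]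
  rw [h1, Measure.integral_comp_smul volume
    (fun y' => (ball x (ε * ρ)).indicator g (x + y')) ε,
    integral_add_left_eq_self ((ball x (ε * ρ)).indicator g) x,
    abs_of_pos (by positivity), smul_eq_mul]
  simp

lemma areaDensity_congr {u w : E 3 → ℝ} {x : E 3} (h : w =ᶠ[nhds x] u) (ε : ℝ) :
    areaDensity ε w x = areaDensity ε u x := by
  simp [areaDensity, h.fderiv_eq, h.eq_of_nhds]

lemma willDensity_congr {u w : E 3 → ℝ} {x : E 3} (h : w =ᶠ[nhds x] u) (ε : ℝ) :
    willDensity ε w x = willDensity ε u x := by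
  simp [willDensity, lap, h.fderiv.fderiv_eq, h.eq_of_nhds]

/-- Localisation and blow-up by the factor `ε⁻¹` at a point of `Ω`. -/
lemma exists_rescale {Ω : Set (E 3)} (hΩ : IsOpen Ω) {u : E 3 → ℝ} (hu : ContDiffOn ℝ 2 u Ω)
    {x : E 3} {R : ℝ} (hR : 0 < R) (hsub : closedBall x R ⊆ Ω) {ε : ℝ} (hε : 0 < ε) :
    ∃ v : E 3 → ℝ, ContDiff ℝ 2 v ∧ HasCompactSupport v ∧
      (∀ ρ, ε * ρ ≤ R / 2 → ∀ y ∈ ball (0 : E 3) ρ, x + ε • y ∈ ball x (ε * ρ) ∧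
        v y = u (x + ε • y)) ∧
      ∀ ρ, ε * ρ ≤ R / 2 →
        energyBall v 0 ρ = (∫ y in ball x (ε * ρ), areaDensity ε u y) / ε ^ 2 ∧
        residBall v 0 ρ = (∫ y in ball x (ε * ρ), willDensity ε u y) / ε := by
  let β : ContDiffBump x := ⟨R / 2, R, by positivity, by linarith⟩
  have hβ : ContDiff ℝ 2 β := β.contDiff
  have hts : tsupport β = closedBall x R := β.tsupport_eq
  set w : E 3 → ℝ := fun y => β y * u y with hw
  have hw2 : ContDiff ℝ 2 w := by
    refine contDiff_iff_contDiffAt.2 fun y => ?_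
    by_cases hy : y ∈ Ω
    · exact hβ.contDiffAt.mul (hu.contDiffAt (hΩ.mem_nhds hy))
    · have h0 : w =ᶠ[nhds y] fun _ => 0 := by
        have : (tsupport β)ᶜ ∈ nhds y :=
          (isClosed_tsupport β).isOpen_compl.mem_nhds fun h => hy (hsub (hts ▸ h))
        filter_upwards [this] with y' hy'
        rw [hw]
        simp only [image_eq_zero_of_notMem_tsupport hy', zero_mul]
      exact contDiffAt_const.congr_of_eventuallyEq h0
  have hwu : ∀ y ∈ ball x (R / 2), w =ᶠ[nhds y] u := fun y hy => by
    filter_upwards [isOpen_ball.mem_nhds hy] with y' hy'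
    rw [hw]
    simp only [β.one_of_mem_closedBall (ball_subset_closedBall hy'), one_mul]
  have hwc : HasCompactSupport w := β.hasCompactSupport.mul_right
  refine ⟨fun y => w (x + ε • y), contDiff_comp_add_smul hw2 ε x, ?_, ?_, fun ρ hρ => ⟨?_, ?_⟩⟩
  · exact hwc.comp_homeomorph ((Homeomorph.smulOfNeZero ε hε.ne').trans (Homeomorph.addLeft x))
  · intro ρ hρ y hy
    have hm : x + ε • y ∈ ball x (ε * ρ) := by
      rw [mem_ball_zero_iff] at hy
      rw [mem_ball_iff_norm, add_sub_cancel_left, norm_smul, Real.norm_eq_abs, abs_of_pos hε]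
      exact mul_lt_mul_of_pos_left hy hε
    exact ⟨hm, (hwu _ (ball_subset_ball hρ hm)).eq_of_nhds⟩
  · simp only [energyBall, edens_comp_add_smul hw2 hε, integral_const_mul]
    rw [setIntegral_ball_comp_add_smul _ hε, setIntegral_congr_fun measurableSet_ball
      fun y hy => areaDensity_congr (hwu y (ball_subset_ball hρ hy)) ε]
    field_simp
  · simp only [residBall, resid_comp_add_smul hw2 hε, integral_const_mul]
    rw [setIntegral_ball_comp_add_smul _ hε, setIntegral_congr_fun measurableSet_ball
      fun y hy => willDensity_congr (hwu y (ball_subset_ball hρ hy)) ε]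
    field_simp

lemma exists_dyadic {a R : ℝ} (ha : 0 < a) {m : ℕ} (h : 2 ^ m * a ≤ R) :
    ∃ N ≥ m, 2 ^ N * a ≤ R ∧ R ≤ 2 ^ (N + 1) * a := by
  have h1 : (2 : ℝ) ^ m ≤ R / a := (le_div_iff₀ ha).2 h
  obtain ⟨N, hN, hN'⟩ := exists_nat_pow_near ((one_le_pow₀ one_le_two).trans h1)
    (one_lt_two : (1 : ℝ) < 2)
  refine ⟨N, ?_, (le_div_iff₀ ha).1 hN, ((div_lt_iff₀ ha).1 hN').le⟩
  have : m < N + 1 := (pow_lt_pow_iff_right₀ (one_lt_two : (1 : ℝ) < 2)).1 (h1.trans_lt hN')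
  omega

lemma continuousOn_areaDensity {Ω : Set (E 3)} (hΩ : IsOpen Ω) {u : E 3 → ℝ}
    (hu : ContDiffOn ℝ 2 u Ω) (ε : ℝ) : ContinuousOn (areaDensity ε u) Ω := by
  have h1 := hu.continuousOn_fderiv_of_isOpen hΩ (by norm_num)
  have h2 := continuous_W.comp_continuousOn hu.continuousOn
  exact (continuousOn_const.mul (h1.norm.pow 2)).add (continuousOn_const.mul h2)

lemma continuousOn_willDensity {Ω : Set (E 3)} (hΩ : IsOpen Ω) {u : E 3 → ℝ}
    (hu : ContDiffOn ℝ 2 u Ω) (ε : ℝ) : ContinuousOn (willDensity ε u) Ω := by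
  have h1 := (hu.fderiv_of_isOpen hΩ (m := 1) (by norm_num)).continuousOn_fderiv_of_isOpen hΩ
    le_rfl
  have h2 := continuous_W'.comp_continuousOn hu.continuousOn
  have h3 : ContinuousOn (lap u) Ω :=
    continuousOn_finsetSum _ fun i _ =>
      (h1.clm_apply continuousOn_const).clm_apply continuousOn_const
  exact ((continuousOn_const.mul h3).sub (continuousOn_const.mul h2)).pow 2

lemma areaDensity_nonneg {ε : ℝ} (hε : 0 < ε) (u : E 3 → ℝ) (x : E 3) : 0 ≤ areaDensity ε u x :=
  add_nonneg (by positivity) (mul_nonneg (by positivity) (W_nonneg _))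

lemma willDensity_nonneg (ε : ℝ) (u : E 3 → ℝ) (x : E 3) : 0 ≤ willDensity ε u x :=
  sq_nonneg _

lemma setIntegral_le_of_subset_closedBall {Ω : Set (E 3)} {g : E 3 → ℝ} (hg : ContinuousOn g Ω)
    (h0 : ∀ y, 0 ≤ g y) {x : E 3} {R : ℝ} (hsub : closedBall x R ⊆ Ω) {S T : Set (E 3)}
    (hST : S ⊆ T) (hT : T ⊆ closedBall x R) : ∫ y in S, g y ≤ ∫ y in T, g y :=
  setIntegral_mono_set
    (((hg.mono hsub).integrableOn_compact (isCompact_closedBall x R)).mono_set hT)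
    (Eventually.of_forall h0) hST.eventuallyLE

lemma div_sq_le_of_quarter_le {X Y R r : ℝ} (h0 : 0 ≤ X) (hXY : X ≤ Y) (hR : 0 < R)
    (hr : R / 4 ≤ r) : X / r ^ 2 ≤ 16 * Y / R ^ 2 := by
  have hr0 : 0 < r := by linarith
  rw [div_le_div_iff₀ (by positivity) (by positivity)]
  have h1 : R ^ 2 ≤ 16 * r ^ 2 := by nlinarith
  calc X * R ^ 2 ≤ Y * (16 * r ^ 2) := mul_le_mul hXY h1 (by positivity) (h0.trans hXY)
    _ = 16 * Y * r ^ 2 := by ring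

/-- Upper and lower bounds for the area ratio at a fixed scale. -/
lemma exists_local_density_bounds : ∃ s ≥ 1, ∃ C > 0,
    (∀ (Ω : Set (E 3)), IsOpen Ω → ∀ (u : E 3 → ℝ), ContDiffOn ℝ 2 u Ω → ∀ (x : E 3) (R : ℝ),
      0 < R → closedBall x R ⊆ Ω → ∀ ε > 0, ∀ j : ℕ, 2 ^ (j + 2) * (s * ε) ≤ R / 2 →
      ∫ y in ball x (R / 2 ^ (j + 2)), areaDensity ε u y ≤ C * (R / 2 ^ (j + 1)) ^ 2 *
        ((∫ y in ball x (R / 2), willDensity ε u y) / ε +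
          16 * (∫ y in ball x (R / 2), areaDensity ε u y) / R ^ 2)) ∧
    ∀ b, 0 ≤ b → b < 1 → ∃ δ > 0, ∃ c > 0,
      ∀ (Ω : Set (E 3)), IsOpen Ω → ∀ (u : E 3 → ℝ), ContDiffOn ℝ 2 u Ω → ∀ (x : E 3) (R : ℝ),
      0 < R → closedBall x R ⊆ Ω → ∀ ε > 0, 2 ^ 2 * (s * ε) ≤ R / 2 → |u x| ≤ b →
      (∫ y in ball x (R / 2), willDensity ε u y) / ε ≤ δ →
      c * R ^ 2 ≤ ∫ y in ball x (R / 2), areaDensity ε u y := by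
  obtain ⟨s, hs, C, hC, H, Hb⟩ := exists_density_bounds
  have hs0 : 0 < s := by linarith
  refine ⟨s, hs, C, hC, ?_, ?_⟩
  · intro Ω hΩ u hu x R hR hsub ε hε j hj
    obtain ⟨N, hN, hN1, hN2⟩ := exists_dyadic (by positivity : 0 < s * ε) hj
    obtain ⟨i, rfl⟩ := Nat.exists_eq_add_of_le' (show j ≤ N by omega)
    obtain ⟨n, hn⟩ := Nat.exists_eq_add_of_le' (show 2 ≤ i + j by omega)
    obtain ⟨v, hv, hvc, -, hball⟩ := exists_rescale hΩ hu hR hsub hε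
    have hP : ε * (2 ^ (n + 2) * s) ≤ R / 2 := by rw [← hn]; linarith
    have hP' : R / 4 ≤ ε * (2 ^ (n + 2) * s) := by rw [← hn]; rw [pow_succ] at hN2; linarith
    have hj0 : (0 : ℝ) < 2 ^ j := by positivity
    have hρ1 : ε * (2 ^ i * s) ≤ R / 2 ^ (j + 1) := by
      rw [le_div_iff₀ (by positivity)]
      calc ε * (2 ^ i * s) * 2 ^ (j + 1) = 2 * (2 ^ (i + j) * (s * ε)) := by ring
        _ ≤ R := by linarith
    have hρ2 : R / 2 ^ (j + 2) ≤ ε * (2 ^ i * s) := by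
      rw [div_le_iff₀ (by positivity)]
      calc R ≤ 2 * (2 ^ (i + j + 1) * (s * ε)) := by linarith
        _ = ε * (2 ^ i * s) * 2 ^ (j + 2) := by ring
    have hjR : R / 2 ^ (j + 1) ≤ R / 2 := by
      refine div_le_div_of_nonneg_left hR.le two_pos ?_
      calc (2 : ℝ) = 2 ^ 1 := (pow_one 2).symm
        _ ≤ 2 ^ (j + 1) := pow_le_pow_right₀ one_le_two (by omega)
    have h1 := (H v hv hvc 0 n).1 i (by omega)
    rw [(hball _ (hρ1.trans hjR)).1, (hball _ hP).1, (hball _ hP).2, div_div, div_div, ← mul_pow,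
      ← mul_pow] at h1
    have ca := continuousOn_areaDensity hΩ hu ε
    have cw := continuousOn_willDensity hΩ hu ε
    have hR2 : ball x (R / 2) ⊆ closedBall x R :=
      (ball_subset_ball (by linarith)).trans ball_subset_closedBall
    have m1 : ∫ y in ball x (ε * (2 ^ (n + 2) * s)), areaDensity ε u y ≤
        ∫ y in ball x (R / 2), areaDensity ε u y :=
      setIntegral_le_of_subset_closedBall ca (areaDensity_nonneg hε u) hsub
        (ball_subset_ball hP) hR2
    have m2 : ∫ y in ball x (ε * (2 ^ (n + 2) * s)), willDensity ε u y ≤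
        ∫ y in ball x (R / 2), willDensity ε u y :=
      setIntegral_le_of_subset_closedBall cw (willDensity_nonneg ε u) hsub (ball_subset_ball hP) hR2
    have m3 : ∫ y in ball x (R / 2 ^ (j + 2)), areaDensity ε u y ≤
        ∫ y in ball x (ε * (2 ^ i * s)), areaDensity ε u y :=
      setIntegral_le_of_subset_closedBall ca (areaDensity_nonneg hε u) hsub (ball_subset_ball hρ2)
        ((ball_subset_ball (hρ1.trans hjR)).trans hR2)
    have n1 := div_sq_le_of_quarter_le (integral_nonneg (areaDensity_nonneg hε u)) m1 hR hP'
    have n2 := div_le_div_of_nonneg_right m2 hε.le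
    have hA0 : 0 ≤ ∫ y in ball x (R / 2), areaDensity ε u y :=
      integral_nonneg (areaDensity_nonneg hε u)
    have hW0 : 0 ≤ ∫ y in ball x (R / 2), willDensity ε u y :=
      integral_nonneg (willDensity_nonneg ε u)
    rw [div_le_iff₀ (by positivity)] at h1
    refine m3.trans (h1.trans ?_)
    calc _ ≤ C * ((∫ y in ball x (R / 2), willDensity ε u y) / ε +
          16 * (∫ y in ball x (R / 2), areaDensity ε u y) / R ^ 2) * (R / 2 ^ (j + 1)) ^ 2 :=
        mul_le_mul (mul_le_mul_of_nonneg_left (add_le_add n2 n1) hC.le)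
          (pow_le_pow_left₀ (by positivity) hρ1 2) (by positivity) (by positivity)
      _ = _ := by ring
  · intro b hb0 hb
    obtain ⟨δ, hδ, c, hc, hlow⟩ := Hb b hb0 hb
    refine ⟨δ, hδ, c / 16, by positivity, ?_⟩
    intro Ω hΩ u hu x R hR hsub ε hε hj hux hF
    obtain ⟨N, hN, hN1, hN2⟩ := exists_dyadic (by positivity : 0 < s * ε) hj
    obtain ⟨n, rfl⟩ := Nat.exists_eq_add_of_le' hN
    obtain ⟨v, hv, hvc, hval, hball⟩ := exists_rescale hΩ hu hR hsub hε
    have hP : ε * (2 ^ (n + 2) * s) ≤ R / 2 := by linarith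
    have hP' : R / 4 ≤ ε * (2 ^ (n + 2) * s) := by rw [pow_succ] at hN2; linarith
    have hv0 : v 0 = u x := by
      have := (hval _ hP 0 (mem_ball_self (by positivity))).2
      simpa using this
    have ca := continuousOn_areaDensity hΩ hu ε
    have cw := continuousOn_willDensity hΩ hu ε
    have hR2 : ball x (R / 2) ⊆ closedBall x R :=
      (ball_subset_ball (by linarith)).trans ball_subset_closedBall
    have m1 : ∫ y in ball x (ε * (2 ^ (n + 2) * s)), areaDensity ε u y ≤
        ∫ y in ball x (R / 2), areaDensity ε u y :=
      setIntegral_le_of_subset_closedBall ca (areaDensity_nonneg hε u) hsub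
        (ball_subset_ball hP) hR2
    have m2 : ∫ y in ball x (ε * (2 ^ (n + 2) * s)), willDensity ε u y ≤
        ∫ y in ball x (R / 2), willDensity ε u y :=
      setIntegral_le_of_subset_closedBall cw (willDensity_nonneg ε u) hsub (ball_subset_ball hP) hR2
    have h1 := hlow v hv hvc 0 n (by rwa [hv0])
      (by rw [(hball _ hP).2]; exact (div_le_div_of_nonneg_right m2 hε.le).trans hF)
    rw [(hball _ hP).1, div_div, ← mul_pow] at h1
    have n1 := h1.trans
      (div_sq_le_of_quarter_le (integral_nonneg (areaDensity_nonneg hε u)) m1 hR hP')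
    rw [le_div_iff₀ (by positivity)] at n1
    linarith

/-- Decay of the area at a fixed scale if a value in `(-1, 1)` is omitted. -/
lemma exists_local_energy_decay : ∃ s ≥ 1, ∀ s₀, -1 < s₀ → s₀ < 1 → ∃ δ > 0, ∀ A ≥ 0, ∃ K > 0,
    ∀ (Ω : Set (E 3)), IsOpen Ω → ∀ (u : E 3 → ℝ), ContDiffOn ℝ 2 u Ω → ∀ (x : E 3) (R : ℝ),
    0 < R → closedBall x R ⊆ Ω → ∀ ε > 0, ∀ m : ℕ, 2 ^ (m + 6) * (s * ε) ≤ R / 2 →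
    ∫ y in ball x (R / 2), areaDensity ε u y ≤ A * R ^ 2 →
    (∫ y in ball x (R / 2), willDensity ε u y) / ε ≤ δ →
    (∀ y ∈ ball x (R / 2), u y ≠ s₀) →
    m * ∫ y in ball x (R / 2 ^ 8), areaDensity ε u y ≤ K * R ^ 2 := by
  obtain ⟨s, hs, H⟩ := exists_energy_decay
  have hs0 : 0 < s := by linarith
  refine ⟨s, hs, fun s₀ h0 h1 => ?_⟩
  obtain ⟨δ, hδ, HA⟩ := H s₀ h0 h1
  refine ⟨δ, hδ, fun A hA => ?_⟩
  obtain ⟨K, hK, HK⟩ := HA (2 ^ 16 * A) (by positivity)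
  refine ⟨K, hK, fun Ω hΩ u hu x R hR hsub ε hε m hm hE hF hne => ?_⟩
  obtain ⟨N, hN, hN1, hN2⟩ := exists_dyadic (by positivity : 0 < s * ε) hm
  obtain ⟨n, rfl⟩ := Nat.exists_eq_add_of_le' (show 6 ≤ N by omega)
  obtain ⟨v, hv, hvc, hval, hball⟩ := exists_rescale hΩ hu hR hsub hε
  have e6 : (2 : ℝ) ^ (n + 6) = 64 * 2 ^ n := by ring
  have e7 : (2 : ℝ) ^ (n + 6 + 1) = 128 * 2 ^ n := by ring
  have hρ0 : 0 < ε * (2 ^ n * s) := by positivity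
  have hP : ε * (2 ^ (n + 6) * s) ≤ R / 2 := by linarith
  have hP1 : ε * (2 ^ (n + 1) * s) ≤ R / 2 := by
    rw [e6] at hP; rw [pow_succ]; linarith
  have hρ : ε * (2 ^ n * s) ≤ R := by rw [e6] at hP; linarith
  have hρ2 : ε * (2 ^ n * s) ≤ R / 2 := by rw [e6] at hP; linarith
  have hρ' : R / 2 ^ 8 ≤ ε * (2 ^ n * s) := by rw [e7] at hN2; linarith
  have ca := continuousOn_areaDensity hΩ hu ε
  have cw := continuousOn_willDensity hΩ hu ε
  have hR2 : ball x (R / 2) ⊆ closedBall x R :=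
    (ball_subset_ball (by linarith)).trans ball_subset_closedBall
  have m1 : ∫ y in ball x (ε * (2 ^ (n + 6) * s)), areaDensity ε u y ≤
      ∫ y in ball x (R / 2), areaDensity ε u y :=
    setIntegral_le_of_subset_closedBall ca (areaDensity_nonneg hε u) hsub
        (ball_subset_ball hP) hR2
  have m2 : ∫ y in ball x (ε * (2 ^ (n + 6) * s)), willDensity ε u y ≤
      ∫ y in ball x (R / 2), willDensity ε u y :=
    setIntegral_le_of_subset_closedBall cw (willDensity_nonneg ε u) hsub (ball_subset_ball hP) hR2
  have m3 : ∫ y in ball x (R / 2 ^ 8), areaDensity ε u y ≤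
      ∫ y in ball x (ε * (2 ^ n * s)), areaDensity ε u y :=
    setIntegral_le_of_subset_closedBall ca (areaDensity_nonneg hε u) hsub (ball_subset_ball hρ')
      ((ball_subset_ball hρ2).trans hR2)
  have key := HK v hv hvc 0 n (by
      rw [(hball _ hP).1, div_le_iff₀ (by positivity)]
      refine (m1.trans hE).trans ?_
      have hRle : R ≤ 2 ^ 8 * (ε * (2 ^ n * s)) := by linarith
      calc A * R ^ 2 ≤ A * (2 ^ 8 * (ε * (2 ^ n * s))) ^ 2 :=
            mul_le_mul_of_nonneg_left (pow_le_pow_left₀ hR.le hRle 2) hA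
        _ = 2 ^ 16 * A * (2 ^ n * s) ^ 2 * ε ^ 2 := by ring)
    (by rw [(hball _ hP).2]; exact (div_le_div_of_nonneg_right m2 hε.le).trans hF)
    (fun y hy => by
      obtain ⟨k1, k2⟩ := hval _ hP1 y hy
      rw [k2]
      exact hne _ (ball_subset_ball hP1 k1))
  rw [(hball _ hρ2).1, mul_div_assoc', div_le_iff₀ (by positivity)] at key
  have hmn : (m : ℝ) ≤ n := by exact_mod_cast (by omega : m ≤ n)
  have hX : 0 ≤ ∫ y in ball x (R / 2 ^ 8), areaDensity ε u y :=
    integral_nonneg (areaDensity_nonneg hε u)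
  calc _ ≤ (n : ℝ) * ∫ y in ball x (ε * (2 ^ n * s)), areaDensity ε u y :=
        mul_le_mul hmn m3 hX (Nat.cast_nonneg n)
    _ ≤ K * (ε * (2 ^ n * s)) ^ 2 := key.trans_eq (by ring)
    _ ≤ K * R ^ 2 := mul_le_mul_of_nonneg_left (pow_le_pow_left₀ hρ0.le hρ 2) hK.le

/-- A bounded continuous cutoff between two concentric balls. -/
lemma exists_bcf_cutoff (x : E 3) {r R : ℝ} (hr : 0 < r) (hrR : r < R) :
    ∃ φ : BoundedContinuousFunction (E 3) ℝ, (∀ y, 0 ≤ φ y) ∧ (∀ y, φ y ≤ 1) ∧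
      (∀ y ∈ ball x r, φ y = 1) ∧ ∀ y ∉ ball x R, φ y = 0 := by
  let β : ContDiffBump x := ⟨r, R, hr, hrR⟩
  refine ⟨BoundedContinuousFunction.ofNormedAddCommGroup β β.continuous 1 fun y => ?_,
    fun y => β.nonneg, fun y => β.le_one,
    fun y hy => β.one_of_mem_closedBall (ball_subset_closedBall hy), fun y hy => ?_⟩
  · rw [Real.norm_eq_abs, abs_of_nonneg β.nonneg]
    exact β.le_one
  · exact β.zero_of_le_dist (not_lt.1 fun h => hy h)

section WeakConvergence

variable {Ω : Set (E 3)} {g : ℕ → E 3 → ℝ} {μ : Measure (E 3)}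
  {x : E 3} {r R m : ℝ}

lemma setIntegral_cutoff_mul {g : E 3 → ℝ} (hΩ : IsOpen Ω)
    (hg : ContinuousOn g Ω) (hsub : closedBall x R ⊆ Ω)
    (φ : BoundedContinuousFunction (E 3) ℝ) (h0 : ∀ y ∉ ball x R, φ y = 0) :
    ∫ y in Ω, φ y * g y = ∫ y in ball x R, φ y * g y ∧
      IntegrableOn (fun y => φ y * g y) (ball x R) ∧ IntegrableOn g (ball x R) := by
  have hb : ball x R ⊆ closedBall x R := ball_subset_closedBall
  have hg' := hg.mono hsub
  refine ⟨setIntegral_eq_of_subset_of_forall_sdiff_eq_zero hΩ.measurableSet (hb.trans hsub)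
    fun y hy => by rw [h0 y hy.2, zero_mul], ?_, ?_⟩
  · exact ((φ.continuous.continuousOn.mul hg').integrableOn_compact
      (isCompact_closedBall x R)).mono_set hb
  · exact (hg'.integrableOn_compact (isCompact_closedBall x R)).mono_set hb

lemma eventually_setIntegral_lt [IsFiniteMeasure μ] (hΩ : IsOpen Ω)
    (hg : ∀ k, ContinuousOn (g k) Ω) (hg0 : ∀ k y, 0 ≤ g k y)
    (hconv : ∀ φ : BoundedContinuousFunction (E 3) ℝ,
      Tendsto (fun k => ∫ y in Ω, φ y * g k y) atTop (nhds (∫ y, φ y ∂μ)))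
    (hr : 0 < r) (hrR : r < R) (hsub : closedBall x R ⊆ Ω) (hm : μ.real (closedBall x R) < m) :
    ∀ᶠ k in atTop, ∫ y in ball x r, g k y < m := by
  obtain ⟨φ, h0, h1, hone, hzero⟩ := exists_bcf_cutoff x hr hrR
  have hle : ∫ y, φ y ∂μ ≤ μ.real (closedBall x R) := by
    rw [← integral_indicator_one measurableSet_closedBall]
    refine integral_mono (φ.integrable μ)
      ((integrable_const 1).indicator measurableSet_closedBall) fun y => ?_
    by_cases hy : y ∈ ball x R
    · rw [indicator_of_mem (ball_subset_closedBall hy)]; exact h1 y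
    · rw [hzero y hy]; exact indicator_nonneg (fun _ _ => zero_le_one) y
  filter_upwards [(hconv φ).eventually_lt_const (hle.trans_lt hm)] with k hk
  obtain ⟨e1, i1, i2⟩ := setIntegral_cutoff_mul hΩ (hg k) hsub φ hzero
  refine lt_of_le_of_lt ?_ hk
  rw [e1]
  calc ∫ y in ball x r, g k y = ∫ y in ball x r, φ y * g k y :=
        setIntegral_congr_fun measurableSet_ball fun y hy => by simp [hone y hy]
    _ ≤ _ := setIntegral_mono_set i1
        (Eventually.of_forall fun y => mul_nonneg (h0 y) (hg0 k y))
        (ball_subset_ball hrR.le).eventuallyLE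

lemma eventually_lt_setIntegral [IsFiniteMeasure μ] (hΩ : IsOpen Ω)
    (hg : ∀ k, ContinuousOn (g k) Ω) (hg0 : ∀ k y, 0 ≤ g k y)
    (hconv : ∀ φ : BoundedContinuousFunction (E 3) ℝ,
      Tendsto (fun k => ∫ y in Ω, φ y * g k y) atTop (nhds (∫ y, φ y ∂μ)))
    (hr : 0 < r) (hrR : r < R) (hsub : closedBall x R ⊆ Ω) (hm : m < μ.real (ball x r)) :
    ∀ᶠ k in atTop, m < ∫ y in ball x R, g k y := by
  obtain ⟨φ, h0, h1, hone, hzero⟩ := exists_bcf_cutoff x hr hrR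
  have hle : μ.real (ball x r) ≤ ∫ y, φ y ∂μ := by
    rw [← integral_indicator_one measurableSet_ball]
    refine integral_mono ((integrable_const 1).indicator measurableSet_ball) (φ.integrable μ)
      fun y => ?_
    by_cases hy : y ∈ ball x r
    · rw [indicator_of_mem hy, hone y hy]; rfl
    · rw [indicator_of_notMem hy]; exact h0 y
  filter_upwards [(hconv φ).eventually_const_lt (hm.trans_le hle)] with k hk
  obtain ⟨e1, i1, i2⟩ := setIntegral_cutoff_mul hΩ (hg k) hsub φ hzero
  refine lt_of_lt_of_le hk ?_
  rw [e1]
  exact setIntegral_mono_on i1 i2 measurableSet_ball fun y _ =>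
    mul_le_of_le_one_left (hg0 k y) (h1 y)

end WeakConvergence

lemma c0_pos : 0 < c0 := by unfold c0; positivity

lemma exists_closedBall_measure_lt {α : Measure (E 3)} [IsFiniteMeasure α] {x : E 3}
    (hx : α {x} = 0) {δ : ℝ} (hδ : 0 < δ) {U : Set (E 3)} (hU : U ∈ nhds x) :
    ∃ R > 0, closedBall x R ⊆ U ∧ α.real (closedBall x R) < δ := by
  have h1 := tendsto_measure_cthickening_of_isCompact (μ := α) (isCompact_singleton (x := x))
  rw [hx] at h1
  obtain ⟨r, hr, hrU⟩ := nhds_basis_closedBall.mem_iff.1 hU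
  have h2 : ∀ᶠ R in nhdsWithin (0 : ℝ) (Ioi 0), α (cthickening R {x}) < ENNReal.ofReal δ :=
    (h1.mono_left nhdsWithin_le_nhds).eventually_lt_const (by simpa using hδ)
  obtain ⟨R, hR, hR0, hRr⟩ := (h2.and (Ioc_mem_nhdsGT hr)).exists
  refine ⟨R, hR0, (closedBall_subset_closedBall hRr).trans hrU, ?_⟩
  rw [cthickening_singleton x hR0.le] at hR
  exact (ENNReal.toReal_lt_of_lt_ofReal hR)

/-- Standing data: weak limits of the diffuse area and Willmore measures. -/
structure IsLimitData (Ω : Set (E 3)) (ε : ℕ → ℝ) (u : ℕ → E 3 → ℝ) (μ α : Measure (E 3)) :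
    Prop where
  isOpen : IsOpen Ω
  pos : ∀ k, 0 < ε k
  tendsto : Tendsto ε atTop (nhds 0)
  contDiffOn : ∀ k, ContDiffOn ℝ 2 (u k) Ω
  area : weakConvA Ω ε u μ
  will : weakConvW Ω ε u α

namespace IsLimitData

variable {Ω : Set (E 3)} {ε : ℕ → ℝ} {u : ℕ → E 3 → ℝ} {μ α : Measure (E 3)}
  {x : E 3} {r R m : ℝ}

lemma eventually_mul_le (h : IsLimitData Ω ε u μ α) (a : ℝ) (hm : 0 < m) :
    ∀ᶠ k in atTop, a * ε k ≤ m := by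
  have h1 : Tendsto (fun k => a * ε k) atTop (nhds (a * 0)) := h.tendsto.const_mul a
  rw [mul_zero] at h1
  exact h1.eventually_le_const hm

lemma eventually_area_lt [IsFiniteMeasure μ] (h : IsLimitData Ω ε u μ α) (hr : 0 < r) (hrR : r < R)
    (hsub : closedBall x R ⊆ Ω) (hm : μ.real (closedBall x R) < m) :
    ∀ᶠ k in atTop, ∫ y in ball x r, areaDensity (ε k) (u k) y < c0 * m := by
  have := eventually_setIntegral_lt h.isOpen (g := fun k y => 1 / c0 * areaDensity (ε k) (u k) y)
    (fun k => continuousOn_const.mul (continuousOn_areaDensity h.isOpen (h.contDiffOn k) _))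
    (fun k y => mul_nonneg (one_div_pos.2 c0_pos).le (areaDensity_nonneg (h.pos k) _ y))
    (fun φ => (h.area φ).congr fun k => by
      rw [← integral_const_mul]; congr 1; ext y; ring) hr hrR hsub hm
  filter_upwards [this] with k hk
  rw [integral_const_mul, one_div, inv_mul_lt_iff₀ c0_pos] at hk
  exact hk

lemma eventually_lt_area [IsFiniteMeasure μ] (h : IsLimitData Ω ε u μ α) (hr : 0 < r) (hrR : r < R)
    (hsub : closedBall x R ⊆ Ω) (hm : m < μ.real (ball x r)) :
    ∀ᶠ k in atTop, c0 * m < ∫ y in ball x R, areaDensity (ε k) (u k) y := by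
  have := eventually_lt_setIntegral h.isOpen (g := fun k y => 1 / c0 * areaDensity (ε k) (u k) y)
    (fun k => continuousOn_const.mul (continuousOn_areaDensity h.isOpen (h.contDiffOn k) _))
    (fun k y => mul_nonneg (one_div_pos.2 c0_pos).le (areaDensity_nonneg (h.pos k) _ y))
    (fun φ => (h.area φ).congr fun k => by
      rw [← integral_const_mul]; congr 1; ext y; ring) hr hrR hsub hm
  filter_upwards [this] with k hk
  rw [integral_const_mul, one_div, lt_inv_mul_iff₀ c0_pos] at hk
  exact hk

lemma eventually_will_lt [IsFiniteMeasure α] (h : IsLimitData Ω ε u μ α) (hr : 0 < r) (hrR : r < R)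
    (hsub : closedBall x R ⊆ Ω) (hm : α.real (closedBall x R) < m) :
    ∀ᶠ k in atTop, (∫ y in ball x r, willDensity (ε k) (u k) y) / ε k < c0 * m := by
  have := eventually_setIntegral_lt h.isOpen
    (g := fun k y => 1 / (c0 * ε k) * willDensity (ε k) (u k) y)
    (fun k => continuousOn_const.mul (continuousOn_willDensity h.isOpen (h.contDiffOn k) _))
    (fun k y => mul_nonneg (one_div_pos.2 (mul_pos c0_pos (h.pos k))).le (willDensity_nonneg _ _ y))
    (fun φ => (h.will φ).congr fun k => by
      rw [← integral_const_mul]; congr 1; ext y; ring) hr hrR hsub hm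
  filter_upwards [this] with k hk
  have hc := c0_pos
  have he := h.pos k
  rw [integral_const_mul, one_div, inv_mul_lt_iff₀ (by positivity)] at hk
  rw [div_lt_iff₀ he]
  linarith

/-- The limit measure has no atoms in `Ω`. -/
lemma measure_singleton [IsFiniteMeasure μ] [IsFiniteMeasure α]
    (h : IsLimitData Ω ε u μ α) (hx : x ∈ Ω) : μ {x} = 0 := by
  obtain ⟨s, hs, C, hC, hD, -⟩ := exists_local_density_bounds
  obtain ⟨R, hR, hsub⟩ := nhds_basis_closedBall.mem_iff.1 (h.isOpen.mem_nhds hx)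
  have hc := c0_pos
  by_contra hne
  have hpos : 0 < μ.real {x} := ENNReal.toReal_pos hne (measure_ne_top μ _)
  set M := c0 * (α.real univ + 1) + 16 * (c0 * (μ.real univ + 1)) / R ^ 2 with hM
  have hα0 : 0 ≤ α.real univ := measureReal_nonneg
  have hμ0 : 0 ≤ μ.real univ := measureReal_nonneg
  have hM0 : 0 < M := by positivity
  obtain ⟨j, hj⟩ := exists_pow_lt_of_lt_one
    (show 0 < c0 * (μ.real {x} / 2) / (C * R ^ 2 * M) by positivity) (one_half_lt_one (α := ℝ))
  rw [lt_div_iff₀ (by positivity)] at hj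
  have hmono : ∀ ν : Measure (E 3), IsFiniteMeasure ν → ∀ S, ν.real S < ν.real univ + 1 :=
    fun ν _ S => (measureReal_mono (subset_univ S)).trans_lt (by linarith)
  have hlow : μ.real {x} / 2 < μ.real (ball x (R / 2 ^ (j + 3))) := by
    have : μ.real {x} ≤ μ.real (ball x (R / 2 ^ (j + 3))) :=
      measureReal_mono (singleton_subset_iff.2 (mem_ball_self (by positivity)))
    linarith
  have hrad : R / 2 ^ (j + 3) < R / 2 ^ (j + 2) :=
    div_lt_div_of_pos_left hR (by positivity) (pow_lt_pow_right₀ one_lt_two (by omega))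
  have hsub' : closedBall x (R / 2 ^ (j + 2)) ⊆ Ω :=
    (closedBall_subset_closedBall (div_le_self hR.le (one_le_pow₀ one_le_two))).trans hsub
  obtain ⟨k, k1, k2, k3, k4⟩ := ((h.eventually_lt_area (by positivity) hrad hsub' hlow).and
    ((h.eventually_area_lt (half_pos hR) (half_lt_self hR) hsub (hmono μ inferInstance _)).and
    ((h.eventually_will_lt (half_pos hR) (half_lt_self hR) hsub (hmono α inferInstance _)).and
    (h.eventually_mul_le (2 ^ (j + 2) * s) (half_pos hR))))).exists
  have hbound := hD Ω h.isOpen (u k) (h.contDiffOn k) x R hR hsub (ε k) (h.pos k) j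
    (by rw [← mul_assoc]; exact k4)
  have hle : (∫ y in ball x (R / 2), willDensity (ε k) (u k) y) / ε k +
      16 * (∫ y in ball x (R / 2), areaDensity (ε k) (u k) y) / R ^ 2 ≤ M := by
    refine add_le_add k3.le (div_le_div_of_nonneg_right ?_ (by positivity))
    exact mul_le_mul_of_nonneg_left k2.le (by norm_num)
  have hsq : (R / 2 ^ (j + 1)) ^ 2 ≤ R ^ 2 * (1 / 2) ^ j := by
    rw [div_pow, div_eq_mul_inv]
    refine mul_le_mul_of_nonneg_left ?_ (by positivity)
    rw [one_div, inv_pow]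
    refine inv_anti₀ (by positivity) ?_
    rw [← pow_mul]
    exact pow_le_pow_right₀ one_le_two (by omega)
  have hfin : C * (R / 2 ^ (j + 1)) ^ 2 *
      ((∫ y in ball x (R / 2), willDensity (ε k) (u k) y) / ε k +
      16 * (∫ y in ball x (R / 2), areaDensity (ε k) (u k) y) / R ^ 2) ≤
      C * (R ^ 2 * (1 / 2) ^ j) * M :=
    (mul_le_mul_of_nonneg_left hle (by positivity)).trans
      (mul_le_mul_of_nonneg_right (mul_le_mul_of_nonneg_left hsq hC.le) hM0.le)
  linarith

/-- Away from the support the level sets are eventually absent. -/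
lemma exists_eventually_notMem [IsFiniteMeasure μ] [IsFiniteMeasure α]
    (h : IsLimitData Ω ε u μ α) (hx : x ∈ Ω) (hμ : x ∉ sptM μ)
    (hα : α {x} = 0) {I : Set ℝ} (hIc : IsCompact I) (hI : I ⊆ Ioo (-1) 1) :
    ∃ r > 0, ∀ᶠ k in atTop, ∀ y ∈ ball x r, u k y ∉ I := by
  obtain ⟨b, hb0, hb1, hb⟩ : ∃ b, 0 ≤ b ∧ b < 1 ∧ ∀ t ∈ I, |t| ≤ b := by
    rcases I.eq_empty_or_nonempty with rfl | hne
    · exact ⟨0, le_rfl, one_pos, by simp⟩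
    · obtain ⟨t, ht, hmax⟩ := hIc.exists_isMaxOn hne continuous_abs.continuousOn
      exact ⟨|t|, abs_nonneg t, abs_lt.2 (hI ht), fun t' ht' => hmax ht'⟩
  obtain ⟨s, hs, -, -, -, hA⟩ := exists_local_density_bounds
  obtain ⟨δ, hδ, c, hc, hA⟩ := hA b hb0 hb1
  have hc0 := c0_pos
  obtain ⟨r₁, hr₁, hnull⟩ : ∃ r₁ > 0, μ (ball x r₁) = 0 := by
    by_contra hcon
    push Not at hcon
    exact hμ fun r hr => pos_iff_ne_zero.2 (hcon r hr)
  obtain ⟨R, hR, hsub, hαR⟩ := exists_closedBall_measure_lt hα (div_pos hδ hc0)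
    (inter_mem (h.isOpen.mem_nhds hx) (ball_mem_nhds x hr₁))
  have hsubΩ : closedBall x R ⊆ Ω := hsub.trans inter_subset_left
  have hμR : μ.real (closedBall x R) = 0 := by
    rw [measureReal_def, measure_mono_null (hsub.trans inter_subset_right) hnull]; rfl
  refine ⟨R / 2, half_pos hR, ?_⟩
  filter_upwards [h.eventually_area_lt (r := 3 / 4 * R) (by positivity) (by linarith) hsubΩ
      (show μ.real (closedBall x R) < c * (R / 2) ^ 2 / c0 by rw [hμR]; positivity),
    h.eventually_will_lt (r := 3 / 4 * R) (by positivity) (by linarith) hsubΩ hαR,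
    h.eventually_mul_le (2 ^ 2 * s) (show 0 < R / 2 / 2 by positivity)] with k k1 k2 k3 y hy hyI
  have hdist : dist y x < R / 2 := hy
  have hsub1 : closedBall y (R / 2) ⊆ Ω :=
    (closedBall_subset_closedBall' (by linarith)).trans hsubΩ
  have hsub2 : ball y (R / 2 / 2) ⊆ ball x (3 / 4 * R) := ball_subset_ball' (by linarith)
  have hsub3 : ball x (3 / 4 * R) ⊆ closedBall x R :=
    (ball_subset_ball (by linarith)).trans ball_subset_closedBall
  have hk := h.contDiffOn k
  have m1 : ∫ y in ball y (R / 2 / 2), areaDensity (ε k) (u k) y ≤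
      ∫ y in ball x (3 / 4 * R), areaDensity (ε k) (u k) y :=
    setIntegral_le_of_subset_closedBall (continuousOn_areaDensity h.isOpen hk _)
      (areaDensity_nonneg (h.pos k) _) hsubΩ hsub2 hsub3
  have m2 : ∫ y in ball y (R / 2 / 2), willDensity (ε k) (u k) y ≤
      ∫ y in ball x (3 / 4 * R), willDensity (ε k) (u k) y :=
    setIntegral_le_of_subset_closedBall (continuousOn_willDensity h.isOpen hk _)
      (willDensity_nonneg _ _) hsubΩ hsub2 hsub3
  have m3 := div_le_div_of_nonneg_right m2 (h.pos k).le
  rw [mul_div_cancel₀ _ hc0.ne'] at k1 k2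
  have := hA Ω h.isOpen (u k) hk y (R / 2) (half_pos hR) hsub1 (ε k) (h.pos k)
    (by rw [← mul_assoc]; exact k3) (hb _ hyI) (m3.trans k2.le)
  linarith

/-- Near points of the support every value in `(-1, 1)` is eventually attained. -/
lemma eventually_exists_eq [IsFiniteMeasure μ] [IsFiniteMeasure α]
    (h : IsLimitData Ω ε u μ α) (hx : x ∈ Ω) (hμ : x ∈ sptM μ)
    {s₀ : ℝ} (h0 : -1 < s₀) (h1 : s₀ < 1) (hr : 0 < r) :
    ∀ᶠ k in atTop, ∃ y ∈ Ω ∩ ball x r, u k y = s₀ := by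
  obtain ⟨s, hs, H⟩ := exists_local_energy_decay
  obtain ⟨δ, hδ, H⟩ := H s₀ h0 h1
  have hc0 := c0_pos
  obtain ⟨r₁, hr₁, hsub₁⟩ := Metric.mem_nhds_iff.1
    (inter_mem (h.isOpen.mem_nhds hx) (ball_mem_nhds x hr))
  obtain ⟨x', hx'1, hx'2, hx'3⟩ : ∃ x' ∈ ball x r₁, x' ∈ sptM μ ∧ α {x'} = 0 := by
    by_contra hcon
    push Not at hcon
    have hcount : {y | 0 < α {y}}.Countable :=
      Measure.countable_meas_pos_of_disjoint_iUnion (fun y => measurableSet_singleton y)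
        fun y y' hyy => disjoint_singleton.2 hyy
    have n1 : μ (sptM μ)ᶜ = 0 := by
      refine measure_null_of_locally_null _ fun y hy => ?_
      have hy' : ∃ ρ > 0, μ (ball y ρ) = 0 := by
        by_contra hcon'
        push Not at hcon'
        exact hy fun ρ hρ => pos_iff_ne_zero.2 (hcon' ρ hρ)
      obtain ⟨ρ, hρ, hn⟩ := hy'
      exact ⟨ball y ρ, mem_nhdsWithin_of_mem_nhds (ball_mem_nhds y hρ), hn⟩
    have n2 : μ ({y | 0 < α {y}} ∩ ball x r₁) = 0 := by
      rw [← biUnion_of_singleton ({y | 0 < α {y}} ∩ ball x r₁),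
        measure_biUnion_null_iff (hcount.mono inter_subset_left)]
      exact fun y hy => h.measure_singleton (hsub₁ hy.2).1
    refine (hμ r₁ hr₁).ne' (measure_mono_null (fun y hy => ?_) (measure_union_null n1 n2))
    by_cases hs : y ∈ sptM μ
    · exact Or.inr ⟨pos_iff_ne_zero.2 (hcon y hy hs), hy⟩
    · exact Or.inl hs
  obtain ⟨R, hR, hsub, hαR⟩ := exists_closedBall_measure_lt hx'3 (div_pos hδ hc0)
    (isOpen_ball.mem_nhds hx'1)
  have hsubΩ : closedBall x' R ⊆ Ω := fun y hy => (hsub₁ (hsub hy)).1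
  have hμ0 : 0 ≤ μ.real univ := measureReal_nonneg
  obtain ⟨K, hK, H⟩ := H (c0 * (μ.real univ + 1) / R ^ 2) (by positivity)
  have hpos : 0 < μ.real (ball x' (R / 2 ^ 9)) :=
    ENNReal.toReal_pos (hx'2 _ (by positivity)).ne' (measure_ne_top μ _)
  set m₀ := c0 * (μ.real (ball x' (R / 2 ^ 9)) / 2) with hm₀
  have hm₀0 : 0 < m₀ := by positivity
  obtain ⟨m, hm⟩ := exists_nat_gt (K * R ^ 2 / m₀)
  rw [div_lt_iff₀ hm₀0] at hm
  have hsub8 : closedBall x' (R / 2 ^ 8) ⊆ Ω :=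
    (closedBall_subset_closedBall (by linarith)).trans hsubΩ
  filter_upwards [h.eventually_lt_area (r := R / 2 ^ 9) (R := R / 2 ^ 8) (by positivity)
      (by linarith) hsub8 (half_lt_self hpos),
    h.eventually_area_lt (half_pos hR) (half_lt_self hR) hsubΩ
      ((measureReal_mono (subset_univ _)).trans_lt (lt_add_one _)),
    h.eventually_will_lt (half_pos hR) (half_lt_self hR) hsubΩ hαR,
    h.eventually_mul_le (2 ^ (m + 6) * s) (half_pos hR)] with k k1 k2 k3 k4
  by_contra hcon
  push Not at hcon
  rw [mul_div_cancel₀ _ hc0.ne'] at k3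
  have hsubR : ball x' (R / 2) ⊆ closedBall x' R :=
    (ball_subset_ball (by linarith)).trans ball_subset_closedBall
  have key := H Ω h.isOpen (u k) (h.contDiffOn k) x' R hR hsubΩ (ε k) (h.pos k) m
    (by rw [← mul_assoc]; exact k4) (by rw [div_mul_cancel₀ _ (by positivity)]; exact k2.le)
    k3.le fun y hy => hcon y (hsub₁ (hsub (hsubR hy)))
  rw [← hm₀] at k1
  have := mul_le_mul_of_nonneg_left k1.le (Nat.cast_nonneg (α := ℝ) m)
  linarith

end IsLimitData

/-- Blaschke selection: closures of nonempty subsets of a bounded set subconverge in the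
Hausdorff distance. -/
lemma exists_subseq_hausdorffDist_tendsto {X : Type*} [MetricSpace X]
    {C : Set X} (hC : IsCompact C) {S : ℕ → Set X} (hSC : ∀ k, S k ⊆ C)
    (hS : ∀ k, (S k).Nonempty) :
    ∃ φ : ℕ → ℕ, StrictMono φ ∧ ∃ K : Set X, IsCompact K ∧ K ⊆ C ∧ K.Nonempty ∧
      Tendsto (fun j => hausdorffDist (closure (S (φ j))) K) atTop (nhds 0) := by
  have := isCompact_iff_compactSpace.1 hC
  have hcl : ∀ k, closure (S k) ⊆ C := fun k => closure_minimal (hSC k) hC.isClosed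
  have himg : ∀ k, ((↑) : C → X) '' ((↑) ⁻¹' closure (S k)) = closure (S k) := fun k => by
    rw [Subtype.image_preimage_coe, inter_eq_right.2 (hcl k)]
  let T : ℕ → TopologicalSpace.NonemptyCompacts C := fun k =>
    ⟨⟨(↑) ⁻¹' closure (S k), (isClosed_closure.preimage continuous_subtype_val).isCompact⟩,
      image_nonempty.1 ((himg k).symm ▸ (hS k).closure)⟩
  obtain ⟨L, φ, hφ, hL⟩ := CompactSpace.tendsto_subseq T
  refine ⟨φ, hφ, (↑) '' (L : Set C), L.isCompact.image continuous_subtype_val,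
    Subtype.coe_image_subset _ _, L.nonempty.image _, ?_⟩
  refine (tendsto_iff_dist_tendsto_zero.1 hL).congr fun j => ?_
  rw [← himg, hausdorffDist_image isometry_subtype_coe]
  exact Metric.NonemptyCompacts.dist_eq

theorem stmt17 (Ω : Set (E 3)) (hΩo : IsOpen Ω) (hΩb : Bornology.IsBounded Ω)
    (ε : ℕ → ℝ) (hεpos : ∀ k, 0 < ε k) (hε0 : Tendsto ε atTop (nhds 0))
    (u : ℕ → E 3 → ℝ) (hu : ∀ k, ContDiffOn ℝ 2 (u k) (closure Ω))
    (A : ℝ) (hA : ∀ k, Se (ε k) Ω (u k) + We (ε k) Ω (u k) ≤ A)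
    (θ : ℝ) (hθ : 1 ≤ θ) (hbd : ∀ k, ∀ x ∈ frontier Ω, |u k x| ≤ θ)
    (μ α : Measure (E 3)) [IsFiniteMeasure μ] [IsFiniteMeasure α]
    (hμ : weakConvA Ω ε u μ) (hα : weakConvW Ω ε u α)
    (ulim : E 3 → ℝ)
    (hL1 : Tendsto (fun k => ∫ x in Ω, |u k x - ulim x|) atTop (nhds 0))
    (hpm : ∀ x ∈ Ω \ sptM μ, ulim x = 1 ∨ ulim x = -1)
    (hlc : ∀ x ∈ Ω \ sptM μ, ∃ ρ > 0, ∀ y ∈ ball x ρ, y ∈ Ω \ sptM μ → ulim y = ulim x)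
    (I : Set ℝ) (hIne : I.Nonempty) (hIc : IsCompact I) (hIsub : I ⊆ Set.Ioo (-1) 1)
    (hnoatom : ∀ x ∈ Ω \ sptM μ, α {x} = 0) :
    ∃ φ : ℕ → ℕ, StrictMono φ ∧
      ∃ K : Set (E 3), IsCompact K ∧ K ⊆ closure Ω ∧
        Tendsto (fun j => Metric.hausdorffDist (closure (Ω ∩ u (φ j) ⁻¹' I)) K)
          atTop (nhds 0) ∧
        K ∩ Ω = sptM μ ∩ Ω := by
  have h : IsLimitData Ω ε u μ α :=
    ⟨hΩo, hεpos, hε0, fun k => (hu k).mono subset_closure, hμ, hα⟩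
  obtain ⟨s₀, hs₀⟩ := hIne
  obtain ⟨hs1, hs2⟩ := hIsub hs₀
  by_cases hemp : ∃ᶠ k in atTop, Ω ∩ u k ⁻¹' I = ∅
  · obtain ⟨φ, hφ, hφe⟩ := extraction_of_frequently_atTop hemp
    refine ⟨φ, hφ, ∅, isCompact_empty, empty_subset _, by simp, ?_⟩
    rw [empty_inter, eq_comm, eq_empty_iff_forall_notMem]
    rintro x ⟨hxμ, hxΩ⟩
    obtain ⟨k, hk, y, ⟨hyΩ, -⟩, hy⟩ :=
      (hemp.and_eventually (h.eventually_exists_eq hxΩ hxμ hs1 hs2 one_pos)).exists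
    exact (eq_empty_iff_forall_notMem.1 hk y) ⟨hyΩ, by rw [mem_preimage, hy]; exact hs₀⟩
  · rw [not_frequently, eventually_atTop] at hemp
    obtain ⟨k₀, hk₀⟩ := hemp
    obtain ⟨φ, hφ, K, hK, hKΩ, hKne, hlim⟩ := exists_subseq_hausdorffDist_tendsto
      hΩb.isCompact_closure (S := fun k => Ω ∩ u (k + k₀) ⁻¹' I)
      (fun k => inter_subset_left.trans subset_closure)
      fun k => nonempty_iff_ne_empty.2 (hk₀ _ (Nat.le_add_left _ _))
    have hφ' : StrictMono fun j => φ j + k₀ := fun a b hab => Nat.add_lt_add_right (hφ hab) k₀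
    have hfin : ∀ j, hausdorffEDist (closure (Ω ∩ u (φ j + k₀) ⁻¹' I)) K ≠ ⊤ := fun j =>
      hausdorffEDist_ne_top_of_nonempty_of_bounded
        (nonempty_iff_ne_empty.2 (hk₀ _ (Nat.le_add_left _ _))).closure hKne
        (hΩb.subset inter_subset_left).closure hK.isBounded
    refine ⟨_, hφ', K, hK, hKΩ, hlim, Subset.antisymm ?_ ?_⟩
    · rintro x ⟨hxK, hxΩ⟩
      refine ⟨?_, hxΩ⟩
      by_contra hxμ
      obtain ⟨r, hr, hr'⟩ := h.exists_eventually_notMem hxΩ hxμ (hnoatom x ⟨hxΩ, hxμ⟩) hIc hIsub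
      obtain ⟨j, hj, hj'⟩ :=
        ((hlim.eventually_lt_const hr).and (hφ'.tendsto_atTop.eventually hr')).exists
      obtain ⟨y, hy, hyx⟩ := exists_dist_lt_of_hausdorffDist_lt' hxK hj (hfin j)
      obtain ⟨z, hz, hzΩ, hzI⟩ := mem_closure_iff.1 hy (ball x r) isOpen_ball hyx
      exact hj' z hz hzI
    · rintro x ⟨hxμ, hxΩ⟩
      refine ⟨?_, hxΩ⟩
      rw [← hK.isClosed.closure_eq, Metric.mem_closure_iff]
      intro r hr
      obtain ⟨j, hj, y, ⟨hyΩ, hyx⟩, hy⟩ := ((hlim.eventually_lt_const (half_pos hr)).and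
        (hφ'.tendsto_atTop.eventually
          (h.eventually_exists_eq hxΩ hxμ hs1 hs2 (half_pos hr)))).exists
      have hyI : y ∈ Ω ∩ u (φ j + k₀) ⁻¹' I := ⟨hyΩ, by rw [mem_preimage, hy]; exact hs₀⟩
      obtain ⟨z, hz, hyz⟩ := exists_dist_lt_of_hausdorffDist_lt (subset_closure hyI) hj (hfin j)
      exact ⟨z, hz, by linarith [dist_triangle x y z, mem_ball'.1 hyx]⟩

end
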